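/- arXiv:1802.08405 — 8 statements merged into one kernel-verified Lean document; each statement's English description precedes it below -/
import Mathlib

section
/- Let P = (1/S, …, 1/S) be the uniform distribution on S ≥ 2 elements and let Pₙ denote the empirical distribution of n i.i.d. samples from P. Then for all n ≥ S, E_P ‖Pₙ^< − P^<‖₁ = E_P ‖Pₙ − P‖₁ ≥ √((S−1)/(2n)). -/
open MeasureTheory Filter

/-- The vector `P` sorted in ascending order. -/
noncomputable def sortVec {S : ℕ} (P : Fin S → ℝ) : Fin S → ℝ := P ∘ Tuple.sort P

/-- The ℓ₁ distance between two vectors in ℝ^S. -/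
noncomputable def l1 {S : ℕ} (v w : Fin S → ℝ) : ℝ := ∑ i, |v i - w i|

/-- Expectation of `f` over `n` i.i.d. samples from the discrete distribution `P`. -/
noncomputable def iidExp {S n : ℕ} (P : Fin S → ℝ) (f : (Fin n → Fin S) → ℝ) : ℝ :=
  ∑ x : Fin n → Fin S, (∏ m, P (x m)) * f x

/-- The empirical distribution of the samples `x`. -/
noncomputable def emp {S n : ℕ} (x : Fin n → Fin S) : Fin S → ℝ :=
  fun i => ((Finset.univ.filter fun m => x m = i).card : ℝ) / n

open Finset in
/-- The number of occurrences of `i` among `n` uniform samples is binomially distributed. -/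
theorem iidExp_uniform_count {S : ℕ} (hS : S ≠ 0) (i : Fin S) (n : ℕ) (f : ℕ → ℝ) :
    iidExp (fun _ : Fin S => (S : ℝ)⁻¹)
        (fun x : Fin n → Fin S => f (univ.filter fun m => x m = i).card) =
      ∑ ij ∈ antidiagonal n,
        (n.choose ij.1 : ℝ) * ((S : ℝ)⁻¹ ^ ij.1 * (1 - (S : ℝ)⁻¹) ^ ij.2 * f ij.1) := by
  have hS' : (S : ℝ) ≠ 0 := by exact_mod_cast hS
  induction n generalizing f with
  | zero => simp [iidExp]
  | succ n ih =>
    have hcount (a : Fin S) (x : Fin n → Fin S) :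
        (univ.filter fun m => (Fin.cons a x : Fin (n + 1) → Fin S) m = i).card =
          (if a = i then 1 else 0) + (univ.filter fun m => x m = i).card := by
      simp only [card_filter, Fin.sum_univ_succ, Fin.cons_zero, Fin.cons_succ]
    have hrec : iidExp (fun _ : Fin S => (S : ℝ)⁻¹)
        (fun x : Fin (n + 1) → Fin S => f (univ.filter fun m => x m = i).card) =
        (1 - (S : ℝ)⁻¹) * iidExp (fun _ : Fin S => (S : ℝ)⁻¹)
          (fun x : Fin n → Fin S => f (univ.filter fun m => x m = i).card) +
        (S : ℝ)⁻¹ * iidExp (fun _ : Fin S => (S : ℝ)⁻¹)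
          (fun x : Fin n → Fin S => f ((univ.filter fun m => x m = i).card + 1)) := by
      unfold iidExp
      rw [← (Fin.consEquiv fun _ => Fin S).sum_comp, Fintype.sum_prod_type, sum_comm]
      simp only [Fin.consEquiv_apply, hcount, prod_const, card_univ, Fintype.card_fin]
      rw [mul_sum, mul_sum, ← sum_add_distrib]
      refine sum_congr rfl fun x _ => ?_
      rw [← add_sum_erase _ _ (mem_univ i), sum_congr rfl
        (g := fun _ => (S : ℝ)⁻¹ ^ (n + 1) * f (univ.filter fun m => x m = i).card)
        (fun a ha => by simp [ne_of_mem_erase ha])]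
      simp only [sum_const, card_erase_of_mem (mem_univ i), card_univ, Fintype.card_fin,
        nsmul_eq_mul, Nat.cast_pred (Nat.pos_of_ne_zero hS), if_true, add_comm 1]
      linear_combination
        ((S : ℝ)⁻¹ ^ n * f (univ.filter fun m => x m = i).card) * mul_inv_cancel₀ hS'
    rw [hrec, ih f, ih fun m => f (m + 1), sum_antidiagonal_choose_succ_mul
      (fun a b => (S : ℝ)⁻¹ ^ a * (1 - (S : ℝ)⁻¹) ^ b * f a), mul_sum, mul_sum]
    congr 1 <;> refine sum_congr rfl fun ij h => ?_
    · ring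
    · rw [← mem_antidiagonal.1 h, Nat.choose_symm_add]
      ring

open Finset in
/-- De Moivre's formula for the mean absolute deviation of a binomial distribution. -/
theorem sum_binomial_mul_abs_sub {n k : ℕ} {p : ℝ} (hk : (k : ℝ) ≤ n * p)
    (hk' : n * p ≤ k + 1) (hkn : k ≤ n) :
    ∑ ij ∈ antidiagonal n, (n.choose ij.1 : ℝ) *
        (p ^ ij.1 * (1 - p) ^ ij.2 * |(ij.1 : ℝ) - n * p|) =
      2 * ((k + 1) * n.choose (k + 1) * p ^ (k + 1) * (1 - p) ^ (n - k)) := by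
  set T : ℕ → ℝ := fun j => j * n.choose j * p ^ j * (1 - p) ^ (n + 1 - j) with hT
  have hstep (j : ℕ) (hj : j ≤ n) :
      (n.choose j : ℝ) * (p ^ j * (1 - p) ^ (n - j)) * (j - n * p) = T j - T (j + 1) := by
    have h := congrArg (Nat.cast : ℕ → ℝ) (Nat.choose_succ_right_eq n j)
    push_cast [hj] at h
    obtain ⟨l, rfl⟩ := Nat.exists_eq_add_of_le hj
    simp only [hT, show j + l + 1 - j = l + 1 by omega, show j + l + 1 - (j + 1) = l by omega,
      Nat.add_sub_cancel_left]
    push_cast at h ⊢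
    linear_combination p ^ (j + 1) * (1 - p) ^ l * h
  rw [Nat.sum_antidiagonal_eq_sum_range_succ_mk,
    ← sum_range_add_sum_Ico _ (show k + 1 ≤ n.succ by omega)]
  have h₁ : ∑ j ∈ range (k + 1), (n.choose j : ℝ) *
      (p ^ j * (1 - p) ^ (n - j) * |(j : ℝ) - n * p|) = T (k + 1) := by
    rw [sum_congr rfl (g := fun j => T (j + 1) - T j), sum_range_sub]
    · simp [hT]
    · intro j hj
      have hj' : j ≤ k := by simpa [Nat.lt_succ_iff] using hj
      have : (j : ℝ) ≤ k := by exact_mod_cast hj'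
      rw [abs_of_nonpos (by linarith)]
      linear_combination -hstep j (hj'.trans hkn)
  have h₂ : ∑ j ∈ Ico (k + 1) n.succ, (n.choose j : ℝ) *
      (p ^ j * (1 - p) ^ (n - j) * |(j : ℝ) - n * p|) = T (k + 1) := by
    rw [sum_congr rfl (g := fun j => -(T (j + 1) - T j)), sum_neg_distrib,
      sum_Ico_sub T (by omega)]
    · simp [hT]
    · intro j hj
      rw [mem_Ico] at hj
      have : ((k + 1 : ℕ) : ℝ) ≤ j := by exact_mod_cast hj.1
      push_cast at this
      rw [abs_of_nonneg (by linarith)]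
      linear_combination hstep j (by omega)
  rw [h₁, h₂]
  simp only [hT, Nat.add_sub_add_right]
  push_cast
  ring

theorem stirlingSeq_pos {m : ℕ} (hm : m ≠ 0) : 0 < Stirling.stirlingSeq m := by
  obtain ⟨m, rfl⟩ := Nat.exists_eq_succ_of_ne_zero hm
  exact Stirling.stirlingSeq'_pos m

/-- The decrements of the logarithm of the Stirling sequence are decreasing. -/
theorem log_stirlingSeq_sub_antitone : Antitone fun m : ℕ =>
    Real.log (Stirling.stirlingSeq (m + 1)) - Real.log (Stirling.stirlingSeq (m + 2)) := by
  intro a b hab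
  refine hasSum_le (fun i => ?_) (Stirling.log_stirlingSeq_sdiff_hasSum b)
    (Stirling.log_stirlingSeq_sdiff_hasSum a)
  gcongr

theorem stirlingSeq_two : Stirling.stirlingSeq 2 = Real.exp 1 ^ 2 / 4 := by
  have h : √(2 * ((2 : ℕ) : ℝ)) = 2 := by
    rw [show (2 * ((2 : ℕ) : ℝ)) = 2 ^ 2 by norm_num]
    exact Real.sqrt_sq (by norm_num)
  rw [Stirling.stirlingSeq, h]
  have := Real.exp_pos 1
  push_cast [Nat.factorial]
  field_simp
  norm_num

theorem stirlingSeq_mul_le {k j : ℕ} (hk : k ≠ 0) (hj : j ≠ 0) :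
    Stirling.stirlingSeq k * Stirling.stirlingSeq j ≤ 2 * Stirling.stirlingSeq (k + j) := by
  have hbase : Real.log (Stirling.stirlingSeq 1) + Real.log (Stirling.stirlingSeq 1) =
      Real.log 2 + Real.log (Stirling.stirlingSeq 2) := by
    have h1 : Stirling.stirlingSeq 1 ≠ 0 := (stirlingSeq_pos one_ne_zero).ne'
    have h2 : Stirling.stirlingSeq 2 ≠ 0 := (stirlingSeq_pos two_ne_zero).ne'
    rw [← Real.log_mul h1 h1, ← Real.log_mul two_ne_zero h2, Stirling.stirlingSeq_one,
      stirlingSeq_two, div_mul_div_comm, Real.mul_self_sqrt zero_le_two]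
    ring_nf
  have hone (b : ℕ) : Real.log (Stirling.stirlingSeq 1) +
      Real.log (Stirling.stirlingSeq (b + 1)) ≤
      Real.log 2 + Real.log (Stirling.stirlingSeq (b + 2)) := by
    induction b with
    | zero => exact hbase.le
    | succ b ih =>
      have := log_stirlingSeq_sub_antitone b.le_succ
      simp only [Nat.succ_eq_add_one, add_assoc, Nat.reduceAdd] at this ⊢
      linarith
  have hgen (a b : ℕ) : Real.log (Stirling.stirlingSeq (a + 1)) +
      Real.log (Stirling.stirlingSeq (b + 1)) ≤
      Real.log 2 + Real.log (Stirling.stirlingSeq (a + b + 2)) := by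
    induction a with
    | zero => simpa using hone b
    | succ a ih =>
      have := log_stirlingSeq_sub_antitone (show a ≤ a + b + 1 by omega)
      simp only [show a + b + 1 + 1 = a + b + 2 by ring,
        show a + b + 1 + 2 = a + 1 + b + 2 by ring] at this
      linarith
  obtain ⟨a, rfl⟩ := Nat.exists_eq_add_one_of_ne_zero hk
  obtain ⟨b, rfl⟩ := Nat.exists_eq_add_one_of_ne_zero hj
  have h := hgen a b
  rw [show a + b + 2 = a + 1 + (b + 1) by ring] at h
  have hab := stirlingSeq_pos (show a + 1 + (b + 1) ≠ 0 by omega)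
  have ha := stirlingSeq_pos hk
  have hb := stirlingSeq_pos hj
  rwa [← Real.log_mul ha.ne' hb.ne', ← Real.log_mul two_ne_zero hab.ne',
    Real.log_le_log_iff (by positivity) (by positivity)] at h

theorem factorial_eq_stirlingSeq_mul {m : ℕ} (hm : m ≠ 0) :
    (m.factorial : ℝ) = Stirling.stirlingSeq m * (√(2 * m) * (m / Real.exp 1) ^ m) := by
  have : (0 : ℝ) < m := by exact_mod_cast Nat.pos_of_ne_zero hm
  rw [Stirling.stirlingSeq]
  field_simp

/-- A lower bound for the central probability of a binomial distribution with integral mean. -/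
theorem add_le_mul_sq_choose {k j : ℕ} (hk : k ≠ 0) (hj : j ≠ 0) :
    ((k + j : ℕ) : ℝ) ≤ 8 * k * j * ((k + j).choose k *
      ((k / (k + j : ℕ) : ℝ) ^ k * (j / (k + j : ℕ) : ℝ) ^ j)) ^ 2 := by
  have hn : k + j ≠ 0 := by omega
  have hk' : (0 : ℝ) < k := by exact_mod_cast Nat.pos_of_ne_zero hk
  have hj' : (0 : ℝ) < j := by exact_mod_cast Nat.pos_of_ne_zero hj
  have hn' : (0 : ℝ) < (k + j : ℕ) := by exact_mod_cast Nat.pos_of_ne_zero hn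
  have hsk := stirlingSeq_pos hk
  have hsj := stirlingSeq_pos hj
  have hsn := stirlingSeq_pos hn
  have hmul := stirlingSeq_mul_le hk hj
  have he := Real.exp_pos 1
  have hsq (x : ℝ) (hx : 0 < x) : √(2 * x) ^ 2 = 2 * x := Real.sq_sqrt (by positivity)
  have heq : ((k + j).choose k : ℝ) *
      ((k / (k + j : ℕ) : ℝ) ^ k * (j / (k + j : ℕ) : ℝ) ^ j) =
      Stirling.stirlingSeq (k + j) / (Stirling.stirlingSeq k * Stirling.stirlingSeq j) *
        (√(2 * (k + j : ℕ)) / (√(2 * k) * √(2 * j))) := by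
    rw [Nat.cast_add_choose, factorial_eq_stirlingSeq_mul hk, factorial_eq_stirlingSeq_mul hj,
      factorial_eq_stirlingSeq_mul hn]
    generalize ((k + j : ℕ) : ℝ) = N at *
    simp only [div_pow, pow_add]
    field_simp
  rw [heq, mul_pow, div_pow, div_pow, mul_pow (√_), hsq _ hk', hsq _ hj', hsq _ hn']
  have hratio : 1 ≤ 4 * (Stirling.stirlingSeq (k + j) ^ 2 /
      (Stirling.stirlingSeq k * Stirling.stirlingSeq j) ^ 2) := by
    rw [← mul_div_assoc, one_le_div (by positivity)]
    calc _ ≤ (2 * Stirling.stirlingSeq (k + j)) ^ 2 := by gcongr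
      _ = _ := by ring
  calc ((k + j : ℕ) : ℝ) = 1 * ((k + j : ℕ) : ℝ) := (one_mul _).symm
    _ ≤ _ := mul_le_mul_of_nonneg_right hratio hn'.le
    _ = _ := by field_simp; ring

theorem min_le_pow_mul_one_sub_pow (a b : ℕ) {x y p : ℝ} (hx : 0 < x) (hy : y < 1)
    (hp : p ∈ Set.Icc x y) :
    min (x ^ a * (1 - x) ^ b) (y ^ a * (1 - y) ^ b) ≤ p ^ a * (1 - p) ^ b := by
  have hxy : x ≤ y := hp.1.trans hp.2
  have hlog {t : ℝ} (ht : t ∈ Set.Ioo (0 : ℝ) 1) :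
      Real.exp (a * Real.log t + b * Real.log (1 - t)) = t ^ a * (1 - t) ^ b := by
    have h1 : 0 < 1 - t := by linarith [ht.2]
    rw [Real.exp_add, mul_comm (a : ℝ), mul_comm (b : ℝ), Real.exp_mul, Real.exp_mul,
      Real.exp_log ht.1, Real.exp_log h1, Real.rpow_natCast, Real.rpow_natCast]
  have hconc : ConcaveOn ℝ (Set.Ioo (0 : ℝ) 1)
      fun t => a * Real.log t + b * Real.log (1 - t) := by
    have h1 : ConcaveOn ℝ (Set.Ioo (0 : ℝ) 1) Real.log :=
      strictConcaveOn_log_Ioi.concaveOn.subset (fun t ht => ht.1) (convex_Ioo 0 1)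
    have h2 : ConcaveOn ℝ (Set.Ioo (0 : ℝ) 1) fun t => Real.log (1 - t) := by
      refine ⟨convex_Ioo 0 1, fun s hs t ht c d hc hd hcd => ?_⟩
      have := strictConcaveOn_log_Ioi.concaveOn.2 (x := 1 - s) (y := 1 - t)
        (sub_pos.2 hs.2) (sub_pos.2 ht.2) hc hd hcd
      simp only [smul_eq_mul] at this ⊢
      convert this using 2
      linear_combination -hcd
    exact (h1.smul a.cast_nonneg).add (h2.smul b.cast_nonneg)
  have h := hconc.min_le_of_mem_Icc (x := x) (y := y) (z := p)
    ⟨hx, hxy.trans_lt hy⟩ ⟨hx.trans_le hxy, hy⟩ hp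
  have := Real.exp_le_exp.2 h
  rwa [Real.exp_monotone.map_min, hlog ⟨hx, hxy.trans_lt hy⟩, hlog ⟨hx.trans_le hxy, hy⟩,
    hlog ⟨hx.trans_le hp.1, hp.2.trans_lt hy⟩] at this

theorem le_sq_deMoivre_term {k j : ℕ} {p : ℝ} (hk : k ≠ 0) (hj : j ≠ 0)
    (hp : (k : ℝ) ≤ (k + j : ℕ) * p) (hp' : (k + j : ℕ) * p ≤ k + 1) (hhalf : p ≤ 1 / 2) :
    (k + j : ℕ) * p * (1 - p) ≤
      8 * ((k + 1) * (k + j).choose (k + 1) * p ^ (k + 1) * (1 - p) ^ j) ^ 2 := by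
  have hk' : (0 : ℝ) < k := by exact_mod_cast Nat.pos_of_ne_zero hk
  have hn' : (0 : ℝ) < (k + j : ℕ) := by positivity
  obtain ⟨l, rfl⟩ := Nat.exists_eq_add_one_of_ne_zero hj
  have hchoose : ((k : ℝ) + 1) * (k + (l + 1)).choose (k + 1) =
      (l + 1) * (k + (l + 1)).choose k := by
    have h := congrArg (Nat.cast : ℕ → ℝ) (Nat.choose_succ_right_eq (k + (l + 1)) k)
    rw [Nat.add_sub_cancel_left] at h
    push_cast at h
    linear_combination h
  have hadd := add_le_mul_sq_choose hk hj
  have hadd' (hl : l ≠ 0) := add_le_mul_sq_choose k.succ_ne_zero hl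
  rw [show k.succ + l = k + (l + 1) by simp; omega] at hadd'
  have hN : ((k + (l + 1) : ℕ) : ℝ) = k + (l + 1) := by push_cast; ring
  generalize ((k + (l + 1) : ℕ) : ℝ) = N at *
  generalize ((k + (l + 1)).choose k : ℝ) = C at *
  generalize ((k + (l + 1)).choose (k + 1) : ℝ) = C' at *
  have hleft : N ≤ 8 * (((k : ℝ) + 1) * C') ^ 2 *
      ((k / N) ^ (2 * k + 1) * (1 - k / N) ^ (2 * l + 1)) := by
    have h1 : 1 - k / N = (l + 1) / N := by field_simp; linarith
    refine hadd.trans_eq ?_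
    rw [h1, hchoose]
    push_cast
    field_simp
    ring
  have hright (hl : l ≠ 0) : N ≤ 8 * (((k : ℝ) + 1) * C') ^ 2 *
      (((k + 1) / N) ^ (2 * k + 1) * (1 - (k + 1) / N) ^ (2 * l + 1)) := by
    have h1 : 1 - (k + 1) / N = l / N := by field_simp; linarith
    refine (hadd' hl).trans_eq ?_
    rw [h1, Nat.succ_eq_add_one]
    push_cast
    field_simp
    ring
  have hkp : k / N ≤ p := by rw [div_le_iff₀ hn']; linarith
  have hpk : p ≤ (k + 1) / N := by rw [le_div_iff₀ hn']; linarith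
  have hmain : N ≤ 8 * (((k : ℝ) + 1) * C') ^ 2 *
      (p ^ (2 * k + 1) * (1 - p) ^ (2 * l + 1)) := by
    rcases eq_or_ne l 0 with rfl | hl
    · have : p = k / N := by
        refine le_antisymm (hhalf.trans ?_) hkp
        have : (1 : ℝ) ≤ k := by exact_mod_cast Nat.one_le_iff_ne_zero.2 hk
        rw [le_div_iff₀ hn', hN, Nat.cast_zero]
        linarith
      rwa [this]
    · have hl' : (0 : ℝ) < l := by exact_mod_cast Nat.pos_of_ne_zero hl
      have hmin := min_le_pow_mul_one_sub_pow (2 * k + 1) (2 * l + 1) (x := k / N)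
        (y := (k + 1) / N) (p := p) (by positivity)
        (by rw [div_lt_one hn', hN]; linarith) ⟨hkp, hpk⟩
      rcases min_le_iff.1 hmin with h | h
      · exact hleft.trans (by gcongr)
      · exact (hright hl).trans (by gcongr)
  have hp0 : 0 < p := (div_pos hk' hn').trans_le hkp
  have hq0 : 0 < 1 - p := by linarith
  calc N * p * (1 - p) ≤ 8 * (((k : ℝ) + 1) * C') ^ 2 *
      (p ^ (2 * k + 1) * (1 - p) ^ (2 * l + 1)) * p * (1 - p) := by gcongr
    _ = _ := by ring

theorem l1_sortVec_const {S : ℕ} (v : Fin S → ℝ) (c : ℝ) :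
    l1 (sortVec v) (sortVec fun _ => c) = l1 v fun _ => c :=
  Equiv.sum_comp (Tuple.sort v) fun i => |v i - c|

open Finset in
theorem iidExp_l1_emp_uniform {S n : ℕ} (hS : S ≠ 0) (hn : n ≠ 0) :
    iidExp (fun _ : Fin S => (S : ℝ)⁻¹)
        (fun x : Fin n → Fin S => l1 (emp x) fun _ => (S : ℝ)⁻¹) =
      S / n * ∑ ij ∈ antidiagonal n, (n.choose ij.1 : ℝ) *
        ((S : ℝ)⁻¹ ^ ij.1 * (1 - (S : ℝ)⁻¹) ^ ij.2 * |(ij.1 : ℝ) - n * (S : ℝ)⁻¹|) := by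
  have hn' : (0 : ℝ) < n := by exact_mod_cast Nat.pos_of_ne_zero hn
  have habs (a : ℝ) : |a / n - (S : ℝ)⁻¹| = (n : ℝ)⁻¹ * |a - n * (S : ℝ)⁻¹| := by
    rw [show a / n - (S : ℝ)⁻¹ = (n : ℝ)⁻¹ * (a - n * (S : ℝ)⁻¹) by field_simp, abs_mul,
      abs_of_pos (inv_pos.2 hn')]
  have hcoord (i : Fin S) := iidExp_uniform_count hS i n fun m => |(m : ℝ) - n * (S : ℝ)⁻¹|
  calc _ = ∑ i : Fin S, (n : ℝ)⁻¹ * iidExp (fun _ : Fin S => (S : ℝ)⁻¹)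
        (fun x : Fin n → Fin S =>
          |((univ.filter fun m => x m = i).card : ℝ) - n * (S : ℝ)⁻¹|) := by
        simp only [iidExp, l1, emp, habs, mul_sum]
        rw [sum_comm]
        exact sum_congr rfl fun i _ => sum_congr rfl fun x _ => by ring
    _ = _ := by
        simp only [hcoord, sum_const, card_univ, Fintype.card_fin, nsmul_eq_mul]
        ring

theorem stmt4 (S n : ℕ) (hS : 2 ≤ S) (hn : S ≤ n) :
    iidExp (fun _ : Fin S => (S : ℝ)⁻¹)
        (fun x : Fin n → Fin S => l1 (sortVec (emp x)) (sortVec fun _ => (S : ℝ)⁻¹)) =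
      iidExp (fun _ : Fin S => (S : ℝ)⁻¹)
        (fun x : Fin n → Fin S => l1 (emp x) fun _ => (S : ℝ)⁻¹) ∧
    Real.sqrt (((S : ℝ) - 1) / (2 * (n : ℝ))) ≤
      iidExp (fun _ : Fin S => (S : ℝ)⁻¹)
        (fun x : Fin n → Fin S => l1 (emp x) fun _ => (S : ℝ)⁻¹) := by
  refine ⟨by simp only [l1_sortVec_const], ?_⟩
  have hS' : (2 : ℝ) ≤ S := by exact_mod_cast hS
  have hn' : (0 : ℝ) < n := by exact_mod_cast (by omega : 0 < n)
  have hp : (S : ℝ)⁻¹ ≤ 1 / 2 := by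
    rw [one_div]
    exact inv_anti₀ two_pos hS'
  have hk : n / S ≠ 0 := (Nat.div_pos hn (by omega)).ne'
  have hkn : n / S < n := Nat.div_lt_self (by omega) (by omega)
  have hlow : ((n / S : ℕ) : ℝ) ≤ n * (S : ℝ)⁻¹ := by
    rw [← div_eq_mul_inv]
    exact Nat.cast_div_le
  have hupp : n * (S : ℝ)⁻¹ ≤ ((n / S : ℕ) : ℝ) + 1 := by
    rw [← div_eq_mul_inv, div_le_iff₀ (by linarith)]
    rw [mul_comm]
    exact_mod_cast (Nat.lt_mul_div_succ n (by omega : 0 < S)).le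
  rw [iidExp_l1_emp_uniform (S := S) (n := n) (by omega) (by omega), sum_binomial_mul_abs_sub hlow hupp hkn.le]
  obtain ⟨j, hj⟩ := Nat.exists_eq_add_of_lt hkn
  generalize n / S = k at *
  subst hj
  have hkey := le_sq_deMoivre_term hk j.succ_ne_zero hlow hupp hp
  have hq : 0 ≤ 1 - (S : ℝ)⁻¹ := by linarith
  rw [show k + j + 1 - k = j + 1 by omega]
  rw [Nat.succ_eq_add_one, ← add_assoc] at hkey
  refine Real.sqrt_le_iff.2 ⟨by positivity, ?_⟩
  generalize ((k : ℝ) + 1) * (k + j + 1).choose (k + 1) * (S : ℝ)⁻¹ ^ (k + 1) *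
    (1 - (S : ℝ)⁻¹) ^ (j + 1) = T at *
  generalize ((k + j + 1 : ℕ) : ℝ) = N at *
  have hS0 : (0 : ℝ) < S := by linarith
  calc ((S : ℝ) - 1) / (2 * N) =
      S ^ 2 / (2 * N ^ 2) * (N * (S : ℝ)⁻¹ * (1 - (S : ℝ)⁻¹)) := by field_simp
    _ ≤ S ^ 2 / (2 * N ^ 2) * (8 * T ^ 2) := by gcongr
    _ = (S / N * (2 * T)) ^ 2 := by field_simp; ring
end

section
/- Let P ∈ [0,1]^S be any vector, let μ be a Borel probability measure on [0,1] with cumulative distribution function F, and define F^{-1}(t) = sup{x : F(x) ≤ t}. Let U₁,…,U_S be independent random variables each uniformly distributed on [0,1], set q_i = F^{-1}((i − U_i)/S) for i = 1,…,S, and let Q = (q₁,…,q_S). Then E[ W(μ_P, μ_Q) ] = W(μ_P, μ), where the expectation is over the randomness U₁,…,U_S. -/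
open MeasureTheory Filter
open scoped ENNReal

/-- The Wasserstein-1 distance with respect to the cost `d`: the infimum over all couplings
`π` of `μ` and `ν` of the expected cost. -/
noncomputable def wass {α : Type*} [MeasurableSpace α] (d : α → α → ℝ) (μ ν : Measure α) : ℝ :=
  sInf { r | ∃ π : Measure (α × α), IsProbabilityMeasure π ∧
    π.map Prod.fst = μ ∧ π.map Prod.snd = ν ∧ r = ∫ p, d p.1 p.2 ∂π }

/-- The uniform probability measure on the multiset of entries of the vector `P`. -/
noncomputable def unifMeas {S : ℕ} (P : Fin S → ℝ) : Measure ℝ :=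
  (S : ℝ≥0∞)⁻¹ • ∑ i : Fin S, Measure.dirac (P i)

/-- The generalized inverse `F⁻¹(t) = sup {x : F(x) ≤ t}` of the CDF of `μ`. -/
noncomputable def cdfInv (μ : Measure ℝ) (t : ℝ) : ℝ :=
  sSup {x : ℝ | (μ (Set.Iic x)).toReal ≤ t}

theorem lintegral_ofReal_abs_sub {Ω : Type*} [MeasurableSpace Ω] (m : Measure Ω) [SFinite m]
    {f g : Ω → ℝ} (hf : Measurable f) (hg : Measurable g) :
    ∫⁻ ω, ENNReal.ofReal |f ω - g ω| ∂m = ∫⁻ z : ℝ, m {ω | z ∈ Set.uIoc (f ω) (g ω)} := by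
  have hE : MeasurableSet {p : Ω × ℝ | p.2 ∈ Set.uIoc (f p.1) (g p.1)} := by
    simp only [Set.mem_uIoc]
    measurability
  have h₁ := Measure.prod_apply (μ := m) (ν := (volume : Measure ℝ)) hE
  rw [Measure.prod_apply_symm hE] at h₁
  refine Eq.trans (lintegral_congr fun ω => ?_) h₁.symm
  rw [abs_sub_comm, ← Real.volume_uIoc]
  rfl

/-- For comonotone random variables, the measure of the symmetric difference of sublevel sets is
minimal among all couplings of their laws. -/
theorem measure_mem_uIoc_le_of_monovaryOn {Ω : Type*} [MeasurableSpace Ω] {m : Measure Ω}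
    [IsProbabilityMeasure m] {f g : Ω → ℝ} {s : Set Ω} (hf : Measurable f) (hg : Measurable g)
    (hs : ∀ᵐ ω ∂m, ω ∈ s) (h : MonovaryOn f g s) {π : Measure (ℝ × ℝ)} [IsProbabilityMeasure π]
    (h₁ : π.map Prod.fst = m.map f) (h₂ : π.map Prod.snd = m.map g) (z : ℝ) :
    m {ω | z ∈ Set.uIoc (f ω) (g ω)} ≤ π {p | z ∈ Set.uIoc p.1 p.2} := by
  have hA : m (f ⁻¹' Set.Iio z) = π (Prod.fst ⁻¹' Set.Iio z) := by
    have := congrArg (fun ν : Measure ℝ => ν (Set.Iio z)) h₁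
    simpa only [Measure.map_apply measurable_fst measurableSet_Iio,
      Measure.map_apply hf measurableSet_Iio] using this.symm
  have hB : m (g ⁻¹' Set.Iio z) = π (Prod.snd ⁻¹' Set.Iio z) := by
    have := congrArg (fun ν : Measure ℝ => ν (Set.Iio z)) h₂
    simpa only [Measure.map_apply measurable_snd measurableSet_Iio,
      Measure.map_apply hg measurableSet_Iio] using this.symm
  change m {ω | f ω < z} = π {p | p.1 < z} at hA
  change m {ω | g ω < z} = π {p | p.2 < z} at hB
  by_cases hsub : ∀ ω ∈ s, f ω < z → g ω < z
  · have hle : {ω | f ω < z} ≤ᵐ[m] {ω | g ω < z} := by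
      filter_upwards [hs] with ω hω using hsub ω hω
    calc m {ω | z ∈ Set.uIoc (f ω) (g ω)} ≤ m ({ω | g ω < z} \ {ω | f ω < z}) := by
          refine measure_mono_ae ?_
          filter_upwards [hs] with ω hω hz
          rcases Set.mem_uIoc.1 hz with hz | hz
          · exact absurd (hsub ω hω hz.1) hz.2.not_gt
          · exact ⟨hz.1, hz.2.not_gt⟩
      _ = m {ω | g ω < z} - m {ω | f ω < z} := by
          rw [← measure_sdiff_add_inter (s := {ω | g ω < z}) (measurableSet_lt hf measurable_const),
            measure_congr (s := {ω | g ω < z} ∩ {ω | f ω < z}) (t := {ω | f ω < z}),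
            ENNReal.add_sub_cancel_right (measure_ne_top _ _)]
          filter_upwards [hle] with ω hω
          exact propext ⟨fun h => h.2, fun h => ⟨hω h, h⟩⟩
      _ = π {p | p.2 < z} - π {p | p.1 < z} := by rw [hA, hB]
      _ ≤ π ({p | p.2 < z} \ {p | p.1 < z}) := le_measure_sdiff
      _ ≤ π {p | z ∈ Set.uIoc p.1 p.2} :=
          measure_mono fun p hp => Set.mem_uIoc.2 (Or.inr ⟨hp.1, not_lt.1 hp.2⟩)
  · push Not at hsub
    obtain ⟨a, ha, hfa, hga⟩ := hsub
    have hsub : ∀ ω ∈ s, g ω < z → f ω < z := fun ω hω hg =>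
      (h hω ha (hg.trans_le hga)).trans_lt hfa
    have hle : {ω | g ω < z} ≤ᵐ[m] {ω | f ω < z} := by
      filter_upwards [hs] with ω hω using hsub ω hω
    calc m {ω | z ∈ Set.uIoc (f ω) (g ω)} ≤ m ({ω | f ω < z} \ {ω | g ω < z}) := by
          refine measure_mono_ae ?_
          filter_upwards [hs] with ω hω hz
          rcases Set.mem_uIoc.1 hz with hz | hz
          · exact ⟨hz.1, hz.2.not_gt⟩
          · exact absurd (hsub ω hω hz.1) hz.2.not_gt
      _ = m {ω | f ω < z} - m {ω | g ω < z} := by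
          rw [← measure_sdiff_add_inter (s := {ω | f ω < z}) (measurableSet_lt hg measurable_const),
            measure_congr (s := {ω | f ω < z} ∩ {ω | g ω < z}) (t := {ω | g ω < z}),
            ENNReal.add_sub_cancel_right (measure_ne_top _ _)]
          filter_upwards [hle] with ω hω
          exact propext ⟨fun h => h.2, fun h => ⟨hω h, h⟩⟩
      _ = π {p | p.1 < z} - π {p | p.2 < z} := by rw [hA, hB]
      _ ≤ π ({p | p.1 < z} \ {p | p.2 < z}) := le_measure_sdiff
      _ ≤ π {p | z ∈ Set.uIoc p.1 p.2} :=
          measure_mono fun p hp => Set.mem_uIoc.2 (Or.inl ⟨hp.1, not_lt.1 hp.2⟩)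

/-- The comonotone coupling is optimal for the cost `|x - y|`. -/
theorem wass_map_of_monovaryOn {Ω : Type*} [MeasurableSpace Ω] {m : Measure Ω}
    [IsProbabilityMeasure m] {f g : Ω → ℝ} {s : Set Ω} (hf : Measurable f) (hg : Measurable g)
    (hfi : Integrable f m) (hgi : Integrable g m)
    (hs : ∀ᵐ ω ∂m, ω ∈ s) (h : MonovaryOn f g s) :
    wass (fun x y => |x - y|) (m.map f) (m.map g) = ∫ ω, |f ω - g ω| ∂m := by
  have hmeas : Measurable fun p : ℝ × ℝ => |p.1 - p.2| :=
    continuous_abs.measurable.comp (measurable_fst.sub measurable_snd)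
  refine IsLeast.csInf_eq ⟨⟨m.map fun ω => (f ω, g ω),
    Measure.isProbabilityMeasure_map (hf.prodMk hg).aemeasurable, ?_, ?_, ?_⟩, ?_⟩
  · rw [Measure.map_map measurable_fst (hf.prodMk hg)]
    rfl
  · rw [Measure.map_map measurable_snd (hf.prodMk hg)]
    rfl
  · rw [integral_map (hf.prodMk hg).aemeasurable hmeas.aestronglyMeasurable]
  · rintro r ⟨π, hπ, h₁, h₂, rfl⟩
    have hi₁ : Integrable (fun p : ℝ × ℝ => p.1) π := by
      have : Integrable (fun x : ℝ => x) (π.map Prod.fst) := by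
        rw [h₁]
        exact (integrable_map_measure aestronglyMeasurable_id hf.aemeasurable).2 hfi
      exact (integrable_map_measure aestronglyMeasurable_id measurable_fst.aemeasurable).1 this
    have hi₂ : Integrable (fun p : ℝ × ℝ => p.2) π := by
      have : Integrable (fun x : ℝ => x) (π.map Prod.snd) := by
        rw [h₂]
        exact (integrable_map_measure aestronglyMeasurable_id hg.aemeasurable).2 hgi
      exact (integrable_map_measure aestronglyMeasurable_id measurable_snd.aemeasurable).1 this
    have hi : Integrable (fun p : ℝ × ℝ => |p.1 - p.2|) π := (hi₁.sub hi₂).abs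
    rw [integral_eq_lintegral_of_nonneg_ae (ae_of_all _ fun _ => abs_nonneg _)
        (hmeas.comp (hf.prodMk hg)).aestronglyMeasurable,
      integral_eq_lintegral_of_nonneg_ae (ae_of_all _ fun _ => abs_nonneg _)
        hi.aestronglyMeasurable]
    refine ENNReal.toReal_mono hi.lintegral_lt_top.ne ?_
    rw [lintegral_ofReal_abs_sub m hf hg, lintegral_ofReal_abs_sub π measurable_fst measurable_snd]
    exact lintegral_mono fun z => measure_mem_uIoc_le_of_monovaryOn hf hg hs h h₁ h₂ z

section Quantile

variable {μ : Measure ℝ}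

theorem measure_Iic_eq_zero_of_neg (hμ : μ (Set.Icc (0 : ℝ) 1)ᶜ = 0) {x : ℝ} (hx : x < 0) :
    μ (Set.Iic x) = 0 :=
  measure_mono_null (t := (Set.Icc (0 : ℝ) 1)ᶜ) (fun _ hy h => (h.1.trans hy).not_gt hx) hμ

theorem bddAbove_cdf_le [IsProbabilityMeasure μ] (hμ : μ (Set.Icc (0 : ℝ) 1)ᶜ = 0) {t : ℝ}
    (ht : t < 1) : 1 ∈ upperBounds {x : ℝ | (μ (Set.Iic x)).toReal ≤ t} := by
  intro x hx
  by_contra! h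
  have : μ (Set.Iic x) = 1 :=
    prob_compl_eq_zero_iff measurableSet_Iic |>.1 <|
      measure_mono_null (t := (Set.Icc (0 : ℝ) 1)ᶜ) (fun y hy hy' => hy (hy'.2.trans h.le)) hμ
  simp only [Set.mem_ofPred_eq, this, ENNReal.toReal_one] at hx
  linarith

theorem le_cdfInv [IsProbabilityMeasure μ] (hμ : μ (Set.Icc (0 : ℝ) 1)ᶜ = 0) {t x : ℝ}
    (ht : t < 1) (hx : (μ (Set.Iic x)).toReal ≤ t) : x ≤ cdfInv μ t :=
  le_csSup ⟨1, bddAbove_cdf_le hμ ht⟩ hx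

theorem cdf_le_nonempty (hμ : μ (Set.Icc (0 : ℝ) 1)ᶜ = 0) {t : ℝ} (ht : 0 ≤ t) :
    {x : ℝ | (μ (Set.Iic x)).toReal ≤ t}.Nonempty :=
  ⟨-1, by simpa [measure_Iic_eq_zero_of_neg hμ (by norm_num : (-1 : ℝ) < 0)] using ht⟩

theorem cdfInv_monotoneOn [IsProbabilityMeasure μ] (hμ : μ (Set.Icc (0 : ℝ) 1)ᶜ = 0) :
    MonotoneOn (cdfInv μ) (Set.Ico 0 1) := fun _ ha _ hb hab =>
  csSup_le_csSup ⟨1, bddAbove_cdf_le hμ hb.2⟩ (cdf_le_nonempty hμ ha.1)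
    fun _ hx => le_trans hx hab

theorem cdfInv_eq_zero [IsProbabilityMeasure μ] {t : ℝ} (ht : t ∉ Set.Ico (0 : ℝ) 1) :
    cdfInv μ t = 0 := by
  by_cases h0 : t < 0
  · have : {x : ℝ | (μ (Set.Iic x)).toReal ≤ t} = ∅ :=
      Set.eq_empty_of_forall_notMem fun x hx => (ENNReal.toReal_nonneg.trans hx).not_gt h0
    rw [cdfInv, this, Real.sSup_empty]
  · have : {x : ℝ | (μ (Set.Iic x)).toReal ≤ t} = Set.univ :=
      Set.eq_univ_of_forall fun x =>
        (ENNReal.toReal_mono ENNReal.one_ne_top prob_le_one).trans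
          (by simpa using not_lt.1 fun h1 => ht ⟨not_lt.1 h0, h1⟩)
    rw [cdfInv, this, Real.sSup_univ]

theorem cdfInv_mem_Icc [IsProbabilityMeasure μ] (hμ : μ (Set.Icc (0 : ℝ) 1)ᶜ = 0) (t : ℝ) :
    cdfInv μ t ∈ Set.Icc (0 : ℝ) 1 := by
  by_cases ht : t ∈ Set.Ico (0 : ℝ) 1
  · refine ⟨le_of_forall_lt fun x hx => ?_,
      csSup_le (cdf_le_nonempty hμ ht.1) (bddAbove_cdf_le hμ ht.2)⟩
    obtain ⟨y, hxy, hy⟩ := exists_between hx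
    exact hxy.trans_le (le_cdfInv hμ ht.2 (by simpa [measure_Iic_eq_zero_of_neg hμ hy] using ht.1))
  · simp [cdfInv_eq_zero ht]

theorem measurable_cdfInv [IsProbabilityMeasure μ] (hμ : μ (Set.Icc (0 : ℝ) 1)ᶜ = 0) :
    Measurable (cdfInv μ) := by
  refine measurable_of_Iic fun c => ?_
  have h₁ : MeasurableSet {t | t ∈ Set.Ico (0 : ℝ) 1 ∧ cdfInv μ t ≤ c} := by
    refine Set.OrdConnected.measurableSet ⟨fun a ha b hb t ht => ?_⟩
    have ht' : t ∈ Set.Ico (0 : ℝ) 1 := ⟨ha.1.1.trans ht.1, ht.2.trans_lt hb.1.2⟩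
    exact ⟨ht', (cdfInv_monotoneOn hμ ht' hb.1 ht.2).trans hb.2⟩
  have h₂ : MeasurableSet {t : ℝ | t ∉ Set.Ico (0 : ℝ) 1 ∧ 0 ≤ c} :=
    measurableSet_Ico.compl.inter (MeasurableSet.const _)
  convert h₁.union h₂ using 1
  ext t
  by_cases ht : t ∈ Set.Ico (0 : ℝ) 1
  · simp only [Set.mem_preimage, Set.mem_Iic, Set.mem_union, Set.mem_ofPred_eq, ht, true_and,
      not_true_eq_false, false_and, or_false]
  · simp only [Set.mem_preimage, Set.mem_Iic, Set.mem_union, Set.mem_ofPred_eq, ht, true_and,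
      not_false_eq_true, false_and, false_or, cdfInv_eq_zero ht]

theorem map_cdfInv [IsProbabilityMeasure μ] (hμ : μ (Set.Icc (0 : ℝ) 1)ᶜ = 0) :
    (volume.restrict (Set.Icc (0 : ℝ) 1)).map (cdfInv μ) = μ := by
  have : IsFiniteMeasure ((volume.restrict (Set.Icc (0 : ℝ) 1)).map (cdfInv μ)) :=
    Measure.isFiniteMeasure_map _ _
  refine Measure.ext_of_Iic _ _ fun z => ?_
  rw [Measure.map_apply (measurable_cdfInv hμ) measurableSet_Iic,
    Measure.restrict_apply (measurable_cdfInv hμ measurableSet_Iic)]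
  have hF : (μ (Set.Iic z)).toReal ≤ 1 :=
    ENNReal.toReal_mono ENNReal.one_ne_top prob_le_one
  have hvol : μ (Set.Iic z) = ENNReal.ofReal ((μ (Set.Iic z)).toReal - 0) := by
    rw [sub_zero, ENNReal.ofReal_toReal (measure_ne_top _ _)]
  refine le_antisymm ?_ ?_
  · calc _ ≤ volume (Set.Icc 0 (μ (Set.Iic z)).toReal ∪ {1}) := by
          refine measure_mono fun t ht => ?_
          by_contra! h
          simp only [Set.mem_union, Set.mem_Icc, Set.mem_singleton_iff, not_or, not_and,
            not_le] at h
          obtain ⟨hz, ht₀, ht₁⟩ := ht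
          have hright : ∀ᶠ y in nhdsWithin z (Set.Ioi z), ProbabilityTheory.cdf μ y < t :=
            ((ProbabilityTheory.cdf μ).right_continuous z).mono_left
              (nhdsWithin_mono _ Set.Ioi_subset_Ici_self) |>.eventually_lt_const
              (by simpa [ProbabilityTheory.cdf_eq_real, measureReal_def] using h.1 ht₀)
          obtain ⟨y, hy, hzy⟩ := (hright.and self_mem_nhdsWithin).exists
          rw [ProbabilityTheory.cdf_eq_real] at hy
          exact ((le_cdfInv hμ (lt_of_le_of_ne ht₁ h.2) hy.le).trans hz).not_gt hzy
      _ ≤ volume (Set.Icc 0 (μ (Set.Iic z)).toReal) + volume {(1 : ℝ)} := measure_union_le _ _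
      _ = μ (Set.Iic z) := by rw [Real.volume_singleton, add_zero, Real.volume_Icc, ← hvol]
  · rw [hvol, ← Real.volume_Ico]
    refine measure_mono fun t ht => ⟨csSup_le (cdf_le_nonempty hμ ht.1) fun x hx => ?_,
      ht.1, ht.2.le.trans hF⟩
    by_contra! hzx
    exact ((ENNReal.toReal_mono (measure_ne_top _ _)
      (measure_mono (Set.Iic_subset_Iic.2 hzx.le))).trans hx).not_gt ht.2

theorem cdfInv_stratified_mono [IsProbabilityMeasure μ] (hμ : μ (Set.Icc (0 : ℝ) 1)ᶜ = 0) {S : ℕ}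
    {i j : Fin S} (hij : i < j) {u v : ℝ} (hu : u ∈ Set.Ioc (0 : ℝ) 1)
    (hv : v ∈ Set.Ioc (0 : ℝ) 1) :
    cdfInv μ (((i : ℕ) + 1 - u) / S) ≤ cdfInv μ (((j : ℕ) + 1 - v) / S) := by
  have hS : (0 : ℝ) < S := Nat.cast_pos.2 i.pos
  have hmem : ∀ (k : Fin S) {w : ℝ}, w ∈ Set.Ioc (0 : ℝ) 1 →
      ((k : ℕ) + 1 - w) / (S : ℝ) ∈ Set.Ico (0 : ℝ) 1 := by
    intro k w hw
    have h₀ : (0 : ℝ) ≤ (k : ℕ) := Nat.cast_nonneg _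
    have h₁ : ((k : ℕ) : ℝ) + 1 ≤ S := mod_cast k.2
    exact ⟨div_nonneg (by linarith [hw.2]) hS.le, (div_lt_one hS).2 (by linarith [hw.1])⟩
  refine cdfInv_monotoneOn hμ (hmem i hu) (hmem j hv) ?_
  have h : ((i : ℕ) : ℝ) + 1 ≤ (j : ℕ) := mod_cast hij
  gcongr ?_ / _
  linarith [hu.1, hv.2]

end Quantile

/-- The uniform probability measure on `Fin S`. -/
noncomputable def finUnif (S : ℕ) : Measure (Fin S) :=
  (S : ℝ≥0∞)⁻¹ • ∑ i : Fin S, Measure.dirac i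

theorem isProbabilityMeasure_finUnif {S : ℕ} (hS : 0 < S) : IsProbabilityMeasure (finUnif S) :=
  ⟨by simp [finUnif, ENNReal.inv_mul_cancel, hS.ne']⟩

theorem map_finUnif {S : ℕ} (P : Fin S → ℝ) : (finUnif S).map P = unifMeas P := by
  simp [finUnif, unifMeas, Measure.map_finset_sum, Measurable.of_discrete.aemeasurable]

theorem integral_finUnif {S : ℕ} (f : Fin S → ℝ) :
    ∫ i, f i ∂(finUnif S) = (S : ℝ)⁻¹ * ∑ i, f i := by
  rw [finUnif, integral_smul_measure, integral_finsetSum_measure fun i _ => .of_finite]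
  simp

theorem unifMeas_comp_perm {S : ℕ} (P : Fin S → ℝ) (σ : Equiv.Perm (Fin S)) :
    unifMeas (P ∘ σ) = unifMeas P := by
  simp only [unifMeas, Function.comp_apply]
  rw [Equiv.sum_comp σ fun i => Measure.dirac (P i)]

theorem integral_stratified {S : ℕ} (hS : 0 < S) {h : ℝ → ℝ}
    (hh : Integrable h (volume.restrict (Set.Icc (0 : ℝ) 1))) :
    ∫ i : Fin S, ∫ u, h (((i : ℕ) + 1 - u) / S) ∂(volume.restrict (Set.Icc (0 : ℝ) 1)) ∂(finUnif S)
      = ∫ t, h t ∂(volume.restrict (Set.Icc (0 : ℝ) 1)) := by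
  have hS' : (0 : ℝ) < S := Nat.cast_pos.2 hS
  have hsub : ∀ i : ℕ, ∫ u, h (((i : ℕ) + 1 - u) / S) ∂(volume.restrict (Set.Icc (0 : ℝ) 1)) =
      S * ∫ t in (i / S : ℝ)..((i + 1 : ℕ) / S : ℝ), h t := by
    intro i
    rw [integral_Icc_eq_integral_Ioc, ← intervalIntegral.integral_of_le zero_le_one]
    have := intervalIntegral.integral_comp_sub_div (a := 0) (b := 1) h hS'.ne' ((i + 1) / S)
    simp only [← sub_div, smul_eq_mul] at this
    rw [this]
    simp
  rw [integral_finUnif]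
  simp only [hsub]
  rw [Fin.sum_univ_eq_sum_range fun i : ℕ => S * ∫ t in (i / S : ℝ)..((i + 1 : ℕ) / S : ℝ), h t,
    ← Finset.mul_sum, inv_mul_cancel_left₀ hS'.ne',
    intervalIntegral.sum_integral_adjacent_intervals (a := fun i : ℕ => (i / S : ℝ))]
  · rw [integral_Icc_eq_integral_Ioc, ← intervalIntegral.integral_of_le zero_le_one]
    simp [hS'.ne']
  · intro k hk
    have hk' : ((k + 1 : ℕ) : ℝ) ≤ S := Nat.cast_le.2 hk
    refine (intervalIntegrable_iff_integrableOn_Icc_of_le (by gcongr; simp)).2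
      (IntegrableOn.mono_set hh (Set.Icc_subset_Icc (by positivity) ?_))
    exact (div_le_one hS').2 hk'

theorem measurable_stratified (S : ℕ) :
    Measurable fun a : Fin S × ℝ => ((a.1 : ℕ) + 1 - a.2) / (S : ℝ) := by
  have : Measurable fun a : Fin S × ℝ => ((a.1 : ℕ) : ℝ) :=
    (Measurable.of_discrete (f := fun i : Fin S => ((i : ℕ) : ℝ))).comp measurable_fst
  fun_prop

theorem map_stratified {S : ℕ} (hS : 0 < S) :
    ((finUnif S).prod (volume.restrict (Set.Icc (0 : ℝ) 1))).map
      (fun a : Fin S × ℝ => (((a.1 : ℕ) : ℝ) + 1 - a.2) / S) = volume.restrict (Set.Icc (0 : ℝ) 1) := by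
  have := isProbabilityMeasure_finUnif hS
  have hT := measurable_stratified S
  ext A hA
  refine (ENNReal.toReal_eq_toReal_iff' (measure_ne_top _ _) (measure_ne_top _ _)).1 ?_
  have hAm : Measurable (A.indicator fun _ => (1 : ℝ)) := measurable_const.indicator hA
  have hint : ∀ {ν : Measure ℝ} [IsFiniteMeasure ν], Integrable (A.indicator fun _ => (1 : ℝ)) ν :=
    (integrable_const _).indicator hA
  have key := integral_stratified hS (hint (ν := volume.restrict (Set.Icc (0 : ℝ) 1)))
  rw [← integral_prod (fun a : Fin S × ℝ =>
      A.indicator (fun _ => (1 : ℝ)) (((a.1 : ℕ) + 1 - a.2) / S))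
      ((integrable_map_measure hAm.aestronglyMeasurable hT.aemeasurable).1 hint),
    ← integral_map hT.aemeasurable hAm.aestronglyMeasurable, integral_indicator_const _ hA,
    integral_indicator_const _ hA] at key
  simpa [measureReal_def] using key


theorem stmt7 (S : ℕ) (hS : 0 < S) (P : Fin S → ℝ) (hP : ∀ i, P i ∈ Set.Icc (0 : ℝ) 1)
    (μ : Measure ℝ) [IsProbabilityMeasure μ] (hμ : μ (Set.Icc (0 : ℝ) 1)ᶜ = 0) :
    (∫ u : Fin S → ℝ,
        wass (fun x y => |x - y|) (unifMeas P)
          (unifMeas fun i : Fin S => cdfInv μ (((i : ℕ) + 1 - u i) / S))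
        ∂(Measure.pi fun _ : Fin S => volume.restrict (Set.Icc (0 : ℝ) 1))) =
      wass (fun x y => |x - y|) (unifMeas P) μ := by
  set P' := P ∘ Tuple.sort P
  have hP' : Monotone P' := Tuple.monotone_sort P
  have hPP' : unifMeas P = (finUnif S).map P' := by
    rw [map_finUnif, unifMeas_comp_perm]
  have := isProbabilityMeasure_finUnif hS
  have : IsProbabilityMeasure (volume.restrict (Set.Icc (0 : ℝ) 1)) := ⟨by simp⟩
  have hIoc : ∀ᵐ u ∂(volume.restrict (Set.Icc (0 : ℝ) 1)), u ∈ Set.Ioc (0 : ℝ) 1 := by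
    rw [← restrict_Ioc_eq_restrict_Icc]
    exact ae_restrict_mem measurableSet_Ioc
  have hmono : ∀ {i j : Fin S} {u v : ℝ}, u ∈ Set.Ioc (0 : ℝ) 1 → v ∈ Set.Ioc (0 : ℝ) 1 →
      cdfInv μ (((i : ℕ) + 1 - u) / S) < cdfInv μ (((j : ℕ) + 1 - v) / S) → P' i ≤ P' j := by
    intro i j u v hu hv hlt
    refine hP' (not_lt.1 fun hji => ?_)
    exact (cdfInv_stratified_mono hμ hji hv hu).not_gt hlt
  have hmeas := measurable_cdfInv hμ
  have hgm : Measurable fun a : Fin S × ℝ => cdfInv μ (((a.1 : ℕ) + 1 - a.2) / S) :=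
    hmeas.comp (measurable_stratified S)
  have hfm : Measurable fun a : Fin S × ℝ => P' a.1 :=
    (Measurable.of_discrete (f := P')).comp measurable_fst
  have hgi : Integrable (fun a : Fin S × ℝ => cdfInv μ (((a.1 : ℕ) + 1 - a.2) / S))
      ((finUnif S).prod (volume.restrict (Set.Icc (0 : ℝ) 1))) :=
    Integrable.of_mem_Icc 0 1 hgm.aemeasurable (ae_of_all _ fun _ => cdfInv_mem_Icc hμ _)
  have hfi : Integrable (fun a : Fin S × ℝ => P' a.1)
      ((finUnif S).prod (volume.restrict (Set.Icc (0 : ℝ) 1))) :=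
    Integrable.of_mem_Icc 0 1 hfm.aemeasurable (ae_of_all _ fun _ => hP _)
  have hfgi : Integrable (fun a : Fin S × ℝ => |P' a.1 - cdfInv μ (((a.1 : ℕ) + 1 - a.2) / S)|)
      ((finUnif S).prod (volume.restrict (Set.Icc (0 : ℝ) 1))) := (hfi.sub hgi).abs
  have hR : wass (fun x y => |x - y|) (unifMeas P) μ = (S : ℝ)⁻¹ * ∑ i : Fin S,
      ∫ u, |P' i - cdfInv μ (((i : ℕ) + 1 - u) / S)| ∂(volume.restrict (Set.Icc (0 : ℝ) 1)) := by
    have hμ' : μ = ((finUnif S).prod (volume.restrict (Set.Icc (0 : ℝ) 1))).map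
        fun a => cdfInv μ (((a.1 : ℕ) + 1 - a.2) / S) := by
      conv_lhs => rw [← map_cdfInv hμ, ← map_stratified hS,
        Measure.map_map hmeas (measurable_stratified S)]
      rfl
    have hP₁ : unifMeas P = ((finUnif S).prod (volume.restrict (Set.Icc (0 : ℝ) 1))).map
        fun a => P' a.1 := by
      have : (fun a : Fin S × ℝ => P' a.1) = P' ∘ Prod.fst := rfl
      rw [hPP', this, ← Measure.map_map .of_discrete measurable_fst, Measure.map_fst_prod]
      simp
    rw [← integral_finUnif, ← integral_prod _ hfgi, hP₁]
    conv_lhs => rw [hμ']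
    refine wass_map_of_monovaryOn (s := {a | a.2 ∈ Set.Ioc (0 : ℝ) 1}) hfm hgm hfi hgi
      (Measure.quasiMeasurePreserving_snd.ae hIoc) ?_
    intro a ha b hb hlt
    exact hmono ha hb hlt
  have hL : ∀ u : Fin S → ℝ, (∀ i, u i ∈ Set.Ioc (0 : ℝ) 1) →
      wass (fun x y => |x - y|) (unifMeas P)
        (unifMeas fun i : Fin S => cdfInv μ (((i : ℕ) + 1 - u i) / S)) =
      (S : ℝ)⁻¹ * ∑ i : Fin S, |P' i - cdfInv μ (((i : ℕ) + 1 - u i) / S)| := by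
    intro u hu
    rw [hPP', ← map_finUnif fun i : Fin S => cdfInv μ (((i : ℕ) + 1 - u i) / S),
      ← integral_finUnif]
    exact wass_map_of_monovaryOn (s := Set.univ) .of_discrete .of_discrete .of_finite .of_finite
      (ae_of_all _ fun _ => Set.mem_univ _) fun i _ j _ hlt => hmono (hu i) (hu j) hlt
  have hmi : ∀ i : Fin S, Measurable fun u : ℝ => |P' i - cdfInv μ (((i : ℕ) + 1 - u) / S)| :=
    fun i => (measurable_const.sub
      (hmeas.comp ((measurable_const.sub measurable_id).div_const _))).abs
  have hii : ∀ i : Fin S, Integrable (fun u : ℝ => |P' i - cdfInv μ (((i : ℕ) + 1 - u) / S)|)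
      (volume.restrict (Set.Icc (0 : ℝ) 1)) := fun i =>
    Integrable.of_mem_Icc 0 1 (hmi i).aemeasurable <| ae_of_all _ fun u =>
      ⟨abs_nonneg _, by
        have h₁ := hP (Tuple.sort P i)
        have h₂ := cdfInv_mem_Icc hμ (((i : ℕ) + 1 - u) / S)
        exact abs_sub_le_iff.2 ⟨by simp only [P', Function.comp_apply]; linarith [h₁.2, h₂.1],
          by simp only [P', Function.comp_apply]; linarith [h₁.1, h₂.2]⟩⟩
  have hae : ∀ᵐ u ∂(Measure.pi fun _ : Fin S => volume.restrict (Set.Icc (0 : ℝ) 1)),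
      ∀ i, u i ∈ Set.Ioc (0 : ℝ) 1 :=
    ae_all_iff.2 fun i => (Measure.quasiMeasurePreserving_eval
      (μ := fun _ : Fin S => volume.restrict (Set.Icc (0 : ℝ) 1)) i).ae hIoc
  rw [hR, integral_congr_ae (hae.mono hL), integral_const_mul, integral_finsetSum]
  · congr 1
    refine Finset.sum_congr rfl fun i _ => ?_
    exact integral_comp_eval (μ := fun _ : Fin S => volume.restrict (Set.Icc (0 : ℝ) 1))
      (hmi i).aestronglyMeasurable
  · intro i _
    exact (measurePreserving_eval (fun _ : Fin S => volume.restrict (Set.Icc (0 : ℝ) 1))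
      i).integrable_comp_of_integrable (hii i)
end

section
/- Let (S, d) be a separable metric space and let P, Q be Borel probability measures on S with finite first moments (i.e., ∫ d(x, x₀) dP(x) < ∞ and ∫ d(x, x₀) dQ(x) < ∞ for some x₀ ∈ S). Then W(P, Q) = sup over functions f : S → ℝ with Lipschitz norm at most 1 of ( E_P f(X) − E_Q f(X) ). -/
open MeasureTheory

/-- Approximate linear programming duality for the transport problem between finitely supported
probability vectors: a transport plan and a pair of dual potentials whose values differ by at most
`ε`. -/
theorem exists_transportPlan_potentials {ι κ : Type*} [Fintype ι] [Fintype κ]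
    {p : ι → ℝ} {q : κ → ℝ} (hp : p ∈ stdSimplex ℝ ι) (hq : q ∈ stdSimplex ℝ κ)
    (c : ι → κ → ℝ) {ε : ℝ} (hε : 0 < ε) :
    ∃ (w : ι × κ → ℝ) (φ : ι → ℝ) (ψ : κ → ℝ), (∀ z, 0 ≤ w z) ∧ (∀ i, ∑ j, w (i, j) = p i) ∧
      (∀ j, ∑ i, w (i, j) = q j) ∧ (∀ i j, φ i + ψ j ≤ c i j) ∧
      ∑ z, w z * c z.1 z.2 ≤ ∑ i, p i * φ i + ∑ j, q j * ψ j + ε := by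
  classical
  let L : (ι × κ → ℝ) →ₗ[ℝ] (ι → ℝ) × (κ → ℝ) × ℝ :=
    { toFun := fun w => (fun i => ∑ j, w (i, j), fun j => ∑ i, w (i, j), ∑ z, w z * c z.1 z.2)
      map_add' := fun w w' => by
        ext <;> simp [Finset.sum_add_distrib, add_mul]
      map_smul' := fun a w => by
        ext <;> simp [Finset.mul_sum, mul_assoc] }
  have hLcont : Continuous L := L.continuous_of_finiteDimensional
  let F : Set (ι × κ → ℝ) := {w | w ∈ stdSimplex ℝ (ι × κ) ∧ (L w).1 = p ∧ (L w).2.1 = q}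
  have hprod : (fun z : ι × κ => p z.1 * q z.2) ∈ F := by
    refine ⟨⟨fun z => mul_nonneg (hp.1 _) (hq.1 _), ?_⟩, ?_, ?_⟩
    · rw [Fintype.sum_prod_type, ← Finset.sum_mul_sum, hp.2, hq.2, one_mul]
    · ext i
      simp [L, ← Finset.mul_sum, hq.2]
    · ext j
      simp [L, ← Finset.sum_mul, hp.2]
  have hFcomp : IsCompact F := by
    refine (isCompact_stdSimplex ℝ (ι × κ)).inter_right (t := {w | (L w).1 = p ∧ (L w).2.1 = q}) ?_
    exact (isClosed_eq (by fun_prop) continuous_const).inter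
      (isClosed_eq (by fun_prop) continuous_const)
  obtain ⟨w, hwF, hwmin⟩ := hFcomp.exists_isMinOn (f := fun w => (L w).2.2) ⟨_, hprod⟩
    (by fun_prop)
  have hsep : (p, q, (L w).2.2 - ε) ∉ L '' stdSimplex ℝ (ι × κ) := by
    rintro ⟨w', hw', h⟩
    have h' : w' ∈ F := ⟨hw', by rw [h], by rw [h]⟩
    have := isMinOn_iff.1 hwmin w' h'
    rw [h] at this
    linarith
  obtain ⟨g, a, hga, hgK⟩ := geometric_hahn_banach_point_closed
    ((convex_stdSimplex ℝ (ι × κ)).linear_image L)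
    ((isCompact_stdSimplex ℝ (ι × κ)).image hLcont).isClosed hsep
  let u : ι → ℝ := fun i => g (Pi.single i 1, 0, 0)
  let v : κ → ℝ := fun j => g (0, Pi.single j 1, 0)
  let l : ℝ := g (0, 0, 1)
  have hg : ∀ x y r, g (x, y, r) = ∑ i, x i * u i + ∑ j, y j * v j + r * l := by
    intro x y r
    have h1 : g (x, 0, 0) = ∑ i, x i * u i := by
      change (g.toLinearMap ∘ₗ LinearMap.inl ℝ (ι → ℝ) ((κ → ℝ) × ℝ)) x = _
      exact (congrArg _ (pi_eq_sum_univ' x)).trans (by rw [map_sum]; simp [u]; rfl)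
    have h2 : g (0, y, 0) = ∑ j, y j * v j := by
      change (g.toLinearMap ∘ₗ LinearMap.inr ℝ (ι → ℝ) ((κ → ℝ) × ℝ) ∘ₗ
        LinearMap.inl ℝ (κ → ℝ) ℝ) y = _
      exact (congrArg _ (pi_eq_sum_univ' y)).trans (by rw [map_sum]; simp [v])
    have h3 : g (0, 0, r) = r * l := by
      have := g.map_smul r (0, 0, 1)
      simpa using this
    rw [← h1, ← h2, ← h3, ← map_add, ← map_add]
    simp
  have hgp := hgK _ ⟨_, hprod.1, rfl⟩
  have hLp : L (fun z : ι × κ => p z.1 * q z.2) =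
      (p, q, (L fun z : ι × κ => p z.1 * q z.2).2.2) :=
    Prod.ext hprod.2.1 (Prod.ext hprod.2.2 rfl)
  have hle := isMinOn_iff.1 hwmin _ hprod
  rw [hLp, hg] at hgp
  rw [hg] at hga
  have hl : 0 < l := by
    by_contra! hl
    nlinarith
  have hpot : ∀ i j, a < u i + v j + c i j * l := by
    intro i j
    have h := hgK _ ⟨_, single_mem_stdSimplex ℝ (i, j), rfl⟩
    have hL : L (Pi.single (i, j) 1) = (Pi.single i 1, Pi.single j 1, c i j) := by
      refine Prod.ext ?_ (Prod.ext ?_ ?_)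
      · ext i'
        by_cases h : i' = i <;> simp [L, Pi.single_apply, h, -Finset.sum_boole]
      · ext j'
        by_cases h : j' = j <;> simp [L, Pi.single_apply, h, -Finset.sum_boole]
      · simp [L, Pi.single_apply]
    rw [hL, hg] at h
    simpa [Pi.single_apply] using h
  refine ⟨w, fun i => (a - u i) / l, fun j => - v j / l, hwF.1.1, congrFun hwF.2.1,
    congrFun hwF.2.2, fun i j => ?_, ?_⟩
  · rw [← add_div, div_le_iff₀ hl]
    linarith [hpot i j]
  · change (L w).2.2 ≤ _
    have h1 : ∑ i, p i * ((a - u i) / l) = (a - ∑ i, p i * u i) / l := by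
      simp_rw [mul_div_assoc', mul_sub, ← Finset.sum_div, Finset.sum_sub_distrib,
        ← Finset.sum_mul, hp.2, one_mul]
    have h2 : ∑ j, q j * (- v j / l) = (- ∑ j, q j * v j) / l := by
      simp_rw [mul_div_assoc', mul_neg, ← Finset.sum_div, Finset.sum_neg_distrib]
    rw [h1, h2, ← add_div, ← sub_le_iff_le_add, le_div_iff₀ hl]
    linarith

open ProbabilityTheory in
/-- A transport plan between the laws of two finitely-valued maps `T` and `U` lifts to a coupling
of the underlying probability measures. -/
theorem exists_coupling_of_transportPlan {α β ι κ : Type*} [MeasurableSpace α] [MeasurableSpace β]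
    [Fintype ι] [Fintype κ] [MeasurableSpace ι] [MeasurableSpace κ]
    [MeasurableSingletonClass ι] [MeasurableSingletonClass κ]
    (P : Measure α) (Q : Measure β) [IsProbabilityMeasure P] [IsProbabilityMeasure Q]
    {T : α → ι} {U : β → κ} (hT : Measurable T) (hU : Measurable U)
    {w : ι × κ → ℝ} (hw : ∀ z, 0 ≤ w z) (hwP : ∀ i, ∑ j, w (i, j) = P.real (T ⁻¹' {i}))
    (hwQ : ∀ j, ∑ i, w (i, j) = Q.real (U ⁻¹' {j})) :
    ∃ π : Measure (α × β), IsProbabilityMeasure π ∧ π.map Prod.fst = P ∧ π.map Prod.snd = Q ∧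
      ∀ c : ι → κ → ℝ, ∫ z, c (T z.1) (U z.2) ∂π = ∑ z, w z * c z.1 z.2 := by
  let π : Measure (α × β) :=
    ∑ z, ENNReal.ofReal (w z) • (P[|T ⁻¹' {z.1}]).prod (Q[|U ⁻¹' {z.2}])
  have hP0 : ∀ z, w z ≠ 0 → P[|T ⁻¹' {z.1}] Set.univ = 1 := by
    intro z hz
    have : P (T ⁻¹' {z.1}) ≠ 0 := by
      intro h
      have h0 := hwP z.1
      rw [measureReal_def, h, ENNReal.toReal_zero,
        Finset.sum_eq_zero_iff_of_nonneg fun j _ => hw _] at h0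
      exact hz (h0 z.2 (Finset.mem_univ _))
    have := cond_isProbabilityMeasure this
    exact measure_univ
  have hQ0 : ∀ z, w z ≠ 0 → Q[|U ⁻¹' {z.2}] Set.univ = 1 := by
    intro z hz
    have : Q (U ⁻¹' {z.2}) ≠ 0 := by
      intro h
      have h0 := hwQ z.2
      rw [measureReal_def, h, ENNReal.toReal_zero,
        Finset.sum_eq_zero_iff_of_nonneg fun j _ => hw _] at h0
      exact hz (h0 z.1 (Finset.mem_univ _))
    have := cond_isProbabilityMeasure this
    exact measure_univ
  have hfst : π.map Prod.fst = P := by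
    calc π.map Prod.fst = ∑ z, ENNReal.ofReal (w z) • P[|T ⁻¹' {z.1}] := by
          rw [Measure.map_finset_sum measurable_fst.aemeasurable]
          refine Finset.sum_congr rfl fun z _ => ?_
          rw [Measure.map_smul, Measure.map_fst_prod]
          by_cases hz : w z = 0
          · simp [hz]
          · rw [hQ0 z hz, one_smul]
      _ = ∑ i, P (T ⁻¹' {i}) • P[|T ⁻¹' {i}] := by
          rw [Fintype.sum_prod_type]
          refine Finset.sum_congr rfl fun i _ => ?_
          dsimp only
          rw [← Finset.sum_smul, ← ENNReal.ofReal_sum_of_nonneg fun j _ => hw _, hwP,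
            ofReal_measureReal]
      _ = P := sum_meas_smul_cond_fiber hT P
  have hsnd : π.map Prod.snd = Q := by
    calc π.map Prod.snd = ∑ z, ENNReal.ofReal (w z) • Q[|U ⁻¹' {z.2}] := by
          rw [Measure.map_finset_sum measurable_snd.aemeasurable]
          refine Finset.sum_congr rfl fun z _ => ?_
          rw [Measure.map_smul, Measure.map_snd_prod]
          by_cases hz : w z = 0
          · simp [hz]
          · rw [hP0 z hz, one_smul]
      _ = ∑ j, Q (U ⁻¹' {j}) • Q[|U ⁻¹' {j}] := by
          rw [Fintype.sum_prod_type_right]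
          refine Finset.sum_congr rfl fun j _ => ?_
          dsimp only
          rw [← Finset.sum_smul, ← ENNReal.ofReal_sum_of_nonneg fun i _ => hw _, hwQ,
            ofReal_measureReal]
      _ = Q := sum_meas_smul_cond_fiber hU Q
  have hπ : IsProbabilityMeasure π := by
    constructor
    rw [← Set.preimage_univ (f := Prod.fst), ← Measure.map_apply measurable_fst .univ, hfst,
      measure_univ]
  refine ⟨π, hπ, hfst, hsnd, fun c => ?_⟩
  have hint : Integrable (fun z : α × β => c (T z.1) (U z.2)) π := by
    have hTU : Measurable (Prod.map T U) := hT.prodMap hU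
    exact (Integrable.of_finite (f := fun z : ι × κ => c z.1 z.2)).comp_measurable hTU
  rw [integral_finsetSum_measure (integrable_finsetSum_measure.1 hint)]
  refine Finset.sum_congr rfl fun z _ => ?_
  rw [integral_smul_measure, ENNReal.toReal_ofReal (hw z), smul_eq_mul]
  by_cases hz : w z = 0
  · simp [hz]
  have hae : (fun x : α × β => c (T x.1) (U x.2)) =ᵐ[(P[|T ⁻¹' {z.1}]).prod (Q[|U ⁻¹' {z.2}])]
      fun _ => c z.1 z.2 := by
    have h1 : ∀ᵐ x ∂P[|T ⁻¹' {z.1}], T x = z.1 := ae_cond_mem (hT (measurableSet_singleton _))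
    have h2 : ∀ᵐ x ∂Q[|U ⁻¹' {z.2}], U x = z.2 := ae_cond_mem (hU (measurableSet_singleton _))
    filter_upwards [Measure.quasiMeasurePreserving_fst.ae h1,
      Measure.quasiMeasurePreserving_snd.ae h2] with x hx1 hx2
    rw [hx1, hx2]
  rw [integral_congr_ae hae, integral_const, measureReal_def, ← Set.univ_prod_univ,
    Measure.prod_prod, hP0 z hz, hQ0 z hz]
  simp

/-- A probability measure with finite first moment on a separable metric space is approximated
by its images under finitely-valued maps. -/
theorem exists_simpleFunc_integral_dist_lt {α : Type*} [PseudoMetricSpace α]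
    [TopologicalSpace.SeparableSpace α] [MeasurableSpace α] [OpensMeasurableSpace α]
    {μ : Measure α} {x₀ : α} (hμ : Integrable (fun x => dist x x₀) μ) {ε : ℝ} (hε : 0 < ε) :
    ∃ T : SimpleFunc α α, Integrable (fun x => dist (T x) x) μ ∧ ∫ x, dist (T x) x ∂μ < ε := by
  have : Nonempty α := ⟨x₀⟩
  let e : ℕ → α := fun n => Nat.casesOn n x₀ (TopologicalSpace.denseSeq α)
  let T := SimpleFunc.nearestPt e
  have hmeas : ∀ n, AEStronglyMeasurable (fun x => dist (T n x) x) μ := fun n =>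
    ((T n).measurable.dist measurable_id).aestronglyMeasurable
  have hbound : ∀ n, ∀ᵐ x ∂μ, ‖dist (T n x) x‖ ≤ dist x x₀ := by
    refine fun n => .of_forall fun x => ?_
    rw [Real.norm_of_nonneg dist_nonneg, dist_comm x x₀]
    have h := SimpleFunc.edist_nearestPt_le e x (Nat.zero_le n)
    rw [edist_dist, edist_dist] at h
    exact (ENNReal.ofReal_le_ofReal_iff dist_nonneg).1 h
  have hlim : Filter.Tendsto (fun n => ∫ x, dist (T n x) x ∂μ) Filter.atTop
      (nhds (∫ _, (0 : ℝ) ∂μ)) := by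
    refine tendsto_integral_of_dominated_convergence _ hmeas hμ hbound (.of_forall fun x => ?_)
    refine tendsto_iff_dist_tendsto_zero.1 (SimpleFunc.tendsto_nearestPt ?_)
    have h : Set.range (TopologicalSpace.denseSeq α) ⊆ Set.range e := by
      rintro _ ⟨n, rfl⟩
      exact ⟨n + 1, rfl⟩
    exact closure_mono h (TopologicalSpace.denseRange_denseSeq α x)
  rw [integral_zero] at hlim
  obtain ⟨n, hn⟩ := (hlim.eventually_lt_const hε).exists
  exact ⟨T n, hμ.mono' (hmeas n) (hbound n), hn⟩

theorem LipschitzWith.integrable_of_integrable_dist {α : Type*} [PseudoMetricSpace α]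
    [MeasurableSpace α] [OpensMeasurableSpace α] {μ : Measure α} [IsFiniteMeasure μ] {x₀ : α}
    (hμ : Integrable (fun x => dist x x₀) μ) {f : α → ℝ} (hf : LipschitzWith 1 f) :
    Integrable f μ := by
  refine ((integrable_const ‖f x₀‖).add hμ).mono' hf.continuous.measurable.aestronglyMeasurable
    (.of_forall fun x => ?_)
  have h := hf.dist_le_mul x x₀
  rw [NNReal.coe_one, one_mul, dist_eq_norm] at h
  have := norm_add_le (f x₀) (f x - f x₀)
  rw [add_sub_cancel] at this
  exact this.trans (by simpa using h)

theorem integral_comp_eq_sum_measureReal_preimage {α ι : Type*} [MeasurableSpace α] [Fintype ι]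
    [MeasurableSpace ι] [MeasurableSingletonClass ι] (μ : Measure α) [IsFiniteMeasure μ]
    {T : α → ι} (hT : Measurable T) (g : ι → ℝ) :
    ∫ x, g (T x) ∂μ = ∑ i, μ.real (T ⁻¹' {i}) * g i := by
  rw [← integral_map hT.aemeasurable (measurable_of_finite g).aestronglyMeasurable,
    integral_fintype .of_finite]
  refine Finset.sum_congr rfl fun i _ => ?_
  rw [map_measureReal_apply hT (measurableSet_singleton i), smul_eq_mul]

theorem mem_stdSimplex_measureReal_preimage {α ι : Type*} [MeasurableSpace α] [Fintype ι]
    [MeasurableSpace ι] [MeasurableSingletonClass ι] (μ : Measure α) [IsProbabilityMeasure μ]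
    {T : α → ι} (hT : Measurable T) : (fun i => μ.real (T ⁻¹' {i})) ∈ stdSimplex ℝ ι := by
  refine ⟨fun i => measureReal_nonneg, ?_⟩
  simpa using (integral_comp_eq_sum_measureReal_preimage μ hT fun _ => 1).symm

section Coupling

variable {α : Type*} [MetricSpace α] [TopologicalSpace.SeparableSpace α]
  [MeasurableSpace α] [BorelSpace α] {P Q : Measure α} {x₀ : α} {π : Measure (α × α)}

theorem integrable_dist_of_coupling (hP : Integrable (fun x => dist x x₀) P)
    (hQ : Integrable (fun x => dist x x₀) Q) (hfst : π.map Prod.fst = P)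
    (hsnd : π.map Prod.snd = Q) : Integrable (fun z => dist z.1 z.2) π := by
  have := UniformSpace.secondCountable_of_separable α
  subst hfst hsnd
  refine ((hP.comp_measurable measurable_fst).add (hQ.comp_measurable measurable_snd)).mono'
    (measurable_fst.dist measurable_snd).aestronglyMeasurable (.of_forall fun z => ?_)
  rw [Real.norm_of_nonneg dist_nonneg]
  exact dist_triangle_right _ _ _

theorem LipschitzWith.integral_sub_integral_le_integral_dist [IsFiniteMeasure P]
    [IsFiniteMeasure Q] (hP : Integrable (fun x => dist x x₀) P)
    (hQ : Integrable (fun x => dist x x₀) Q) (hfst : π.map Prod.fst = P)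
    (hsnd : π.map Prod.snd = Q) {f : α → ℝ} (hf : LipschitzWith 1 f) :
    ∫ x, f x ∂P - ∫ x, f x ∂Q ≤ ∫ z, dist z.1 z.2 ∂π := by
  have hd := integrable_dist_of_coupling hP hQ hfst hsnd
  have hfP := hf.integrable_of_integrable_dist hP
  have hfQ := hf.integrable_of_integrable_dist hQ
  subst hfst hsnd
  have hfst : Integrable (fun z => f z.1) π := hfP.comp_measurable measurable_fst
  have hsnd : Integrable (fun z => f z.2) π := hfQ.comp_measurable measurable_snd
  rw [integral_map measurable_fst.aemeasurable hfP.aestronglyMeasurable,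
    integral_map measurable_snd.aemeasurable hfQ.aestronglyMeasurable,
    ← integral_sub hfst hsnd]
  refine integral_mono (hfst.sub hsnd) hd fun z => ?_
  have h := hf.dist_le_mul z.1 z.2
  rw [NNReal.coe_one, one_mul] at h
  exact (le_abs_self _).trans h

/-- Approximate Kantorovich–Rubinstein duality: there are a coupling and a `1`-Lipschitz function
whose values differ by at most `ε`. -/
theorem exists_coupling_lipschitzWith_integral_dist_le [IsProbabilityMeasure P]
    [IsProbabilityMeasure Q] (hP : Integrable (fun x => dist x x₀) P)
    (hQ : Integrable (fun x => dist x x₀) Q) {ε : ℝ} (hε : 0 < ε) :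
    ∃ (π : Measure (α × α)) (f : α → ℝ), IsProbabilityMeasure π ∧ π.map Prod.fst = P ∧
      π.map Prod.snd = Q ∧ LipschitzWith 1 f ∧
      ∫ z, dist z.1 z.2 ∂π ≤ ∫ x, f x ∂P - ∫ x, f x ∂Q + ε := by
  have := UniformSpace.secondCountable_of_separable α
  obtain ⟨T, hTint, hTε⟩ := exists_simpleFunc_integral_dist_lt hP (show 0 < ε / 5 by positivity)
  obtain ⟨U, hUint, hUε⟩ := exists_simpleFunc_integral_dist_lt hQ (show 0 < ε / 5 by positivity)
  let T' : α → Set.range T := Set.rangeFactorization T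
  let U' : α → Set.range U := Set.rangeFactorization U
  have hT' : Measurable T' := T.measurable.subtype_mk
  have hU' : Measurable U' := U.measurable.subtype_mk
  let _ : Fintype (Set.range T) := T.finite_range.fintype
  let _ : Fintype (Set.range U) := U.finite_range.fintype
  have : Nonempty (Set.range U) := ⟨U' x₀⟩
  obtain ⟨w, φ, ψ, hw, hwP, hwQ, hφψ, hle⟩ := exists_transportPlan_potentials
    (mem_stdSimplex_measureReal_preimage P hT') (mem_stdSimplex_measureReal_preimage Q hU')
    (fun i j => dist (i : α) j) (show 0 < ε / 5 by positivity)
  obtain ⟨π, hπ, hfst, hsnd, hπc⟩ := exists_coupling_of_transportPlan P Q hT' hU' hw hwP hwQ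
  let f : α → ℝ := fun x => Finset.univ.inf' Finset.univ_nonempty
    fun j : Set.range U => dist x j - ψ j
  have hf : LipschitzWith 1 f := by
    refine LipschitzWith.of_le_add fun x y => ?_
    rw [← sub_le_iff_le_add]
    refine Finset.le_inf' _ _ fun j _ => ?_
    have h : f x ≤ dist x j - ψ j := Finset.inf'_le _ (Finset.mem_univ j)
    linarith [dist_triangle x y j]
  have hfφ : ∀ i : Set.range T, φ i ≤ f i := fun i =>
    Finset.le_inf' _ _ fun j _ => by linarith [hφψ i j]
  have hfψ : ∀ j : Set.range U, ψ j ≤ - f j := fun j => by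
    have h : f j ≤ dist (j : α) j - ψ j := Finset.inf'_le _ (Finset.mem_univ j)
    rw [dist_self] at h
    linarith
  have hfP := hf.integrable_of_integrable_dist hP
  have hfQ := hf.integrable_of_integrable_dist hQ
  have hfdist : ∀ x y, f x - f y ≤ dist x y := fun x y => by
    have h := hf.dist_le_mul x y
    rw [NNReal.coe_one, one_mul] at h
    exact (le_abs_self _).trans h
  have hboundP : ∑ i, P.real (T' ⁻¹' {i}) * φ i ≤ ∫ x, f x ∂P + ε / 5 := by
    calc ∑ i, P.real (T' ⁻¹' {i}) * φ i ≤ ∑ i, P.real (T' ⁻¹' {i}) * f i :=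
          Finset.sum_le_sum fun i _ => mul_le_mul_of_nonneg_left (hfφ i) measureReal_nonneg
      _ = ∫ x, f (T' x) ∂P := (integral_comp_eq_sum_measureReal_preimage P hT' fun i => f i).symm
      _ ≤ ∫ x, (f x + dist (T x) x) ∂P := by
          refine integral_mono ?_ (hfP.add hTint) fun x => ?_
          · exact (Integrable.of_finite (f := fun i : Set.range T => f i)).comp_measurable hT'
          · linarith [hfdist (T x) x, show f (T' x) = f (T x) from rfl]
      _ = ∫ x, f x ∂P + ∫ x, dist (T x) x ∂P := integral_add hfP hTint
      _ ≤ ∫ x, f x ∂P + ε / 5 := by linarith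
  have hboundQ : ∑ j, Q.real (U' ⁻¹' {j}) * ψ j ≤ - ∫ x, f x ∂Q + ε / 5 := by
    calc ∑ j, Q.real (U' ⁻¹' {j}) * ψ j ≤ ∑ j, Q.real (U' ⁻¹' {j}) * (- f j) :=
          Finset.sum_le_sum fun j _ => mul_le_mul_of_nonneg_left (hfψ j) measureReal_nonneg
      _ = ∫ x, - f (U' x) ∂Q :=
          (integral_comp_eq_sum_measureReal_preimage Q hU' fun j => - f j).symm
      _ ≤ ∫ x, (- f x + dist (U x) x) ∂Q := by
          refine integral_mono ?_ (hfQ.neg.add hUint) fun x => ?_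
          · exact (Integrable.of_finite (f := fun j : Set.range U => - f j)).comp_measurable hU'
          · linarith [hfdist x (U x), dist_comm x (U x), show f (U' x) = f (U x) from rfl]
      _ = - ∫ x, f x ∂Q + ∫ x, dist (U x) x ∂Q := by
          rw [← integral_neg]
          exact integral_add hfQ.neg hUint
      _ ≤ - ∫ x, f x ∂Q + ε / 5 := by linarith
  have hcost : ∫ z, dist z.1 z.2 ∂π ≤ ε / 5 + ∑ z, w z * dist (z.1 : α) z.2 + ε / 5 := by
    have hTπ : Integrable (fun z : α × α => dist (T z.1) z.1) π := by
      subst hfst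
      exact hTint.comp_measurable measurable_fst
    have hUπ : Integrable (fun z : α × α => dist (U z.2) z.2) π := by
      subst hsnd
      exact hUint.comp_measurable measurable_snd
    have hTUπ : Integrable (fun z : α × α => dist (T z.1) (U z.2)) π :=
      (Integrable.of_finite (f := fun z : Set.range T × Set.range U =>
        dist (z.1 : α) z.2)).comp_measurable (hT'.prodMap hU')
    have hTeq : ∫ z, dist (T z.1) z.1 ∂π = ∫ x, dist (T x) x ∂P := by
      subst hfst
      rw [integral_map measurable_fst.aemeasurable hTint.aestronglyMeasurable]
    have hUeq : ∫ z, dist (U z.2) z.2 ∂π = ∫ x, dist (U x) x ∂Q := by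
      subst hsnd
      rw [integral_map measurable_snd.aemeasurable hUint.aestronglyMeasurable]
    calc ∫ z, dist z.1 z.2 ∂π
        ≤ ∫ z, (dist (T z.1) z.1 + dist (T z.1) (U z.2) + dist (U z.2) z.2) ∂π := by
          refine integral_mono (integrable_dist_of_coupling hP hQ hfst hsnd)
            ((hTπ.add hTUπ).add hUπ) fun z => ?_
          linarith [dist_triangle4 z.1 (T z.1) (U z.2) z.2, dist_comm z.1 (T z.1)]
      _ = ∫ z, dist (T z.1) z.1 ∂π + ∫ z, dist (T z.1) (U z.2) ∂π
          + ∫ z, dist (U z.2) z.2 ∂π := by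
          rw [← integral_add hTπ hTUπ]
          exact integral_add (hTπ.add hTUπ) hUπ
      _ ≤ ε / 5 + ∑ z, w z * dist (z.1 : α) z.2 + ε / 5 := by
          rw [hTeq, hUeq]
          have h : ∫ z, dist (T z.1) (U z.2) ∂π = _ := hπc fun i j => dist (i : α) j
          linarith
  exact ⟨π, f, hπ, hfst, hsnd, hf, by linarith⟩

end Coupling

theorem stmt8 {α : Type*} [MetricSpace α] [TopologicalSpace.SeparableSpace α]
    [MeasurableSpace α] [BorelSpace α]
    (P Q : Measure α) [IsProbabilityMeasure P] [IsProbabilityMeasure Q]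
    (x₀ : α) (hP : Integrable (fun x => dist x x₀) P) (hQ : Integrable (fun x => dist x x₀) Q) :
    wass dist P Q =
      sSup { r | ∃ f : α → ℝ, LipschitzWith 1 f ∧ r = (∫ x, f x ∂P) - ∫ x, f x ∂Q } := by
  have hle : ∀ (π : Measure (α × α)) (f : α → ℝ), π.map Prod.fst = P → π.map Prod.snd = Q →
      LipschitzWith 1 f → ∫ x, f x ∂P - ∫ x, f x ∂Q ≤ ∫ z, dist z.1 z.2 ∂π :=
    fun π f hfst hsnd hf => hf.integral_sub_integral_le_integral_dist hP hQ hfst hsnd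
  obtain ⟨π₀, f₀, hπ₀, hfst₀, hsnd₀, hf₀, -⟩ :=
    exists_coupling_lipschitzWith_integral_dist_le hP hQ one_pos
  refine le_antisymm (le_of_forall_pos_le_add fun ε hε => ?_) ?_
  · obtain ⟨π, f, hπ, hfst, hsnd, hf, h⟩ := exists_coupling_lipschitzWith_integral_dist_le hP hQ hε
    calc wass dist P Q ≤ ∫ z, dist z.1 z.2 ∂π := by
          refine csInf_le ⟨0, ?_⟩ ⟨π, hπ, hfst, hsnd, rfl⟩
          rintro _ ⟨π', -, -, -, rfl⟩
          exact integral_nonneg fun _ => dist_nonneg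
      _ ≤ ∫ x, f x ∂P - ∫ x, f x ∂Q + ε := h
      _ ≤ _ := by
          gcongr
          refine le_csSup ⟨∫ z, dist z.1 z.2 ∂π, ?_⟩ ⟨f, hf, rfl⟩
          rintro _ ⟨f', hf', rfl⟩
          exact hle π f' hfst hsnd hf'
  · refine csSup_le ⟨_, f₀, hf₀, rfl⟩ ?_
    rintro _ ⟨f, hf, rfl⟩
    refine le_csInf ⟨_, π₀, hπ₀, hfst₀, hsnd₀, rfl⟩ ?_
    rintro _ ⟨π, -, hfst, hsnd, rfl⟩
    exact hle π f hfst hsnd hf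
end

section
/- Let R(n,S) denote the minimax risk inf_{P̂} sup_{P ∈ M_S} E_P ‖P̂ − P^<‖₁ when the estimator observes n i.i.d. samples from P, and let R_P(n,S) denote the corresponding minimax risk in the Poissonized model, where the estimator observes N i.i.d. samples from P with N ~ Poisson(n) independent of the samples. Then for every even integer n ≥ 2 and every S, (1/2)·R(2n, S) ≤ R_P(n, S) ≤ R(n/2, S) + 2·exp(−n/8). -/
open MeasureTheory Filter
open scoped ENNReal

/-- The probability simplex M_S. -/
def simplex (S : ℕ) : Set (Fin S → ℝ) := {P | (∀ i, 0 ≤ P i) ∧ ∑ i, P i = 1}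

/-- Minimax risk (in `ℝ≥0∞`) of estimating the sorted distribution from exactly `n` i.i.d.
samples (the multinomial model). -/
noncomputable def riskMultinomial (n S : ℕ) : ℝ≥0∞ :=
  ⨅ est : (Fin n → Fin S) → (Fin S → ℝ),
    ⨆ P ∈ simplex S,
      ∑ x : Fin n → Fin S, ENNReal.ofReal ((∏ m, P (x m)) * l1 (est x) (sortVec P))

/-- Minimax risk (in `ℝ≥0∞`) of estimating the sorted distribution in the Poissonized model:
the estimator observes `N` i.i.d. samples, where `N ~ Poisson(n)` is independent of the
samples. -/
noncomputable def riskPoissonized (n S : ℕ) : ℝ≥0∞ :=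
  ⨅ est : List (Fin S) → (Fin S → ℝ),
    ⨆ P ∈ simplex S,
      ∑' N : ℕ, ENNReal.ofReal (Real.exp (-(n : ℝ)) * (n : ℝ) ^ N / N.factorial) *
        ∑ x : Fin N → Fin S,
          ENNReal.ofReal ((∏ m, P (x m)) * l1 (est (List.ofFn x)) (sortVec P))

/-- The Poisson(`r`) weight of `k`. -/
noncomputable def poissonWeight (r k : ℕ) : ℝ :=
  Real.exp (-(r : ℝ)) * (r : ℝ) ^ k / k.factorial

lemma poissonWeight_nonneg (r k : ℕ) : 0 ≤ poissonWeight r k := by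
  unfold poissonWeight; positivity

lemma hasSum_poissonWeight (r : ℕ) : HasSum (poissonWeight r) 1 := by
  unfold poissonWeight
  simpa using ProbabilityTheory.hasSum_one_poissonMeasure (r : NNReal)

lemma poissonWeight_succ_le {r k : ℕ} (hk : 2 * r ≤ k) :
    poissonWeight r (k + 1) ≤ 1 / 2 * poissonWeight r k := by
  have hk' : (2 * r : ℝ) ≤ k := by exact_mod_cast hk
  have hq : (r : ℝ) / (k + 1) ≤ 1 / 2 := by
    rw [div_le_div_iff₀ (by positivity) (by norm_num)]; linarith
  have hrec : poissonWeight r (k + 1) = r / (k + 1) * poissonWeight r k := by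
    unfold poissonWeight
    rw [Nat.factorial_succ, pow_succ]
    push_cast
    field_simp
  rw [hrec]
  exact mul_le_mul_of_nonneg_right hq (poissonWeight_nonneg r k)

/-- A Poisson(`r`) variable is at most `2 r` with probability at least one half. -/
lemma half_le_sum_poissonWeight (r : ℕ) :
    1 / 2 ≤ ∑ k ∈ Finset.range (2 * r + 1), poissonWeight r k := by
  have hs := (hasSum_poissonWeight r).summable
  have h1 := hs.sum_add_tsum_nat_add (2 * r + 1)
  have h0 := hs.sum_add_tsum_nat_add (2 * r)
  rw [(hasSum_poissonWeight r).tsum_eq] at h1 h0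
  have hs0 := (summable_nat_add_iff (2 * r)).2 hs
  have htail : ∑' k, poissonWeight r (k + (2 * r + 1)) ≤
      ∑' k, 1 / 2 * poissonWeight r (k + 2 * r) :=
    ((summable_nat_add_iff (2 * r + 1)).2 hs).tsum_le_tsum
      (fun k => poissonWeight_succ_le (Nat.le_add_left _ k)) (hs0.mul_left _)
  rw [tsum_mul_left] at htail
  have hpos : 0 ≤ ∑ k ∈ Finset.range (2 * r), poissonWeight r k :=
    Finset.sum_nonneg fun k _ => poissonWeight_nonneg r k
  linarith

/-- Chernoff bound for the lower tail of a Poisson variable of mean `2 m`. -/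
lemma sum_poissonWeight_le (m : ℕ) :
    ∑ k ∈ Finset.range m, poissonWeight (2 * m) k ≤ Real.exp (-((2 * m : ℕ) : ℝ) / 8) := by
  have hle : ∀ k ∈ Finset.range m,
      poissonWeight (2 * m) k ≤ Real.exp (-(m : ℝ)) * 2 ^ m * poissonWeight m k := by
    intro k hk
    have hkm : (2 : ℝ) ^ k ≤ 2 ^ m :=
      pow_le_pow_right₀ (by norm_num) (Finset.mem_range.1 hk).le
    have he : Real.exp (-((2 * m : ℕ) : ℝ)) = Real.exp (-(m : ℝ)) * Real.exp (-(m : ℝ)) := by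
      rw [← Real.exp_add]; push_cast; ring_nf
    have heq : poissonWeight (2 * m) k = Real.exp (-(m : ℝ)) * 2 ^ k * poissonWeight m k := by
      unfold poissonWeight
      rw [he]; push_cast; rw [mul_pow]; ring
    rw [heq]
    have := poissonWeight_nonneg m k
    gcongr
  have hone : ∑ k ∈ Finset.range m, poissonWeight m k ≤ 1 :=
    sum_le_hasSum _ (fun k _ => poissonWeight_nonneg m k) (hasSum_poissonWeight m)
  calc _ ≤ Real.exp (-(m : ℝ)) * 2 ^ m * ∑ k ∈ Finset.range m, poissonWeight m k := by
        rw [Finset.mul_sum]; exact Finset.sum_le_sum hle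
    _ ≤ Real.exp (-(m : ℝ)) * 2 ^ m := mul_le_of_le_one_right (by positivity) hone
    _ = Real.exp (-(m : ℝ) + m * Real.log 2) := by
        rw [Real.exp_add, mul_comm (m : ℝ) (Real.log 2), Real.exp_mul,
          Real.exp_log (by norm_num), Real.rpow_natCast]
    _ ≤ _ := by
        apply Real.exp_le_exp.2
        have := Real.log_two_lt_d9
        push_cast
        nlinarith [(Nat.cast_nonneg m : (0 : ℝ) ≤ m)]

lemma prod_nonneg_of_mem_simplex {S N : ℕ} {P : Fin S → ℝ} (hP : P ∈ simplex S)
    (x : Fin N → Fin S) : 0 ≤ ∏ m, P (x m) :=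
  Finset.prod_nonneg fun m _ => hP.1 (x m)

lemma sum_prod_eq_one {S : ℕ} {P : Fin S → ℝ} (hP : P ∈ simplex S) (N : ℕ) :
    ∑ x : Fin N → Fin S, ENNReal.ofReal (∏ m, P (x m)) = 1 := by
  rw [← ENNReal.ofReal_sum_of_nonneg fun x _ => prod_nonneg_of_mem_simplex hP x,
    ← Fintype.sum_pow, hP.2, one_pow, ENNReal.ofReal_one]

/-- The first `m` of `N` i.i.d. samples are `m` i.i.d. samples. -/
lemma sum_prod_mul_take {S m N : ℕ} {P : Fin S → ℝ} (hP : P ∈ simplex S) (hm : m ≤ N)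
    (g : List (Fin S) → ℝ≥0∞) :
    ∑ x : Fin N → Fin S, ENNReal.ofReal (∏ j, P (x j)) * g ((List.ofFn x).take m) =
      ∑ y : Fin m → Fin S, ENNReal.ofReal (∏ j, P (y j)) * g (List.ofFn y) := by
  obtain ⟨k, rfl⟩ := Nat.exists_eq_add_of_le hm
  rw [← (Fin.appendEquiv m k).sum_comp, Fintype.sum_prod_type]
  refine Finset.sum_congr rfl fun y _ => ?_
  have hterm : ∀ z : Fin k → Fin S,
      ENNReal.ofReal (∏ j, P (Fin.appendEquiv m k (y, z) j)) *
          g ((List.ofFn (Fin.appendEquiv m k (y, z))).take m) =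
        ENNReal.ofReal (∏ j, P (y j)) * g (List.ofFn y) * ENNReal.ofReal (∏ j, P (z j)) := by
    intro z
    have htake : (List.ofFn (Fin.appendEquiv m k (y, z))).take m = List.ofFn y := by
      rw [show Fin.appendEquiv m k (y, z) = Fin.append y z from rfl, List.ofFn_fin_append]
      exact List.take_left' List.length_ofFn
    rw [htake]
    simp only [Fin.appendEquiv_apply, Fin.prod_univ_add, Fin.append_left, Fin.append_right]
    rw [ENNReal.ofReal_mul (prod_nonneg_of_mem_simplex hP y)]
    ring
  rw [Finset.sum_congr rfl fun z _ => hterm z, ← Finset.mul_sum, sum_prod_eq_one hP, mul_one]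

lemma l1_nonneg {S : ℕ} (v w : Fin S → ℝ) : 0 ≤ l1 v w :=
  Finset.sum_nonneg fun _ _ => abs_nonneg _

/-- Jensen's inequality for the ℓ₁ loss. -/
lemma l1_sum_le {S : ℕ} {ι : Type*} (s : Finset ι) (q : ι → ℝ) (hq : ∀ k ∈ s, 0 ≤ q k)
    (hq1 : ∑ k ∈ s, q k = 1) (v : ι → Fin S → ℝ) (w : Fin S → ℝ) :
    l1 (fun i => ∑ k ∈ s, q k * v k i) w ≤ ∑ k ∈ s, q k * l1 (v k) w := by
  unfold l1
  simp_rw [Finset.mul_sum]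
  rw [Finset.sum_comm]
  refine Finset.sum_le_sum fun i _ => ?_
  have heq : (∑ k ∈ s, q k * v k i) - w i = ∑ k ∈ s, q k * (v k i - w i) := by
    simp_rw [mul_sub, Finset.sum_sub_distrib, ← Finset.sum_mul, hq1, one_mul]
  rw [heq]
  refine (Finset.abs_sum_le_sum_abs _ _).trans (Finset.sum_le_sum fun k hk => ?_)
  rw [abs_mul, abs_of_nonneg (hq k hk)]

lemma l1_zero_sortVec {S : ℕ} {P : Fin S → ℝ} (hP : P ∈ simplex S) :
    l1 (fun _ => 0) (sortVec P) = 1 := by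
  have h : ∀ i, |0 - sortVec P i| = P (Tuple.sort P i) := fun i => by
    rw [zero_sub, abs_neg]; exact abs_of_nonneg (hP.1 _)
  unfold l1
  rw [Finset.sum_congr rfl fun i _ => h i, Equiv.sum_comp (Tuple.sort P) P, hP.2]

/-- The Poissonized risk of an estimator at `P`. -/
noncomputable def poissonRiskAt (n : ℕ) {S : ℕ} (est : List (Fin S) → (Fin S → ℝ))
    (P : Fin S → ℝ) : ℝ≥0∞ :=
  ∑' N : ℕ, ENNReal.ofReal (poissonWeight n N) *
    ∑ x : Fin N → Fin S, ENNReal.ofReal ((∏ m, P (x m)) * l1 (est (List.ofFn x)) (sortVec P))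

/-- The average of a sequential estimator over a Poisson(`n`) sample size conditioned to be at
most `2 n`. -/
noncomputable def averagedEstimator (n : ℕ) {S : ℕ} (est : List (Fin S) → (Fin S → ℝ))
    (x : Fin (2 * n) → Fin S) : Fin S → ℝ := fun i =>
  ∑ k ∈ Finset.range (2 * n + 1),
    poissonWeight n k / (∑ j ∈ Finset.range (2 * n + 1), poissonWeight n j) *
      est ((List.ofFn x).take k) i

lemma averagedEstimator_risk_le (n : ℕ) {S : ℕ} (est : List (Fin S) → (Fin S → ℝ))
    {P : Fin S → ℝ} (hP : P ∈ simplex S) :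
    ∑ x : Fin (2 * n) → Fin S,
        ENNReal.ofReal ((∏ m, P (x m)) * l1 (averagedEstimator n est x) (sortVec P)) ≤
      2 * poissonRiskAt n est P := by
  set W := ∑ j ∈ Finset.range (2 * n + 1), poissonWeight n j with hW
  have hWhalf : 1 / 2 ≤ W := half_le_sum_poissonWeight n
  have hWpos : 0 < W := by linarith
  have hq : ∀ k, 0 ≤ poissonWeight n k / W := fun k =>
    div_nonneg (poissonWeight_nonneg n k) hWpos.le
  have hq1 : ∑ k ∈ Finset.range (2 * n + 1), poissonWeight n k / W = 1 := by
    rw [← Finset.sum_div, ← hW, div_self hWpos.ne']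
  have hpt : ∀ x : Fin (2 * n) → Fin S,
      ENNReal.ofReal ((∏ m, P (x m)) * l1 (averagedEstimator n est x) (sortVec P)) ≤
        ∑ k ∈ Finset.range (2 * n + 1), ENNReal.ofReal (poissonWeight n k / W) *
          (ENNReal.ofReal (∏ m, P (x m)) *
            ENNReal.ofReal (l1 (est ((List.ofFn x).take k)) (sortVec P))) := by
    intro x
    have hJ := l1_sum_le (Finset.range (2 * n + 1)) (fun k => poissonWeight n k / W)
      (fun k _ => hq k) hq1 (fun k => est ((List.ofFn x).take k)) (sortVec P)
    refine (ENNReal.ofReal_le_ofReal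
      (mul_le_mul_of_nonneg_left hJ (prod_nonneg_of_mem_simplex hP x))).trans ?_
    rw [ENNReal.ofReal_mul (prod_nonneg_of_mem_simplex hP x),
      ENNReal.ofReal_sum_of_nonneg fun k _ => mul_nonneg (hq k) (l1_nonneg _ _), Finset.mul_sum]
    refine Finset.sum_le_sum fun k _ => ?_
    rw [ENNReal.ofReal_mul (hq k)]
    exact (mul_left_comm _ _ _).le
  refine (Finset.sum_le_sum fun x _ => hpt x).trans ?_
  rw [Finset.sum_comm]
  refine le_trans ?_ (mul_le_mul_right (ENNReal.sum_le_tsum (Finset.range (2 * n + 1))) 2)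
  rw [Finset.mul_sum]
  refine Finset.sum_le_sum fun k hk => ?_
  have hmarg := sum_prod_mul_take hP (Nat.lt_succ_iff.1 (Finset.mem_range.1 hk))
    fun L => ENNReal.ofReal (l1 (est L) (sortVec P))
  rw [← Finset.mul_sum, hmarg, ← mul_assoc]
  refine mul_le_mul' ?_ (Finset.sum_le_sum fun y _ => ?_)
  · rw [← ENNReal.ofReal_ofNat 2, ← ENNReal.ofReal_mul (by norm_num)]
    refine ENNReal.ofReal_le_ofReal ?_
    rw [div_le_iff₀ hWpos]
    nlinarith [poissonWeight_nonneg n k]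
  · rw [ENNReal.ofReal_mul (prod_nonneg_of_mem_simplex hP y)]

/-- The estimator applying `est` to the first `m` samples, and returning `0` if there are fewer. -/
noncomputable def truncatedEstimator {m S : ℕ} (est : (Fin m → Fin S) → (Fin S → ℝ))
    (L : List (Fin S)) : Fin S → ℝ :=
  if h : m ≤ L.length then est fun i => L.get ⟨i, i.2.trans_le h⟩ else fun _ => 0

lemma truncatedEstimator_ofFn {m S : ℕ} (est : (Fin m → Fin S) → (Fin S → ℝ))
    (y : Fin m → Fin S) : truncatedEstimator est (List.ofFn y) = est y := by
  simp [truncatedEstimator]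

lemma truncatedEstimator_take {m S : ℕ} (est : (Fin m → Fin S) → (Fin S → ℝ))
    {L : List (Fin S)} (h : m ≤ L.length) :
    truncatedEstimator est (L.take m) = truncatedEstimator est L := by
  simp [truncatedEstimator, h]

lemma truncatedEstimator_of_lt {m S : ℕ} (est : (Fin m → Fin S) → (Fin S → ℝ))
    {L : List (Fin S)} (h : L.length < m) : truncatedEstimator est L = fun _ => 0 := by
  simp [truncatedEstimator, h]

lemma truncatedEstimator_risk_le (m : ℕ) {S : ℕ} (est : (Fin m → Fin S) → (Fin S → ℝ))
    {P : Fin S → ℝ} (hP : P ∈ simplex S) :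
    poissonRiskAt (2 * m) (truncatedEstimator est) P ≤
      ∑ x : Fin m → Fin S, ENNReal.ofReal ((∏ j, P (x j)) * l1 (est x) (sortVec P)) +
        ENNReal.ofReal (Real.exp (-((2 * m : ℕ) : ℝ) / 8)) := by
  set M := ∑ x : Fin m → Fin S, ENNReal.ofReal ((∏ j, P (x j)) * l1 (est x) (sortVec P)) with hM
  have hterm : ∀ N : ℕ, ENNReal.ofReal (poissonWeight (2 * m) N) * ∑ x : Fin N → Fin S,
      ENNReal.ofReal ((∏ j, P (x j)) * l1 (truncatedEstimator est (List.ofFn x)) (sortVec P)) ≤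
        ENNReal.ofReal (poissonWeight (2 * m) N) * M +
          if N ∈ Finset.range m then ENNReal.ofReal (poissonWeight (2 * m) N) else 0 := by
    intro N
    by_cases hN : N < m
    · rw [if_pos (Finset.mem_range.2 hN)]
      refine le_add_left (mul_le_of_le_one_right' ?_)
      rw [← sum_prod_eq_one hP N]
      refine Finset.sum_le_sum fun x _ => ?_
      rw [truncatedEstimator_of_lt est (by simpa using hN), l1_zero_sortVec hP, mul_one]
    · refine le_add_right (mul_le_mul_right (le_of_eq ?_) _)
      have hmarg := sum_prod_mul_take hP (not_lt.1 hN)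
        fun L => ENNReal.ofReal (l1 (truncatedEstimator est L) (sortVec P))
      rw [hM]
      simp_rw [truncatedEstimator_ofFn] at hmarg
      simp_rw [ENNReal.ofReal_mul (prod_nonneg_of_mem_simplex hP _)]
      rw [← hmarg]
      refine Finset.sum_congr rfl fun x _ => ?_
      rw [truncatedEstimator_take est (by simpa using hN)]
  have htot : ∑' N, ENNReal.ofReal (poissonWeight (2 * m) N) = 1 := by
    rw [← ENNReal.ofReal_tsum_of_nonneg (poissonWeight_nonneg _)
      (hasSum_poissonWeight _).summable, (hasSum_poissonWeight _).tsum_eq, ENNReal.ofReal_one]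
  refine (ENNReal.tsum_le_tsum hterm).trans ?_
  rw [ENNReal.tsum_add, ENNReal.tsum_mul_right, htot, one_mul]
  refine add_le_add le_rfl ?_
  rw [tsum_eq_sum (s := Finset.range m) fun N hN => if_neg hN,
    Finset.sum_congr rfl fun N hN => if_pos hN,
    ← ENNReal.ofReal_sum_of_nonneg fun N _ => poissonWeight_nonneg _ N]
  exact ENNReal.ofReal_le_ofReal (sum_poissonWeight_le m)

theorem stmt9 (n S : ℕ) (hn : 2 ≤ n) (hev : Even n) :
    riskMultinomial (2 * n) S / 2 ≤ riskPoissonized n S ∧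
      riskPoissonized n S ≤
        riskMultinomial (n / 2) S + ENNReal.ofReal (2 * Real.exp (-(n : ℝ) / 8)) := by
  constructor
  · refine le_iInf fun est => ENNReal.div_le_of_le_mul' ?_
    refine (iInf_le _ (averagedEstimator n est)).trans (iSup₂_le fun P hP => ?_)
    refine (averagedEstimator_risk_le n est hP).trans (mul_le_mul_right ?_ 2)
    exact le_iSup₂ (f := fun P (_ : P ∈ simplex S) => poissonRiskAt n est P) P hP
  · obtain ⟨m, rfl⟩ := hev.exists_two_nsmul
    rw [smul_eq_mul, Nat.mul_div_cancel_left m two_pos, riskMultinomial, ENNReal.iInf_add]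
    refine le_iInf fun est => (iInf_le _ (truncatedEstimator est)).trans
      (iSup₂_le fun P hP => (truncatedEstimator_risk_le m est hP).trans (add_le_add ?_ ?_))
    · exact le_iSup₂ (f := fun P (_ : P ∈ simplex S) => ∑ x : Fin m → Fin S,
        ENNReal.ofReal ((∏ j, P (x j)) * l1 (est x) (sortVec P))) P hP
    · exact ENNReal.ofReal_le_ofReal (le_mul_of_one_le_left (Real.exp_pos _).le one_le_two)
end

section
/- Let n be a positive integer, p ≥ 0, and let X be a random variable with X ~ Poisson(np); set p̂ = X/n. Then for every integer k ≥ 0 and every x ∈ ℝ, E[ g_{k,x}(p̂) ] = (p − x)^k, where g_{k,x}(u) = Σ_{l=0}^{k} C(k,l) (−x)^{k−l} ∏_{l'=0}^{l−1} ( u − l'/n ). -/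
/-- The polynomial `g_{k,x}` whose evaluation at `X/n`, `X ~ Poisson(np)`, is an unbiased
estimator of `(p-x)^k`. -/
noncomputable def gfun (n k : ℕ) (x u : ℝ) : ℝ :=
  ∑ l ∈ Finset.range (k + 1), (k.choose l : ℝ) * (-x) ^ (k - l) *
    ∏ l' ∈ Finset.range l, (u - (l' : ℝ) / n)

/-- The `l`-th factorial moment of the Poisson distribution with mean `a` is `a ^ l`. -/
theorem hasSum_poisson_mul_prod_sub (a : ℝ) (l : ℕ) :
    HasSum (fun m : ℕ ↦ (Real.exp (-a) * a ^ m / m.factorial) *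
      ∏ j ∈ Finset.range l, ((m : ℝ) - j)) (a ^ l) := by
  induction l with
  | zero =>
    have h := (NormedSpace.expSeries_div_hasSum_exp a).mul_left (Real.exp (-a))
    rw [← Real.exp_eq_exp_ℝ, ← Real.exp_add, neg_add_cancel, Real.exp_zero] at h
    simpa [mul_div_assoc] using h
  | succ l ih =>
    rw [← hasSum_nat_add_iff' 1]
    have h : ∀ m : ℕ, Real.exp (-a) * a ^ (m + 1) / (m + 1).factorial *
        ∏ j ∈ Finset.range (l + 1), (((m + 1 : ℕ) : ℝ) - j) =
        a * (Real.exp (-a) * a ^ m / m.factorial * ∏ j ∈ Finset.range l, ((m : ℝ) - j)) := by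
      intro m
      have hm : (m : ℝ) + 1 ≠ 0 := by positivity
      rw [Finset.prod_range_succ', Nat.factorial_succ]
      push_cast
      simp only [add_sub_add_right_eq_sub, sub_zero]
      field_simp
      ring
    simp_rw [h]
    simpa [Finset.prod_range_succ', pow_succ'] using ih.mul_left a

theorem stmt10 (n : ℕ) (hn : 0 < n) (p : ℝ) (hp : 0 ≤ p) (k : ℕ) (x : ℝ) :
    ∑' m : ℕ, (Real.exp (-((n : ℝ) * p)) * ((n : ℝ) * p) ^ m / m.factorial) *
        gfun n k x ((m : ℝ) / n) =
      (p - x) ^ k := by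
  have hn' : (n : ℝ) ≠ 0 := by positivity
  have h : HasSum (fun m : ℕ ↦ (Real.exp (-((n : ℝ) * p)) * ((n : ℝ) * p) ^ m / m.factorial) *
      gfun n k x ((m : ℝ) / n))
      (∑ l ∈ Finset.range (k + 1),
        ((k.choose l : ℝ) * (-x) ^ (k - l) / (n : ℝ) ^ l) * ((n : ℝ) * p) ^ l) := by
    have hterm (m : ℕ) : (Real.exp (-((n : ℝ) * p)) * ((n : ℝ) * p) ^ m / m.factorial) *
        gfun n k x ((m : ℝ) / n) = ∑ l ∈ Finset.range (k + 1),
          ((k.choose l : ℝ) * (-x) ^ (k - l) / (n : ℝ) ^ l) *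
            ((Real.exp (-((n : ℝ) * p)) * ((n : ℝ) * p) ^ m / m.factorial) *
              ∏ j ∈ Finset.range l, ((m : ℝ) - j)) := by
      rw [gfun, Finset.mul_sum]
      refine Finset.sum_congr rfl fun l _ ↦ ?_
      simp only [← sub_div, Finset.prod_div_distrib, Finset.prod_const, Finset.card_range]
      ring
    simp_rw [hterm]
    exact hasSum_sum fun l _ ↦ (hasSum_poisson_mul_prod_sub ((n : ℝ) * p) l).mul_left _
  rw [h.tsum_eq, sub_eq_add_neg, add_pow]
  refine Finset.sum_congr rfl fun l _ ↦ ?_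
  rw [mul_pow]
  field_simp
end

section
/- There exists a constant c₁ > 0 such that for all integers n ≥ 2, all positive integers j, and all p ∈ [0,1]: if p ∉ Ĩ_j and X is a random variable with nX ~ Poisson(np), then ℙ( X ∈ I_j ) ≤ n^{−5}. Here I_j = [ (c₁ ln n / n)·(j−1)² , (c₁ ln n / n)·j² ] and Ĩ_j = [ (c₁ ln n / n)·(j − 3/2)²·𝟙(j ≥ 2) , (c₁ ln n / n)·(j+1)² ]. -/
/-- The interval `I_j = [(c₁ ln n / n)(j-1)², (c₁ ln n / n) j²]`. -/
noncomputable def Iint (c₁ : ℝ) (n j : ℕ) : Set ℝ :=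
  Set.Icc (c₁ * Real.log n / n * ((j : ℝ) - 1) ^ 2) (c₁ * Real.log n / n * (j : ℝ) ^ 2)

/-- The enlarged interval `Ĩ_j = [(c₁ ln n / n)(j-3/2)²·𝟙(j ≥ 2), (c₁ ln n / n)(j+1)²]`. -/
noncomputable def Itil (c₁ : ℝ) (n j : ℕ) : Set ℝ :=
  Set.Icc (c₁ * Real.log n / n * ((j : ℝ) - 3 / 2) ^ 2 * (if 2 ≤ j then 1 else 0))
    (c₁ * Real.log n / n * ((j : ℝ) + 1) ^ 2)

/-- Chernoff bound for a Poisson variable of mean `l`, restricted to a set `S` on which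
`s ^ b ≤ s ^ m`. -/
theorem tsum_indicator_poisson_le (S : Set ℕ) {l s b : ℝ} (hl : 0 ≤ l) (hs : 0 < s)
    (hS : ∀ m ∈ S, s ^ b ≤ s ^ m) :
    ∑' m : ℕ, S.indicator (fun m => Real.exp (-l) * l ^ m / m.factorial) m ≤
      Real.exp (l * (s - 1) - b * Real.log s) := by
  have hsum : HasSum (fun m : ℕ => Real.exp (-l) * s ^ (-b) * ((l * s) ^ m / m.factorial))
      (Real.exp (l * (s - 1) - b * Real.log s)) := by
    have h := (NormedSpace.expSeries_div_hasSum_exp (l * s)).mul_left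
      (Real.exp (-l) * s ^ (-b))
    rw [← Real.exp_eq_exp_ℝ] at h
    have hexp : Real.exp (l * (s - 1) - b * Real.log s) =
        Real.exp (-l) * s ^ (-b) * Real.exp (l * s) := by
      rw [Real.rpow_def_of_pos hs, ← Real.exp_add, ← Real.exp_add]
      ring_nf
    rwa [hexp]
  have hle : ∀ m : ℕ, S.indicator (fun m => Real.exp (-l) * l ^ m / m.factorial) m ≤
      Real.exp (-l) * s ^ (-b) * ((l * s) ^ m / m.factorial) := by
    intro m
    refine Set.indicator_apply_le' (fun hm => ?_) (fun _ => by positivity)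
    have h1 : 1 ≤ s ^ (-b) * s ^ m := by
      rw [Real.rpow_neg hs.le, ← div_eq_inv_mul, one_le_div (by positivity)]
      exact hS m hm
    calc Real.exp (-l) * l ^ m / m.factorial
        ≤ Real.exp (-l) * l ^ m / m.factorial * (s ^ (-b) * s ^ m) :=
          le_mul_of_one_le_right (by positivity) h1
      _ = _ := by rw [mul_pow]; ring
  have hnonneg : ∀ m : ℕ,
      0 ≤ S.indicator (fun m => Real.exp (-l) * l ^ m / m.factorial) m :=
    fun m => Set.indicator_nonneg (fun m _ => by positivity) m
  exact (hsum.summable.of_nonneg_of_le hnonneg hle).tsum_le_tsum hle hsum.summable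
    |>.trans_eq hsum.tsum_eq

/-- The Chernoff exponent at the tilt `(u / v) ^ 2` is at most `-(L * (u - v) ^ 2)`. -/
theorem chernoff_exponent_le {L u v l : ℝ} (hL : 0 ≤ L) (hu : 0 < u) (hv : 0 < v)
    (h : l * ((u / v) ^ 2 - 1) ≤ L * v ^ 2 * ((u / v) ^ 2 - 1)) :
    l * ((u / v) ^ 2 - 1) - L * u ^ 2 * Real.log ((u / v) ^ 2) ≤ -(L * (u - v) ^ 2) := by
  have hlog : -Real.log (u / v) ≤ v / u - 1 := by
    rw [← Real.log_inv, inv_div]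
    exact Real.log_le_sub_one_of_pos (by positivity)
  have h1 : L * v ^ 2 * ((u / v) ^ 2 - 1) = L * (u ^ 2 - v ^ 2) := by field_simp
  have h2 : 2 * L * u ^ 2 * (v / u - 1) = 2 * L * (u * v - u ^ 2) := by field_simp
  have h3 := mul_le_mul_of_nonneg_left hlog (show 0 ≤ 2 * L * u ^ 2 by positivity)
  rw [Real.log_pow]
  push_cast
  linarith

theorem stmt11 :
    ∃ c₁ : ℝ, 0 < c₁ ∧ ∀ n j : ℕ, 2 ≤ n → 1 ≤ j → ∀ p ∈ Set.Icc (0 : ℝ) 1,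
      p ∉ Itil c₁ n j →
      (∑' m : ℕ, (Iint c₁ n j).indicator
          (fun _ => Real.exp (-((n : ℝ) * p)) * ((n : ℝ) * p) ^ m / m.factorial)
          ((m : ℝ) / n)) ≤ (n : ℝ) ^ (-(5 : ℝ)) := by
  refine ⟨20, by norm_num, fun n j hn hj p hp hpI => ?_⟩
  have hn0 : (0 : ℝ) < n := by positivity
  have hlog : 0 ≤ Real.log n := Real.log_natCast_nonneg n
  set L : ℝ := 20 * Real.log n with hL
  have hL0 : 0 ≤ L := by positivity
  have hscale : ∀ x : ℝ, L / n * x = L * x / n := fun x => by ring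
  have hnp : 0 ≤ (n : ℝ) * p := mul_nonneg hn0.le hp.1
  have key : ∀ u v : ℝ, 0 < u → 0 < v → 1 / 4 ≤ (u - v) ^ 2 →
      (n : ℝ) * p * ((u / v) ^ 2 - 1) ≤ L * v ^ 2 * ((u / v) ^ 2 - 1) →
      (∀ m : ℕ, (m : ℝ) / n ∈ Iint 20 n j →
        ((u / v) ^ 2) ^ (L * u ^ 2) ≤ ((u / v) ^ 2) ^ m) →
      (∑' m : ℕ, (Iint 20 n j).indicator
          (fun _ => Real.exp (-((n : ℝ) * p)) * ((n : ℝ) * p) ^ m / m.factorial)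
          ((m : ℝ) / n)) ≤ (n : ℝ) ^ (-(5 : ℝ)) := by
    intro u v hu hv huv hmean hS
    refine (tsum_indicator_poisson_le {m : ℕ | (m : ℝ) / n ∈ Iint 20 n j} hnp
      (by positivity) hS).trans ?_
    rw [Real.rpow_def_of_pos hn0, Real.exp_le_exp]
    refine (chernoff_exponent_le hL0 hu hv hmean).trans ?_
    nlinarith
  by_cases hright : L / n * ((j : ℝ) + 1) ^ 2 < p
  · rw [hscale, div_lt_iff₀ hn0] at hright
    have hs : ((j : ℝ) / (j + 1)) ^ 2 ≤ 1 :=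
      pow_le_one₀ (by positivity) (div_le_one_of_le₀ (by linarith) (by positivity))
    refine key j (j + 1) (by positivity) (by positivity) (by norm_num)
      (mul_le_mul_of_nonpos_right (by linarith) (by linarith)) fun m hm => ?_
    have hm2 := hm.2
    rw [← hL, hscale, div_le_div_iff_of_pos_right hn0] at hm2
    rw [← Real.rpow_natCast _ m]
    exact Real.rpow_le_rpow_of_exponent_ge (by positivity) hs hm2
  · have hleft : p < L / n * ((j : ℝ) - 3 / 2) ^ 2 * (if 2 ≤ j then 1 else 0) := by
      by_contra! h
      exact hpI ⟨h, not_lt.1 hright⟩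
    have hj2 : 2 ≤ j := by
      by_contra h
      rw [if_neg h, mul_zero] at hleft
      exact hleft.not_ge hp.1
    have hj2' : (2 : ℝ) ≤ j := by exact_mod_cast hj2
    rw [if_pos hj2, mul_one, hscale, lt_div_iff₀ hn0] at hleft
    have hv : (0 : ℝ) < j - 3 / 2 := by linarith
    have hs : 1 ≤ (((j : ℝ) - 1) / (j - 3 / 2)) ^ 2 :=
      one_le_pow₀ ((one_le_div hv).2 (by linarith))
    refine key (j - 1) (j - 3 / 2) (by linarith) hv (by ring_nf; norm_num)
      (mul_le_mul_of_nonneg_right (by linarith) (by linarith)) fun m hm => ?_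
    have hm1 := hm.1
    rw [← hL, hscale, div_le_div_iff_of_pos_right hn0] at hm1
    rw [← Real.rpow_natCast _ m]
    exact Real.rpow_le_rpow_of_exponent_le hs hm1
end

section
/- There exists a choice of constant c₁ > 0 (the same as in the Poisson localization lemma) such that the following holds for any constants c₂, c₃ with c₁ > 2c₂ and c₃ > 30c₁. Let n ≥ 2 satisfy c₂ ln n ≥ 1, let j be a positive integer, set x_j = c₁ j(j−1) ln n / n and Ĩ_j = [ (c₁ ln n/n)(j−3/2)²·𝟙(j ≥ 2), (c₁ ln n/n)(j+1)² ]. Let A be a finite index set, let p_i ∈ Ĩ_j for every i ∈ A, and let (X_i)_{i∈A} be independent with nX_i ~ Poisson(n p_i). Then for every integer k with 1 ≤ k ≤ c₂ ln n: ℙ( | Σ_{i∈A} g_{k,x_j}(X_i) − Σ_{i∈A} (p_i − x_j)^k | > √(|A| ln n) · (c₃ j ln n / n)^k ) ≤ 2 n^{−4}. -/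
/-- The center `x_j = c₁ j (j-1) ln n / n` of the interval `I_j`. -/
noncomputable def xctr (c₁ : ℝ) (n j : ℕ) : ℝ := c₁ * (j : ℝ) * ((j : ℝ) - 1) * Real.log n / n

open Real Finset MeasureTheory ProbabilityTheory Polynomial
open scoped NNReal Nat

/-- The linear functional on polynomials sending `X ^ l` to the scaled falling factorial
`∏_{l' < l} (u - l' / n)`. -/
noncomputable def fallingFunctional (n : ℕ) (u : ℝ) : ℝ[X] →ₗ[ℝ] ℝ :=
  lsum fun l => (∏ l' ∈ range l, (u - (l' : ℝ) / n)) • LinearMap.id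

lemma fallingFunctional_monomial (n : ℕ) (u : ℝ) (l : ℕ) (a : ℝ) :
    fallingFunctional n u (monomial l a) = a * ∏ l' ∈ range l, (u - (l' : ℝ) / n) := by
  simp [fallingFunctional, lsum_apply, sum_monomial_index, mul_comm]

lemma fallingFunctional_X_mul (n : ℕ) (u : ℝ) (q : ℝ[X]) :
    fallingFunctional n u (X * q) =
      u * fallingFunctional n u q - fallingFunctional n u (X * derivative q) / n := by
  induction q using Polynomial.induction_on' with
  | add p q hp hq => simp only [mul_add, map_add, hp, hq]; ring
  | monomial l a =>
    rw [X_mul_monomial, derivative_monomial, X_mul_monomial, fallingFunctional_monomial,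
      fallingFunctional_monomial, fallingFunctional_monomial]
    cases l with
    | zero => simp [mul_comm]
    | succ l => rw [prod_range_succ, Nat.add_sub_cancel]; ring

lemma gfun_eq_fallingFunctional (n k : ℕ) (x u : ℝ) :
    gfun n k x u = fallingFunctional n u ((X - C x) ^ k) := by
  rw [sub_eq_add_neg, add_pow, map_sum, gfun]
  refine sum_congr rfl fun l _ => ?_
  have : (X ^ l * (-C x) ^ (k - l) * (k.choose l : ℝ[X]) : ℝ[X]) =
      monomial l ((k.choose l : ℝ) * (-x) ^ (k - l)) := by
    rw [← C_mul_X_pow_eq_monomial]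
    simp
    ring
  rw [this, fallingFunctional_monomial]

lemma gfun_zero (n : ℕ) (x u : ℝ) : gfun n 0 x u = 1 := by simp [gfun]

lemma gfun_one (n : ℕ) (x u : ℝ) : gfun n 1 x u = u - x := by
  simp [gfun, sum_range_succ]; ring

/-- The three-term recurrence of the (scaled) Charlier polynomials. -/
lemma gfun_add_two (n k : ℕ) (x u : ℝ) :
    gfun n (k + 2) x u = (u - x - (k + 1) / n) * gfun n (k + 1) x u
      - (k + 1) * x / n * gfun n k x u := by
  have h₁ : ((X - C x) ^ (k + 2) : ℝ[X]) = X * (X - C x) ^ (k + 1) - x • (X - C x) ^ (k + 1) := by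
    rw [smul_eq_C_mul]; ring
  have h₂ : (X * derivative ((X - C x) ^ (k + 1)) : ℝ[X]) =
      ((k : ℝ) + 1) • (X - C x) ^ (k + 1) + (((k : ℝ) + 1) * x) • (X - C x) ^ k := by
    rw [derivative_pow]
    simp [smul_eq_C_mul]
    ring
  simp only [gfun_eq_fallingFunctional]
  rw [h₁, map_sub, fallingFunctional_X_mul, h₂]
  simp only [map_add, map_smul, smul_eq_mul]
  ring

lemma abs_gfun_le_pow {n K : ℕ} {x u Q : ℝ} (hx : 0 ≤ x) (hQ : 0 ≤ Q)
    (h : (|u - x| + K / n) * Q + K * x / n ≤ Q ^ 2) (hQ' : |u - x| ≤ Q) :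
    ∀ k ≤ K, |gfun n k x u| ≤ Q ^ k := by
  intro k
  induction k using Nat.strong_induction_on with
  | _ k ih =>
    intro hk
    match k, ih, hk with
    | 0, _, _ => simp [gfun_zero]
    | 1, _, _ => simpa [gfun_one] using hQ'
    | k + 2, ih, hk =>
      have h₁ := ih (k + 1) (by omega) (by omega)
      have h₀ := ih k (by omega) (by omega)
      have hkK : (k : ℝ) + 1 ≤ K := by exact_mod_cast (by omega : k + 1 ≤ K)
      have hd : |u - x - (k + 1) / n| ≤ |u - x| + K / n := by
        refine (abs_sub _ _).trans ?_
        rw [abs_of_nonneg (by positivity : (0 : ℝ) ≤ ((k : ℝ) + 1) / n)]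
        gcongr
      have hm : |((k : ℝ) + 1) * x / n| ≤ K * x / n := by
        rw [abs_of_nonneg (by positivity)]
        gcongr
      rw [gfun_add_two]
      calc _ ≤ |u - x - (k + 1) / n| * |gfun n (k + 1) x u|
              + |((k : ℝ) + 1) * x / n| * |gfun n k x u| := by
            rw [← abs_mul, ← abs_mul]; exact abs_sub _ _
        _ ≤ (|u - x| + K / n) * Q ^ (k + 1) + K * x / n * Q ^ k := by gcongr
        _ = ((|u - x| + K / n) * Q + K * x / n) * Q ^ k := by ring
        _ ≤ Q ^ 2 * Q ^ k := by gcongr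
        _ = Q ^ (k + 2) := by ring

lemma hasSum_poisson_descFactorial (r : ℝ) (l : ℕ) :
    HasSum (fun m : ℕ => exp (-r) * r ^ m / m ! * (m.descFactorial l : ℝ)) (r ^ l) := by
  have h := ((NormedSpace.expSeries_div_hasSum_exp r).mul_left (exp (-r))).mul_right (r ^ l)
  rw [← exp_eq_exp_ℝ, ← exp_add, neg_add_cancel, exp_zero, one_mul] at h
  have h0 : ∑ m ∈ range l, exp (-r) * r ^ m / m ! * (m.descFactorial l : ℝ) = 0 :=
    sum_eq_zero fun m hm => by
      rw [Nat.descFactorial_of_lt (mem_range.1 hm)]; simp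
  have := (hasSum_nat_add_iff (f := fun m : ℕ => exp (-r) * r ^ m / m ! * (m.descFactorial l : ℝ))
    (g := r ^ l) l).1
  rw [h0, add_zero] at this
  refine this (h.congr_fun fun m => ?_)
  have hf : ((m + l)! : ℝ) = m ! * ((m + l).descFactorial l : ℝ) := by
    have := Nat.factorial_mul_descFactorial (Nat.le_add_left l m)
    rw [Nat.add_sub_cancel] at this
    exact_mod_cast this.symm
  have h1 : ((m + l).descFactorial l : ℝ) ≠ 0 := by
    intro h'
    have : ((m + l)! : ℝ) ≠ 0 := by positivity
    simp [hf, h'] at this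
  have h2 : (m ! : ℝ) ≠ 0 := by positivity
  rw [hf, pow_add]
  field_simp

lemma hasSum_poisson_gfun {n : ℕ} (hn : n ≠ 0) (p x : ℝ) (k : ℕ) :
    HasSum (fun m : ℕ => exp (-(n * p)) * (n * p) ^ m / m ! * gfun n k x ((m : ℝ) / n))
      ((p - x) ^ k) := by
  have hn' : (n : ℝ) ≠ 0 := by exact_mod_cast hn
  have hprod : ∀ m l : ℕ, ∏ l' ∈ range l, ((m : ℝ) / n - (l' : ℝ) / n) =
      (m.descFactorial l : ℝ) / n ^ l := by
    intro m l
    induction l with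
    | zero => simp
    | succ l ih =>
      rw [prod_range_succ, ih, Nat.descFactorial_succ]
      rcases le_or_gt l m with h | h
      · push_cast [h]; field_simp; ring
      · simp [Nat.descFactorial_of_lt h]
  have h := hasSum_sum (s := range (k + 1)) fun l _ =>
    (hasSum_poisson_descFactorial (n * p) l).mul_left ((k.choose l : ℝ) * (-x) ^ (k - l) / n ^ l)
  convert! h using 1
  · ext m
    rw [gfun, mul_sum]
    refine sum_congr rfl fun l _ => ?_
    rw [hprod]; ring
  · rw [sub_eq_add_neg, add_pow]
    refine sum_congr rfl fun l _ => ?_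
    rw [mul_pow]; field_simp

lemma hasSum_poisson_exp (r s : ℝ) :
    HasSum (fun m : ℕ => exp (-r) * r ^ m / m ! * exp (s * m)) (exp (r * (exp s - 1))) := by
  have h := (NormedSpace.expSeries_div_hasSum_exp (r * exp s)).mul_left (exp (-r))
  rw [← exp_eq_exp_ℝ, ← exp_add] at h
  convert! h using 1
  · ext m
    rw [mul_pow, ← exp_nat_mul, mul_comm s]; ring
  · ring_nf

/-- A concentration inequality for a sum of independent variables which are small on sets `S i`
outside of which they have a small second moment: Hoeffding's inequality for the truncated
variables, Chebyshev's inequality for the remainders. -/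
lemma measureReal_sum_sub_integral_gt_le {ι : Type*} [Fintype ι] {Ω : ι → Type*}
    [∀ i, MeasurableSpace (Ω i)] {ν : ∀ i, Measure (Ω i)} [∀ i, IsProbabilityMeasure (ν i)]
    {f : ∀ i, Ω i → ℝ} {S : ∀ i, Set (Ω i)} {ε t : ℝ} (hfm : ∀ i, Measurable (f i))
    (hS : ∀ i, MeasurableSet (S i)) (hf : ∀ i, MemLp (f i) 2 (ν i))
    (hb : ∀ i, ∀ ω ∈ S i, |f i ω| ≤ 1 / 4) (hε : 0 ≤ ε)
    (htail : ∀ i, ∫ ω in (S i)ᶜ, f i ω ^ 2 ∂ν i ≤ ε) (ht : 0 < t) :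
    (Measure.pi ν).real {ω | √((Fintype.card ι : ℝ) * t) < |∑ i, (f i (ω i) - ∫ x, f i x ∂ν i)|}
      ≤ 2 * exp (-5 * t) + 25 * ε / t := by
  rcases isEmpty_or_nonempty ι with hι | hι
  · have : {ω : ∀ i, Ω i | √((Fintype.card ι : ℝ) * t) < |∑ i, (f i (ω i) - ∫ x, f i x ∂ν i)|}
        = ∅ := by ext; simp
    rw [this, measureReal_empty]
    positivity
  have hN : (0 : ℝ) < Fintype.card ι := by exact_mod_cast Fintype.card_pos
  set s := √((Fintype.card ι : ℝ) * t) with hs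
  have hs0 : 0 < s := sqrt_pos.2 (by positivity)
  have hs2 : s ^ 2 = Fintype.card ι * t := sq_sqrt (by positivity)
  set a : ∀ i, Ω i → ℝ := fun i => (S i).indicator (f i) with ha
  set r : ∀ i, Ω i → ℝ := fun i => (S i)ᶜ.indicator (f i) with hr
  have ham : ∀ i, Measurable (a i) := fun i => (hfm i).indicator (hS i)
  have haL : ∀ i, MemLp (a i) 2 (ν i) := fun i => (hf i).indicator (hS i)
  have hrL : ∀ i, MemLp (r i) 2 (ν i) := fun i => (hf i).indicator (hS i).compl
  have har : ∀ i ω, f i ω = a i ω + r i ω := fun i ω => by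
    simp only [ha, hr]
    exact (congr_fun (Set.indicator_self_add_compl (S i) (f i)) ω).symm
  have hint : ∀ i, ∫ x, f i x ∂ν i = ∫ x, a i x ∂ν i + ∫ x, r i x ∂ν i := fun i => by
    rw [← integral_add ((haL i).integrable one_le_two) ((hrL i).integrable one_le_two)]
    exact integral_congr_ae (.of_forall (har i))
  have habs : ∀ i ω, a i ω ∈ Set.Icc (-(1 / 4) : ℝ) (1 / 4) := fun i ω => by
    refine abs_le.1 ?_
    by_cases h : ω ∈ S i
    · simpa [ha, h] using hb i ω h
    · simp [ha, h]
  have hsub : ∀ i, HasSubgaussianMGF (fun ω : ∀ i, Ω i => a i (ω i) - ∫ x, a i x ∂ν i)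
      (1 / 16) (Measure.pi ν) := fun i => by
    have h := hasSubgaussianMGF_of_mem_Icc (μ := Measure.pi ν) (X := fun ω => a i (ω i))
      (a := -(1 / 4)) (b := 1 / 4) ((ham i).comp (measurable_pi_apply i)).aemeasurable
      (.of_forall fun ω => habs i (ω i))
    rw [integral_comp_eval (haL i).1] at h
    convert h using 1
    ext
    norm_num
  have hindep : iIndepFun (fun i (ω : ∀ i, Ω i) => a i (ω i) - ∫ x, a i x ∂ν i) (Measure.pi ν) :=
    iIndepFun_pi (X := fun i x => a i x - ∫ x, a i x ∂ν i)
      fun i => ((ham i).sub_const _).aemeasurable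
  have hindep' : iIndepFun (fun i (ω : ∀ i, Ω i) => -(a i (ω i) - ∫ x, a i x ∂ν i))
      (Measure.pi ν) :=
    iIndepFun_pi (X := fun i x => -(a i x - ∫ x, a i x ∂ν i))
      fun i => ((ham i).sub_const _).neg.aemeasurable
  have hexp : exp (-(4 / 5 * s) ^ 2 / (2 * (∑ _i : ι, (1 / 16 : ℝ≥0) : ℝ≥0))) ≤ exp (-5 * t) := by
    rw [exp_le_exp, mul_pow, hs2, NNReal.coe_sum]
    simp only [sum_const, card_univ, nsmul_eq_mul]
    push_cast
    rw [div_le_iff₀ (by positivity)]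
    nlinarith [mul_pos hN ht]
  have hU := (HasSubgaussianMGF.measure_sum_ge_le_of_iIndepFun hindep (s := univ)
    (fun i _ => hsub i) (ε := 4 / 5 * s) (by positivity)).trans hexp
  have hL := (HasSubgaussianMGF.measure_sum_ge_le_of_iIndepFun hindep' (s := univ)
    (fun i _ => (hsub i).neg) (ε := 4 / 5 * s) (by positivity)).trans hexp
  have hRL : MemLp (∑ i, fun ω : ∀ i, Ω i => r i (ω i)) 2 (Measure.pi ν) :=
    memLp_finsetSum' _ fun i _ => (hrL i).comp_measurePreserving (measurePreserving_eval _ i)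
  have hRint : ∫ ω, (∑ i, fun ω : ∀ i, Ω i => r i (ω i)) ω ∂Measure.pi ν =
      ∑ i, ∫ x, r i x ∂ν i := by
    simp only [Finset.sum_apply]
    rw [integral_finsetSum _ fun i _ => integrable_comp_eval ((hrL i).integrable one_le_two)]
    exact sum_congr rfl fun i _ => integral_comp_eval (hrL i).1
  have hvar : Var[∑ i, fun ω : ∀ i, Ω i => r i (ω i); Measure.pi ν] ≤ Fintype.card ι * ε := by
    rw [variance_sum_pi hrL]
    refine (sum_le_card_nsmul univ _ ε fun i _ => ?_).trans_eq (by simp)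
    refine (variance_le_expectation_sq (hrL i).1).trans (le_of_eq_of_le ?_ (htail i))
    rw [← integral_indicator (hS i).compl]
    refine integral_congr_ae (.of_forall fun ω => ?_)
    by_cases h : ω ∈ S i <;> simp [hr, h]
  have hC : (Measure.pi ν).real {ω | 1 / 5 * s ≤ |∑ i, (r i (ω i) - ∫ x, r i x ∂ν i)|} ≤
      25 * ε / t := by
    have h := meas_ge_le_variance_div_sq hRL (c := 1 / 5 * s) (by positivity)
    rw [hRint] at h
    simp only [Finset.sum_apply, ← sum_sub_distrib] at h
    refine (ENNReal.toReal_le_of_le_ofReal (div_nonneg (variance_nonneg _ _) (sq_nonneg _))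
      h).trans ?_
    rw [mul_pow, hs2, div_le_div_iff₀ (by positivity) ht]
    nlinarith [mul_le_mul_of_nonneg_right hvar ht.le]
  refine (measureReal_mono (s₂ := ({ω | 4 / 5 * s ≤ ∑ i, (a i (ω i) - ∫ x, a i x ∂ν i)} ∪
    {ω | 4 / 5 * s ≤ ∑ i, -(a i (ω i) - ∫ x, a i x ∂ν i)}) ∪
    {ω | 1 / 5 * s ≤ |∑ i, (r i (ω i) - ∫ x, r i x ∂ν i)|}) ?_).trans ?_
  · intro ω hω
    have hsplit : ∑ i, (f i (ω i) - ∫ x, f i x ∂ν i) = ∑ i, (a i (ω i) - ∫ x, a i x ∂ν i) +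
        ∑ i, (r i (ω i) - ∫ x, r i x ∂ν i) := by
      rw [← sum_add_distrib]
      exact sum_congr rfl fun i _ => by rw [har, hint]; ring
    simp only [Set.mem_ofPred_eq, hsplit] at hω
    by_contra! hcon
    simp only [Set.mem_union, Set.mem_ofPred_eq, not_or, not_le, sum_neg_distrib] at hcon
    obtain ⟨⟨h1, h2⟩, h3⟩ := hcon
    have h4 := abs_lt.2 ⟨by linarith, h1⟩
    linarith [abs_add_le (∑ i, (a i (ω i) - ∫ x, a i x ∂ν i))
      (∑ i, (r i (ω i) - ∫ x, r i x ∂ν i))]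
  · refine (measureReal_union_le _ _).trans ?_
    have := measureReal_union_le (μ := Measure.pi ν)
      {ω | 4 / 5 * s ≤ ∑ i, (a i (ω i) - ∫ x, a i x ∂ν i)}
      {ω | 4 / 5 * s ≤ ∑ i, -(a i (ω i) - ∫ x, a i x ∂ν i)}
    linarith

lemma exp_sub_one_le {s : ℝ} (hs : |s| ≤ 1) : exp s - 1 ≤ s + s ^ 2 := by
  linarith [(abs_le.1 (abs_exp_sub_one_sub_id_le hs)).2]

/-- Chernoff bound for the Poisson distribution: `s > 0` gives upper tails, `s < 0` lower tails. -/
lemma tsum_indicator_poisson_le_s12 {r s a : ℝ} (hr : 0 ≤ r) {B : Set ℕ}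
    (hB : ∀ m ∈ B, s * a ≤ s * m) :
    ∑' m : ℕ, B.indicator (fun m => exp (-r) * r ^ m / m !) m ≤
      exp (r * (exp s - 1) - s * a) := by
  have h := (hasSum_poisson_exp r s).mul_right (exp (-(s * a)))
  rw [← exp_add, ← sub_eq_add_neg] at h
  have hle : ∀ m : ℕ, B.indicator (fun m => exp (-r) * r ^ m / m !) m ≤
      exp (-r) * r ^ m / m ! * exp (s * m) * exp (-(s * a)) := fun m => by
    rw [mul_assoc, ← exp_add]
    by_cases hm : m ∈ B
    · rw [Set.indicator_of_mem hm]
      refine le_mul_of_one_le_right (by positivity) (one_le_exp ?_)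
      linarith [hB m hm]
    · rw [Set.indicator_of_notMem hm]
      positivity
  have hsum : Summable fun m : ℕ => B.indicator (fun m => exp (-r) * r ^ m / m !) m :=
    Summable.of_nonneg_of_le (fun m => Set.indicator_nonneg (fun _ _ => by positivity) m) hle
      h.summable
  exact (hsum.tsum_le_tsum hle h.summable).trans_eq h.tsum_eq

/-- Poisson localization: for `p` outside the enlarged interval, the empirical frequency lies in
the interval `I_j` with polynomially small probability. -/
lemma poisson_localization {c₁ : ℝ} (hc₁ : 36 ≤ c₁) {n j : ℕ} (hn : 2 ≤ n) (hj : 1 ≤ j) {p : ℝ}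
    (hp0 : 0 ≤ p) (hp : p ∉ Itil c₁ n j) :
    ∑' m : ℕ, (Iint c₁ n j).indicator
        (fun _ => exp (-((n : ℝ) * p)) * ((n : ℝ) * p) ^ m / m !) ((m : ℝ) / n) ≤
      (n : ℝ) ^ (-(5 : ℝ)) := by
  have hn0 : (0 : ℝ) < n := by positivity
  have hln : 0 < log n := log_pos (by exact_mod_cast hn)
  have hj1 : (1 : ℝ) ≤ j := by exact_mod_cast hj
  set L := c₁ * log n with hL
  have hL5 : 36 * log n ≤ L := mul_le_mul_of_nonneg_right hc₁ hln.le
  have hL0 : 0 < L := by nlinarith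
  set B : Set ℕ := {m | (m : ℝ) / n ∈ Iint c₁ n j} with hB
  have hBm : ∀ m ∈ B, L * ((j : ℝ) - 1) ^ 2 ≤ m ∧ (m : ℝ) ≤ L * (j : ℝ) ^ 2 := by
    intro m hm
    obtain ⟨h1, h2⟩ := hm
    rw [← hL, div_mul_eq_mul_div] at h1 h2
    exact ⟨(div_le_div_iff_of_pos_right hn0).1 h1, (div_le_div_iff_of_pos_right hn0).1 h2⟩
  have key : ∀ s a : ℝ, (∀ m ∈ B, s * a ≤ s * m) → n * p * (exp s - 1) - s * a ≤ -(9 / 64) * L →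
      ∑' m : ℕ, (Iint c₁ n j).indicator
        (fun _ => exp (-((n : ℝ) * p)) * ((n : ℝ) * p) ^ m / m !) ((m : ℝ) / n) ≤
      (n : ℝ) ^ (-(5 : ℝ)) := by
    intro s a h1 h2
    refine (tsum_indicator_poisson_le_s12 (by positivity) h1).trans ?_
    rw [rpow_def_of_pos hn0, exp_le_exp]
    nlinarith
  by_cases hup : L / n * ((j : ℝ) + 1) ^ 2 < p
  · have hnp : L * ((j : ℝ) + 1) ^ 2 ≤ n * p := by
      rw [div_mul_eq_mul_div, div_lt_iff₀ hn0] at hup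
      linarith
    set v : ℝ := (j : ℝ) + 1 with hv
    have hv2 : 2 ≤ v := by linarith
    refine key (-(1 / (2 * v))) (L * j ^ 2) (fun m hm => ?_) ?_
    · exact mul_le_mul_of_nonpos_left (hBm m hm).2 (by simp; linarith)
    · have hs : |-(1 / (2 * v))| ≤ 1 := by
        rw [abs_neg, abs_of_nonneg (by positivity), div_le_one (by positivity)]; linarith
      have he := exp_sub_one_le hs
      have hneg : -(1 / (2 * v)) + (-(1 / (2 * v))) ^ 2 ≤ 0 := by
        have : 1 / (2 * v) ≤ 1 := by rw [div_le_one (by positivity)]; linarith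
        have : 0 ≤ 1 / (2 * v) := by positivity
        nlinarith
      have h1 : n * p * (exp (-(1 / (2 * v))) - 1) ≤
          L * v ^ 2 * (-(1 / (2 * v)) + (-(1 / (2 * v))) ^ 2) :=
        (mul_le_mul_of_nonneg_left he (by positivity)).trans
          (mul_le_mul_of_nonpos_right hnp hneg)
      have hjv : (j : ℝ) = v - 1 := by linarith
      have h2 : L * v ^ 2 * (-(1 / (2 * v)) + (-(1 / (2 * v))) ^ 2) - -(1 / (2 * v)) * (L * j ^ 2)
          = L * (-3 / 4 + 1 / (2 * v)) := by
        rw [hjv]; field_simp; ring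
      have h3 : 1 / (2 * v) ≤ 1 / 4 := by
        apply one_div_le_one_div_of_le <;> linarith
      nlinarith
  · have hlow : 2 ≤ j ∧ p < L / n * ((j : ℝ) - 3 / 2) ^ 2 := by
      by_contra hcon
      refine hp ⟨?_, not_lt.1 hup⟩
      split_ifs with h2
      · rw [mul_one]
        exact not_lt.1 fun h => hcon ⟨h2, h⟩
      · simpa using hp0
    obtain ⟨hj2, hlow⟩ := hlow
    have hj2' : (2 : ℝ) ≤ j := by exact_mod_cast hj2
    have hnp : n * p ≤ L * ((j : ℝ) - 3 / 2) ^ 2 := by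
      rw [div_mul_eq_mul_div, lt_div_iff₀ hn0] at hlow
      linarith
    set v : ℝ := (j : ℝ) - 1 with hv
    have hv1 : 1 ≤ v := by linarith
    have hjv : (j : ℝ) - 3 / 2 = v - 1 / 2 := by linarith
    rw [hjv] at hnp
    refine key (3 / (8 * v)) (L * v ^ 2) (fun m hm => ?_) ?_
    · exact mul_le_mul_of_nonneg_left (hBm m hm).1 (by positivity)
    · have hs : |3 / (8 * v)| ≤ 1 := by
        rw [abs_of_nonneg (by positivity), div_le_one (by positivity)]; linarith
      have he := exp_sub_one_le hs
      have h1 : n * p * (exp (3 / (8 * v)) - 1) ≤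
          L * (v - 1 / 2) ^ 2 * (3 / (8 * v) + (3 / (8 * v)) ^ 2) :=
        (mul_le_mul_of_nonneg_left he (by positivity)).trans
          (mul_le_mul_of_nonneg_right hnp (by positivity))
      refine (sub_le_sub_right h1 _).trans ?_
      have h2 : L * (v - 1 / 2) ^ 2 * (3 / (8 * v) + (3 / (8 * v)) ^ 2) - 3 / (8 * v) * (L * v ^ 2)
          = L * (-(15 / 64) - 3 / 64 * (1 / v) + 9 / 256 * (1 / v) ^ 2) := by
        field_simp; ring
      have h3 : 1 / v ≤ 1 := by rw [div_le_one (by positivity)]; exact hv1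
      have h4 : 0 < 1 / v := by positivity
      have h5 : -(15 / 64) - 3 / 64 * (1 / v) + 9 / 256 * (1 / v) ^ 2 ≤ -(9 / 64) := by nlinarith
      rw [h2]
      linarith [mul_le_mul_of_nonneg_left h5 hL0.le]

lemma integrable_exp_mul_poissonMeasure (r : ℝ≥0) (s : ℝ) :
    Integrable (fun m : ℕ => exp (s * m)) (poissonMeasure r) :=
  integrable_poissonMeasure_iff.2 <| by
    simpa only [norm_eq_abs, abs_exp] using (hasSum_poisson_exp r s).summable

lemma integral_exp_mul_poissonMeasure (r : ℝ≥0) (s : ℝ) :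
    ∫ m : ℕ, exp (s * m) ∂poissonMeasure r = exp (r * (exp s - 1)) := by
  rw [integral_poissonMeasure]
  simpa only [smul_eq_mul] using (hasSum_poisson_exp r s).tsum_eq

lemma exp_mul_abs_sub_le (r s m : ℝ) :
    exp (s * |m - r|) ≤ exp (-(s * r)) * exp (s * m) + exp (s * r) * exp (-s * m) := by
  rw [← exp_add, ← exp_add]
  rcases abs_cases (m - r) with ⟨h, -⟩ | ⟨h, -⟩ <;> rw [h]
  · refine le_add_of_le_of_nonneg (exp_le_exp.2 (by linarith)) (exp_nonneg _)
  · refine le_add_of_nonneg_of_le (exp_nonneg _) (exp_le_exp.2 (by linarith))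

lemma integrable_exp_mul_abs_sub_poissonMeasure (r : ℝ≥0) (s : ℝ) :
    Integrable (fun m : ℕ => exp (s * |(m : ℝ) - r|)) (poissonMeasure r) := by
  refine (((integrable_exp_mul_poissonMeasure r s).const_mul (exp (-(s * r)))).add
    ((integrable_exp_mul_poissonMeasure r (-s)).const_mul (exp (s * r)))).mono'
    Measurable.of_discrete.aestronglyMeasurable (.of_forall fun m => ?_)
  rw [norm_eq_abs, abs_exp]
  exact exp_mul_abs_sub_le _ _ _

lemma integral_exp_mul_abs_sub_poissonMeasure_le (r : ℝ≥0) {s : ℝ} (hs : |s| ≤ 1) :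
    ∫ m : ℕ, exp (s * |(m : ℝ) - r|) ∂poissonMeasure r ≤ 2 * exp (r * s ^ 2) := by
  have i₁ := (integrable_exp_mul_poissonMeasure r s).const_mul (exp (-(s * r)))
  have i₂ := (integrable_exp_mul_poissonMeasure r (-s)).const_mul (exp (s * r))
  refine (integral_mono (integrable_exp_mul_abs_sub_poissonMeasure r s) (i₁.add i₂)
    fun m => exp_mul_abs_sub_le _ _ _).trans ?_
  simp only [Pi.add_apply]
  rw [integral_add i₁ i₂, integral_const_mul, integral_const_mul, integral_exp_mul_poissonMeasure,
    integral_exp_mul_poissonMeasure, ← exp_add, ← exp_add, two_mul]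
  have h₁ := mul_le_mul_of_nonneg_left (exp_sub_one_le hs) r.2
  have h₂ := mul_le_mul_of_nonneg_left (exp_sub_one_le (by rwa [abs_neg] : |-s| ≤ 1)) r.2
  refine add_le_add (exp_le_exp.2 ?_) (exp_le_exp.2 ?_) <;> simp only [NNReal.val_eq_coe] at * <;>
    nlinarith

section Bounds

variable {c₁ : ℝ} {n j : ℕ} {p : ℝ}

lemma Itil_bounds (hL : 0 ≤ c₁ * log n) (hj : 1 ≤ j) (hp : p ∈ Itil c₁ n j) :
    0 ≤ p ∧ p ≤ 4 * (c₁ * log n / n * j ^ 2) ∧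
      |p - xctr c₁ n j| ≤ 4 * (c₁ * log n / n * j) := by
  have hj1 : (1 : ℝ) ≤ j := by exact_mod_cast hj
  have ha : 0 ≤ c₁ * log n / n := by positivity
  have hx : xctr c₁ n j = c₁ * log n / n * (j * (j - 1)) := by rw [xctr]; ring
  obtain ⟨h1, h2⟩ := hp
  rw [hx]
  set a := c₁ * log n / n
  refine ⟨le_trans (by positivity) h1, ?_, ?_⟩
  · nlinarith [mul_nonneg ha (by nlinarith : (0 : ℝ) ≤ 4 * j ^ 2 - (j + 1) ^ 2)]
  · refine abs_le.2 ⟨?_, ?_⟩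
    · split_ifs at h1 with hj2
      · nlinarith
      · have : (j : ℝ) = 1 := by exact_mod_cast (by omega : j = 1)
        rw [this] at h1 ⊢
        linarith
    · nlinarith

lemma abs_gfun_xctr_le (hL : 0 ≤ c₁ * log n) (hj : 1 ≤ j) (hp : p ∈ Itil c₁ n j) {k : ℕ}
    (hk : 2 * (k : ℝ) ≤ c₁ * log n) (u : ℝ) :
    |gfun n k (xctr c₁ n j) u| ≤ (|u - p| + 5 * (c₁ * log n / n * j)) ^ k := by
  obtain ⟨-, -, hpx⟩ := Itil_bounds hL hj hp
  have hj1 : (1 : ℝ) ≤ j := by exact_mod_cast hj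
  have ha : 0 ≤ c₁ * log n / n := by positivity
  have hx : xctr c₁ n j = c₁ * log n / n * (j * (j - 1)) := by rw [xctr]; ring
  have hkn : (k : ℝ) / n ≤ c₁ * log n / n / 2 := by
    rw [div_div, mul_comm (n : ℝ), ← div_div]
    gcongr
    linarith
  have hk0 : (0 : ℝ) ≤ (k : ℝ) / n := by positivity
  set a := c₁ * log n / n with ha'
  set x := xctr c₁ n j with hx'
  have hx0 : 0 ≤ x := by rw [hx]; exact mul_nonneg ha (mul_nonneg (by linarith) (by linarith))
  have haj : a ≤ a * j := le_mul_of_one_le_right ha hj1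
  have hux : |u - x| ≤ |u - p| + 4 * (a * j) := (abs_sub_le u p x).trans (by linarith)
  have hkx : (k : ℝ) * x / n ≤ (a * j) ^ 2 / 2 := by
    calc (k : ℝ) * x / n = k / n * x := by ring
      _ ≤ a / 2 * (a * (j * j)) := by
        rw [hx]
        gcongr
        linarith
      _ = (a * j) ^ 2 / 2 := by ring
  have hu0 := abs_nonneg (u - p)
  refine abs_gfun_le_pow hx0 (by positivity) ?_ (by linarith) k le_rfl
  set Q := |u - p| + 5 * (a * j) with hQ
  have hQ5 : 5 * (a * j) ≤ Q := by linarith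
  have hw : 0 ≤ a * j := by linarith
  nlinarith [mul_le_mul_of_nonneg_right
    (by linarith : |u - x| + k / n ≤ Q - a * j / 2) (by linarith : 0 ≤ Q),
    mul_le_mul_of_nonneg_left hQ5 hw]

variable {k : ℕ}

/-- The normalized deviation bound for `gfun`, with `D` the deviation in units of
`c₁ j ln n / n`. -/
lemma abs_gfun_xctr_div_le (hL : 0 < c₁ * log n) (hn : 0 < n) (hj : 1 ≤ j) (hp : p ∈ Itil c₁ n j)
    (hk : 2 * (k : ℝ) ≤ c₁ * log n) (m : ℕ) :
    |gfun n k (xctr c₁ n j) ((m : ℝ) / n) / (30 * (c₁ * log n / n * j)) ^ k| ≤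
      ((5 + |(m : ℝ) - n * p| / (c₁ * log n * j)) / 30) ^ k := by
  have hn0 : (0 : ℝ) < n := by exact_mod_cast hn
  have hj0 : (0 : ℝ) < j := by exact_mod_cast hj
  have hw : 0 < c₁ * log n / n * j := by positivity
  rw [abs_div, abs_of_pos (by positivity : 0 < (30 * (c₁ * log n / n * j)) ^ k),
    div_le_iff₀ (by positivity), ← mul_pow]
  refine (abs_gfun_xctr_le hL.le hj hp hk _).trans_eq ?_
  have : (m : ℝ) / n - p = (m - n * p) / n := by field_simp
  rw [this, abs_div, abs_of_pos hn0]
  congr 1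
  generalize c₁ * log n = L at hL
  field_simp
  ring

lemma sq_gfun_xctr_div_le (hL : 0 < c₁ * log n) (hn : 0 < n) (hj : 1 ≤ j) (hp : p ∈ Itil c₁ n j)
    (hk : 2 * (k : ℝ) ≤ c₁ * log n) (m : ℕ) :
    (gfun n k (xctr c₁ n j) ((m : ℝ) / n) / (30 * (c₁ * log n / n * j)) ^ k) ^ 2 ≤
      exp (1 / (30 * j) * |(m : ℝ) - n * p|) := by
  have hj0 : (0 : ℝ) < j := by exact_mod_cast hj
  set D := |(m : ℝ) - n * p| / (c₁ * log n * j) with hD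
  have hD0 : 0 ≤ D := by positivity
  rw [← sq_abs]
  have h := abs_gfun_xctr_div_le hL hn hj hp hk m
  rw [← hD] at h
  calc _ ≤ (((5 + D) / 30) ^ k) ^ 2 := by gcongr
    _ ≤ ((exp (D / 30)) ^ k) ^ 2 := by
      gcongr
      linarith [add_one_le_exp (D / 30)]
    _ = exp (2 * k * (D / 30)) := by rw [← exp_nat_mul, ← exp_nat_mul]; push_cast; ring_nf
    _ ≤ exp (c₁ * log n * (D / 30)) := by gcongr
    _ = _ := by
      rw [hD]
      generalize c₁ * log n = L at hL
      congr 1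
      field_simp

end Bounds

section Moments

variable {c₁ : ℝ} {n j : ℕ} {p : ℝ} {k : ℕ}

lemma memLp_gfun_xctr_div (hL : 0 < c₁ * log n) (hn : 0 < n) (hj : 1 ≤ j)
    (hp : p ∈ Itil c₁ n j) (hk : 2 * (k : ℝ) ≤ c₁ * log n) {r : ℝ≥0} (hr : (r : ℝ) = n * p) :
    MemLp (fun m : ℕ => gfun n k (xctr c₁ n j) ((m : ℝ) / n) / (30 * (c₁ * log n / n * j)) ^ k) 2
      (poissonMeasure r) := by
  refine (memLp_two_iff_integrable_sq Measurable.of_discrete.aestronglyMeasurable).2 ?_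
  refine (integrable_exp_mul_abs_sub_poissonMeasure r (1 / (30 * j))).mono'
    Measurable.of_discrete.aestronglyMeasurable (.of_forall fun m => ?_)
  rw [norm_of_nonneg (sq_nonneg _), hr]
  exact sq_gfun_xctr_div_le hL hn hj hp hk m

lemma setIntegral_sq_gfun_xctr_div_le (hL : 0 < c₁ * log n) (hn : 0 < n) (hj : 1 ≤ j)
    (hp : p ∈ Itil c₁ n j) (hk : 2 * (k : ℝ) ≤ c₁ * log n) {r : ℝ≥0} (hr : (r : ℝ) = n * p) :
    ∫ m in {m : ℕ | |(m : ℝ) - n * p| ≤ 2 * (c₁ * log n * j)}ᶜ,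
      (gfun n k (xctr c₁ n j) ((m : ℝ) / n) / (30 * (c₁ * log n / n * j)) ^ k) ^ 2
        ∂poissonMeasure r ≤ 2 * exp (-(11 / 225) * (c₁ * log n)) := by
  have hn0 : (0 : ℝ) < n := by exact_mod_cast hn
  have hj1 : (1 : ℝ) ≤ j := by exact_mod_cast hj
  set s : ℝ := 1 / (15 * j) with hs
  have hs0 : 0 ≤ s := by positivity
  have hs1 : |s| ≤ 1 := by
    rw [abs_of_nonneg hs0, hs, div_le_one (by positivity)]; linarith
  have hint := (integrable_exp_mul_abs_sub_poissonMeasure r s).const_mul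
    (exp (-(c₁ * log n / 15)))
  refine (setIntegral_mono_on (memLp_gfun_xctr_div hL hn hj hp hk hr).integrable_sq.integrableOn
    hint.integrableOn .of_discrete fun m hm => ?_).trans ((setIntegral_le_integral hint
      (.of_forall fun m => by positivity)).trans ?_)
  · refine (sq_gfun_xctr_div_le hL hn hj hp hk m).trans ?_
    rw [← exp_add, exp_le_exp, hr]
    have hm' : 2 * (c₁ * log n * j) < |(m : ℝ) - n * p| := not_le.1 hm
    have h1 : s = 2 * (1 / (30 * j)) := by rw [hs]; field_simp; norm_num
    have h2 : c₁ * log n / 15 = 1 / (30 * j) * (2 * (c₁ * log n * j)) := by field_simp; ring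
    rw [h1, h2]
    have := mul_le_mul_of_nonneg_left hm'.le (by positivity : (0 : ℝ) ≤ 1 / (30 * j))
    linarith
  · rw [integral_const_mul]
    refine (mul_le_mul_of_nonneg_left (integral_exp_mul_abs_sub_poissonMeasure_le r hs1)
      (exp_nonneg _)).trans ?_
    rw [mul_left_comm, ← exp_add]
    gcongr
    obtain ⟨-, hp4, -⟩ := Itil_bounds hL.le hj hp
    have hnp : (r : ℝ) ≤ 4 * (c₁ * log n * j ^ 2) := by
      rw [hr]
      calc n * p ≤ n * (4 * (c₁ * log n / n * j ^ 2)) := by gcongr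
        _ = _ := by field_simp
    have h1 : (r : ℝ) * s ^ 2 ≤ 4 * (c₁ * log n * j ^ 2) * s ^ 2 := by gcongr
    have h2 : 4 * (c₁ * log n * j ^ 2) * s ^ 2 = 4 / 225 * (c₁ * log n) := by
      rw [hs]; field_simp; norm_num
    linarith

lemma integral_gfun_div (hn : 0 < n) {r : ℝ≥0} (hr : (r : ℝ) = n * p) (x w : ℝ) :
    ∫ m : ℕ, gfun n k x ((m : ℝ) / n) / w ∂poissonMeasure r = (p - x) ^ k / w := by
  rw [integral_div, integral_poissonMeasure, hr]
  simp only [smul_eq_mul]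
  rw [(hasSum_poisson_gfun hn.ne' p x k).tsum_eq]

end Moments

lemma measureReal_pi_poissonMeasure_eq_tsum {ι : Type*} [Fintype ι] (r : ι → ℝ≥0)
    (B : Set (ι → ℕ)) :
    (Measure.pi fun i => poissonMeasure (r i)).real B =
      ∑' m : ι → ℕ, B.indicator (fun m => ∏ i, exp (-(r i : ℝ)) * (r i : ℝ) ^ m i / (m i)!) m := by
  rw [← integral_indicator_one (.of_discrete), integral_countable
    ((integrable_const 1).indicator .of_discrete)]
  refine tsum_congr fun m => ?_
  by_cases hm : m ∈ B
  · simp only [Set.indicator_of_mem hm, Pi.one_apply, smul_eq_mul, mul_one]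
    rw [measureReal_def, Measure.pi_singleton, ENNReal.toReal_prod]
    exact prod_congr rfl fun i _ => poissonMeasure_real_singleton _ _
  · simp [hm]

lemma concentration_error_le {n : ℕ} (hn : 2 ≤ n) :
    2 * exp (-5 * log n) + 25 * (2 * exp (-(11 / 225) * (450 * log n))) / log n ≤
      2 * (n : ℝ) ^ (-(4 : ℝ)) := by
  have hn2 : (2 : ℝ) ≤ n := by exact_mod_cast hn
  have hn0 : (0 : ℝ) < n := by linarith
  have hln : 1 / 2 ≤ log n := by
    linarith [log_two_gt_d9, log_le_log two_pos hn2]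
  have e : ∀ q : ℕ, exp (-q * log n) = ((n : ℝ)⁻¹) ^ q := fun q => by
    rw [neg_mul, exp_neg, exp_nat_mul, exp_log hn0, inv_pow]
  have e5 := e 5
  have e22 := e 22
  push_cast at e5 e22
  have h22 : -(11 / 225) * (450 * log n) = -22 * log n := by ring
  rw [h22, e5, e22, rpow_neg hn0.le, show (4 : ℝ) = (4 : ℕ) by norm_num, rpow_natCast, ← inv_pow]
  set y := (n : ℝ)⁻¹ with hy
  have hy0 : 0 < y := by positivity
  have hy2 : y ≤ 1 / 2 := by
    rw [hy, ← one_div]; exact one_div_le_one_div_of_le two_pos hn2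
  have h18 : y ^ 18 ≤ (1 / 2) ^ 18 := pow_le_pow_left₀ hy0.le hy2 18
  have h1 : 25 * (2 * y ^ 22) / log n ≤ 100 * y ^ 22 := by
    rw [div_le_iff₀ (by linarith)]
    nlinarith [pow_pos hy0 22]
  have h4 := pow_pos hy0 4
  have h5 : y ^ 5 ≤ y ^ 4 * (1 / 2) := by rw [pow_succ]; gcongr
  have h6 : y ^ 22 ≤ y ^ 4 * (1 / 2) ^ 18 := by
    rw [show y ^ 22 = y ^ 4 * y ^ 18 by ring]; gcongr
  norm_num at h6
  linarith

theorem stmt12 :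
    ∃ c₁ : ℝ, 0 < c₁ ∧
      -- c₁ is the same constant as in the Poisson localization lemma:
      (∀ n j : ℕ, 2 ≤ n → 1 ≤ j → ∀ p ∈ Set.Icc (0 : ℝ) 1,
        p ∉ Itil c₁ n j →
        (∑' m : ℕ, (Iint c₁ n j).indicator
            (fun _ => Real.exp (-((n : ℝ) * p)) * ((n : ℝ) * p) ^ m / m.factorial)
            ((m : ℝ) / n)) ≤ (n : ℝ) ^ (-(5 : ℝ))) ∧
      -- the local moment-matching concentration property:
      ∀ c₂ c₃ : ℝ, 2 * c₂ < c₁ → 30 * c₁ < c₃ →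
        ∀ n : ℕ, 2 ≤ n → 1 ≤ c₂ * Real.log n →
        ∀ j : ℕ, 1 ≤ j →
        ∀ (ι : Type) [Fintype ι], ∀ p : ι → ℝ, (∀ i, p i ∈ Itil c₁ n j) →
        ∀ k : ℕ, 1 ≤ k → (k : ℝ) ≤ c₂ * Real.log n →
        (∑' m : ι → ℕ,
            {m' : ι → ℕ |
                Real.sqrt ((Fintype.card ι : ℝ) * Real.log n) *
                    (c₃ * (j : ℝ) * Real.log n / n) ^ k <
                  |(∑ i, gfun n k (xctr c₁ n j) ((m' i : ℝ) / n)) -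
                    ∑ i, (p i - xctr c₁ n j) ^ k|}.indicator
              (fun m' => ∏ i, Real.exp (-((n : ℝ) * p i)) * ((n : ℝ) * p i) ^ (m' i) /
                (m' i).factorial) m) ≤
          2 * (n : ℝ) ^ (-(4 : ℝ)) := by
  refine ⟨450, by norm_num, fun n j hn hj p hp hp' =>
    poisson_localization (by norm_num) hn hj hp.1 hp', ?_⟩
  intro c₂ c₃ hc₂ hc₃ n hn _ j hj ι _ p hp k hk1 hk
  have hn0 : 0 < n := by omega
  have hn0' : (0 : ℝ) < n := by exact_mod_cast hn0
  have hj1 : (1 : ℝ) ≤ j := by exact_mod_cast hj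
  have hln : 0 < log n := log_pos (by exact_mod_cast hn)
  have hL : 0 < 450 * log n := by positivity
  have hkL : 2 * (k : ℝ) ≤ 450 * log n := by nlinarith
  have hpn : ∀ i, 0 ≤ n * p i := fun i =>
    mul_nonneg hn0'.le (Itil_bounds hL.le hj (hp i)).1
  set r : ι → ℝ≥0 := fun i => ⟨n * p i, hpn i⟩ with hr
  set x := xctr 450 n j with hx
  set W : ℝ := (30 * (450 * log n / n * j)) ^ k with hW
  have hW0 : 0 < W := by positivity
  have hWle : W ≤ (c₃ * (j : ℝ) * log n / n) ^ k := by
    rw [hW]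
    gcongr
    calc 30 * (450 * log n / n * j) = 30 * 450 * (j * log n / n) := by ring
      _ ≤ c₃ * (j * log n / n) := by gcongr
      _ = _ := by ring
  refine le_trans (le_of_eq_of_le (measureReal_pi_poissonMeasure_eq_tsum r _).symm ?_)
    (concentration_error_le hn)
  refine (measureReal_mono ?_).trans (measureReal_sum_sub_integral_gt_le
    (f := fun _ (m : ℕ) => gfun n k x ((m : ℝ) / n) / W)
    (S := fun i => {m : ℕ | |(m : ℝ) - n * p i| ≤ 2 * (450 * log n * j)})
    (fun _ => .of_discrete) (fun _ => .of_discrete)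
    (fun i => memLp_gfun_xctr_div hL hn0 hj (hp i) hkL rfl) (fun i m hm => ?_) (by positivity)
    (fun i => setIntegral_sq_gfun_xctr_div_le hL hn0 hj (hp i) hkL rfl) hln)
  · intro m hm
    simp only [Set.mem_ofPred_eq] at hm ⊢
    have hmean : ∀ i, ∫ m : ℕ, gfun n k x ((m : ℝ) / n) / W ∂poissonMeasure (r i) =
        (p i - x) ^ k / W := fun i =>
      integral_gfun_div hn0 rfl x W
    simp only [hmean, ← sub_div, ← sum_div]
    rw [abs_div, abs_of_pos hW0, lt_div_iff₀ hW0, sum_sub_distrib]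
    exact lt_of_le_of_lt (by gcongr) hm
  · refine (abs_gfun_xctr_div_le hL hn0 hj (hp i) hkL m).trans ?_
    have hD : |(m : ℝ) - n * p i| / (450 * log n * j) ≤ 2 := by
      rw [div_le_iff₀ (by positivity)]; exact hm
    have hD0 : 0 ≤ |(m : ℝ) - n * p i| / (450 * log n * j) := by positivity
    refine (pow_le_of_le_one (by positivity) (by linarith) (by omega)).trans ?_
    linarith
end

section
/- Fix constants c₁, c₂, c₃ > 0 and ε > 0 with c₂(6 ln 2 + ln(5c₃/c₁)) < ε. Let n ≥ 2 satisfy c₂ ln n ≥ 1 and set K = c₂ ln n. Let j be a positive integer, x_j = c₁ j(j−1) ln n / n, and Ĩ_j = [ (c₁ ln n/n)(j−3/2)²·𝟙(j ≥ 2), (c₁ ln n/n)(j+1)² ]. Let S_j ≥ 0 and let μ, ν be finite Borel measures supported on Ĩ_j with μ(Ĩ_j) = ν(Ĩ_j) = S_j, such that for every integer k with 1 ≤ k ≤ K, | ∫ (x − x_j)^k μ(dx) − ∫ (x − x_j)^k ν(dx) | ≤ 2 √(S_j ln n) · (c₃ j ln n / n)^k. Then there exists a constant C₀, depending only on c₁,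 c₂, c₃, ε (in particular independent of n, j, S_j, μ, ν and f), such that for every 1-Lipschitz function f : ℝ → ℝ with f(0) = 0: | ∫ f dμ − ∫ f dν | ≤ C₀ ( ∫ √( x / (n ln n) ) (μ + ν)(dx) + j √(S_j) · n^{ε − 1} ). -/
open MeasureTheory

/-- `n` times the Fejér kernel, written as `|∑_{k<n} e^{iku}|²`. -/
noncomputable def fejerKernel (n : ℕ) (u : ℝ) : ℝ :=
  (∑ k ∈ Finset.range n, Real.cos (k * u)) ^ 2 + (∑ k ∈ Finset.range n, Real.sin (k * u)) ^ 2

/-- The quadruples indexing the Fourier expansion of the squared kernel. -/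
def quadIndex (n : ℕ) : Finset ((ℕ × ℕ) × ℕ × ℕ) :=
  (Finset.range n ×ˢ Finset.range n) ×ˢ Finset.range n ×ˢ Finset.range n

/-- The frequency attached to a quadruple. -/
def quadFreq (x : (ℕ × ℕ) × ℕ × ℕ) : ℤ := (x.1.1 - x.1.2) + (x.2.1 - x.2.2)

lemma natAbs_quadFreq_le {n : ℕ} {x : (ℕ × ℕ) × ℕ × ℕ} (hx : x ∈ quadIndex n) :
    (quadFreq x).natAbs ≤ 2 * (n - 1) := by
  simp only [quadIndex, Finset.mem_product, Finset.mem_range] at hx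
  simp only [quadFreq]
  omega

lemma card_quadIndex (n : ℕ) : (quadIndex n).card = n ^ 4 := by
  simp [quadIndex]; ring

lemma continuous_fejerKernel (n : ℕ) : Continuous (fejerKernel n) := by
  unfold fejerKernel; fun_prop

lemma fejerKernel_nonneg (n : ℕ) (u : ℝ) : 0 ≤ fejerKernel n u := by
  unfold fejerKernel; positivity

lemma fejerKernel_neg (n : ℕ) (u : ℝ) : fejerKernel n (-u) = fejerKernel n u := by
  simp [fejerKernel]

lemma fejerKernel_eq_sum_cos (n : ℕ) (u : ℝ) :
    fejerKernel n u = ∑ x ∈ Finset.range n ×ˢ Finset.range n,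
      Real.cos (((x.1 : ℝ) - x.2) * u) := by
  rw [fejerKernel, sq, sq, Finset.sum_mul_sum, Finset.sum_mul_sum, Finset.sum_product,
    ← Finset.sum_add_distrib]
  refine Finset.sum_congr rfl fun k _ => ?_
  rw [← Finset.sum_add_distrib]
  refine Finset.sum_congr rfl fun l _ => ?_
  rw [sub_mul, Real.cos_sub]

lemma sum_sin_sub_eq_zero (n : ℕ) (u : ℝ) :
    ∑ x ∈ Finset.range n ×ˢ Finset.range n, Real.sin (((x.1 : ℝ) - x.2) * u) = 0 := by
  simp only [sub_mul, Real.sin_sub, Finset.sum_sub_distrib, Finset.sum_product]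
  rw [sub_eq_zero, Finset.sum_comm]
  simp only [mul_comm]

lemma sq_fejerKernel_eq_sum_cos (n : ℕ) (u : ℝ) :
    fejerKernel n u ^ 2 = ∑ x ∈ quadIndex n, Real.cos (quadFreq x * u) := by
  have h (x : (ℕ × ℕ) × ℕ × ℕ) : Real.cos (quadFreq x * u) =
      Real.cos (((x.1.1 : ℝ) - x.1.2) * u) * Real.cos (((x.2.1 : ℝ) - x.2.2) * u) -
      Real.sin (((x.1.1 : ℝ) - x.1.2) * u) * Real.sin (((x.2.1 : ℝ) - x.2.2) * u) := by
    rw [← Real.cos_add, ← add_mul]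
    simp [quadFreq]
  simp only [h, quadIndex]
  have hp (s : Finset (ℕ × ℕ)) (a : ℕ × ℕ → ℝ) :
      ∑ x ∈ s ×ˢ s, a x.1 * a x.2 = (∑ x ∈ s, a x) * ∑ x ∈ s, a x := by
    rw [Finset.sum_mul_sum, Finset.sum_product]
  rw [Finset.sum_sub_distrib, hp _ fun x => Real.cos (((x.1 : ℝ) - x.2) * u),
    hp _ fun x => Real.sin (((x.1 : ℝ) - x.2) * u), sum_sin_sub_eq_zero,
    fejerKernel_eq_sum_cos]
  ring

lemma fejerKernel_mul_sin_sq_le (n : ℕ) (u : ℝ) :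
    fejerKernel n u * Real.sin (u / 2) ^ 2 ≤ 1 := by
  set C := ∑ k ∈ Finset.range n, Real.cos (k * u) with hC
  set S := ∑ k ∈ Finset.range n, Real.sin (k * u) with hS
  have h1 : C * (Real.cos u - 1) - S * Real.sin u = Real.cos (n * u) - 1 ∧
      C * Real.sin u + S * (Real.cos u - 1) = Real.sin (n * u) := by
    rw [hC, hS]
    clear hC hS C S
    induction n with
    | zero => simp
    | succ n ih =>
      obtain ⟨h1, h2⟩ := ih
      simp only [Finset.sum_range_succ]
      push_cast
      rw [add_mul (n : ℝ) 1 u, one_mul, Real.cos_add, Real.sin_add]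
      constructor <;> linarith
  have h2 : Real.cos u = 1 - 2 * Real.sin (u / 2) ^ 2 := by
    rw [Real.sin_sq_eq_half_sub, mul_div_cancel₀ u two_ne_zero]; ring
  have h3 : (C ^ 2 + S ^ 2) * (2 - 2 * Real.cos u) = 2 - 2 * Real.cos (n * u) := by
    have e1 := Real.sin_sq_add_cos_sq u
    have e2 := Real.sin_sq_add_cos_sq (n * u)
    obtain ⟨h1, h1'⟩ := h1
    calc (C ^ 2 + S ^ 2) * (2 - 2 * Real.cos u)
        = (C ^ 2 + S ^ 2) * ((Real.cos u - 1) ^ 2 + Real.sin u ^ 2) := by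
          congr 1; linarith
      _ = (C * (Real.cos u - 1) - S * Real.sin u) ^ 2 +
            (C * Real.sin u + S * (Real.cos u - 1)) ^ 2 := by ring
      _ = _ := by rw [h1, h1']; linarith
  have h4 := Real.neg_one_le_cos (n * u)
  change (C ^ 2 + S ^ 2) * _ ≤ 1
  rw [h2] at h3
  linarith

lemma integral_cos_int_mul (m : ℤ) :
    ∫ u in (-Real.pi)..Real.pi, Real.cos (m * u) = if m = 0 then 2 * Real.pi else 0 := by
  split_ifs with h
  · simp [h]; ring
  · have hm : (m : ℝ) ≠ 0 := by exact_mod_cast h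
    rw [intervalIntegral.integral_comp_mul_left (fun x => Real.cos x) hm, integral_cos]
    have := Real.sin_int_mul_pi m
    simp [this]

lemma integral_fejerKernel (n : ℕ) :
    ∫ u in (-Real.pi)..Real.pi, fejerKernel n u = 2 * Real.pi * n := by
  have h (x : ℕ × ℕ) : (((x.1 : ℤ) - x.2 : ℤ) : ℝ) = (x.1 : ℝ) - x.2 := by push_cast; rfl
  simp only [fejerKernel_eq_sum_cos, ← h]
  rw [intervalIntegral.integral_finsetSum
    (fun _ _ => Continuous.intervalIntegrable (by fun_prop) _ _)]
  simp only [integral_cos_int_mul, Finset.sum_product, sub_eq_zero, Nat.cast_inj]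
  rw [Finset.sum_congr rfl fun i hi => by rw [Finset.sum_ite_eq, if_pos hi]]
  simp; ring

lemma le_integral_sq_fejerKernel (n : ℕ) :
    Real.pi * (n : ℝ) ^ 3 ≤ ∫ u in (-Real.pi)..Real.pi, fejerKernel n u ^ 2 := by
  rcases Nat.eq_zero_or_pos n with rfl | hn
  · simp [fejerKernel]
  have hE : ∫ u in (-Real.pi)..Real.pi, fejerKernel n u ^ 2 =
      2 * Real.pi * Finset.addEnergy (Finset.range n) (Finset.range n) := by
    simp only [sq_fejerKernel_eq_sum_cos]
    rw [intervalIntegral.integral_finsetSum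
      (fun _ _ => Continuous.intervalIntegrable (by fun_prop) _ _)]
    simp only [integral_cos_int_mul]
    rw [← Finset.sum_filter, Finset.sum_const, nsmul_eq_mul, mul_comm]
    congr 2
    rw [Finset.addEnergy, quadIndex]
    congr 1
    refine Finset.filter_congr fun x _ => ?_
    simp only [quadFreq]
    omega
  open Pointwise in
  have hsub : Finset.range n + Finset.range n ⊆ Finset.range (2 * n) := by
    intro x hx
    obtain ⟨a, ha, b, hb, rfl⟩ := Finset.mem_add.1 hx
    simp only [Finset.mem_range] at *
    omega
  have h1 := Finset.le_card_add_mul_addEnergy (Finset.range n) (Finset.range n)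
  have h2 := h1.trans (Nat.mul_le_mul_right _ (Finset.card_le_card hsub))
  simp only [Finset.card_range] at h2
  have h3 : (n : ℝ) ^ 2 * n ^ 2 ≤ 2 * n *
    (Finset.addEnergy (Finset.range n) (Finset.range n) : ℝ) := by exact_mod_cast h2
  have hn' : (0 : ℝ) < n := by exact_mod_cast hn
  have h4 : (n : ℝ) ^ 3 ≤ 2 * (Finset.addEnergy (Finset.range n) (Finset.range n) : ℝ) := by
    refine le_of_mul_le_mul_left ?_ hn'
    linarith
  rw [hE]
  nlinarith [Real.pi_pos]

lemma integral_sq_fejerKernel_mul_sin_sq_le {n : ℕ} (hn : 0 < n) :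
    ∫ u in (-Real.pi)..Real.pi, fejerKernel n u ^ 2 * Real.sin (u / 2) ^ 2 ≤
      2 / (n : ℝ) ^ 2 * ∫ u in (-Real.pi)..Real.pi, fejerKernel n u ^ 2 := by
  have hn' : (0 : ℝ) < n := by exact_mod_cast hn
  have hc := continuous_fejerKernel n
  calc _ ≤ ∫ u in (-Real.pi)..Real.pi, fejerKernel n u := by
        refine intervalIntegral.integral_mono_on (by linarith [Real.pi_pos])
          (Continuous.intervalIntegrable (by fun_prop) _ _)
          (hc.intervalIntegrable _ _) fun u _ => ?_
        have := mul_le_mul_of_nonneg_left (fejerKernel_mul_sin_sq_le n u)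
          (fejerKernel_nonneg n u)
        linarith
    _ = 2 / (n : ℝ) ^ 2 * (Real.pi * (n : ℝ) ^ 3) := by
        rw [integral_fejerKernel]; field_simp
    _ ≤ _ := by
        gcongr
        exact le_integral_sq_fejerKernel n

lemma integral_sq_fejerKernel_mul_abs_sin_le {n : ℕ} (hn : 0 < n) :
    ∫ u in (-Real.pi)..Real.pi, fejerKernel n u ^ 2 * |Real.sin (u / 2)| ≤
      3 / (2 * n) * ∫ u in (-Real.pi)..Real.pi, fejerKernel n u ^ 2 := by
  have hn' : (0 : ℝ) < n := by exact_mod_cast hn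
  have hc := continuous_fejerKernel n
  have hi (h : ℝ → ℝ) (hh : Continuous h) : IntervalIntegrable h volume (-Real.pi) Real.pi :=
    hh.intervalIntegrable _ _
  calc _ ≤ ∫ u in (-Real.pi)..Real.pi, (1 / (2 * n) * fejerKernel n u ^ 2 +
          n / 2 * (fejerKernel n u ^ 2 * Real.sin (u / 2) ^ 2)) := by
        refine intervalIntegral.integral_mono_on (by linarith [Real.pi_pos])
          (hi _ (by fun_prop)) (hi _ (by fun_prop)) fun u _ => ?_
        have h1 : |Real.sin (u / 2)| ≤ 1 / (2 * n) + n / 2 * Real.sin (u / 2) ^ 2 := by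
          rw [← sq_abs (Real.sin (u / 2))]
          set w := |Real.sin (u / 2)|
          have : 1 / (2 * n) + n / 2 * w ^ 2 - w = (n * w - 1) ^ 2 / (2 * n) := by
            field_simp; ring
          have : 0 ≤ (n * w - 1) ^ 2 / (2 * n) := by positivity
          linarith
        have := mul_le_mul_of_nonneg_left h1 (sq_nonneg (fejerKernel n u))
        linarith
    _ = 1 / (2 * n) * (∫ u in (-Real.pi)..Real.pi, fejerKernel n u ^ 2) +
          n / 2 * ∫ u in (-Real.pi)..Real.pi, fejerKernel n u ^ 2 * Real.sin (u / 2) ^ 2 := by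
        rw [intervalIntegral.integral_add (hi _ (by fun_prop)) (hi _ (by fun_prop)),
          intervalIntegral.integral_const_mul, intervalIntegral.integral_const_mul]
    _ ≤ 1 / (2 * n) * (∫ u in (-Real.pi)..Real.pi, fejerKernel n u ^ 2) +
          n / 2 * (2 / (n : ℝ) ^ 2 * ∫ u in (-Real.pi)..Real.pi, fejerKernel n u ^ 2) := by
        gcongr
        exact integral_sq_fejerKernel_mul_sin_sq_le hn
    _ = _ := by field_simp; ring

lemma fejerKernel_periodic (n : ℕ) : Function.Periodic (fejerKernel n) (2 * Real.pi) := by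
  intro u
  simp [fejerKernel, mul_add, Real.cos_add_nat_mul_two_pi, Real.sin_add_nat_mul_two_pi]

lemma integral_neg_pi_pi_eq_zero_of_odd {h : ℝ → ℝ} (hodd : ∀ s, h (-s) = -h s) :
    ∫ s in (-Real.pi)..Real.pi, h s = 0 := by
  have h1 := intervalIntegral.integral_comp_neg (a := -Real.pi) (b := Real.pi) h
  simp only [hodd, neg_neg, intervalIntegral.integral_neg] at h1
  linarith

lemma abs_sin_add_le (a b : ℝ) : |Real.sin (a + b)| ≤ |Real.sin a| + |Real.sin b| := by
  rw [Real.sin_add]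
  refine (abs_add_le _ _).trans (add_le_add ?_ ?_)
  · rw [abs_mul]
    exact mul_le_of_le_one_right (abs_nonneg _) (Real.abs_cos_le_one _)
  · rw [abs_mul]
    exact mul_le_of_le_one_left (abs_nonneg _) (Real.abs_cos_le_one _)

lemma abs_integral_mul_sq_fejerKernel_le {n : ℕ} (hn : 0 < n) {h : ℝ → ℝ} (hh : Continuous h)
    {A B C : ℝ} (hB : 0 ≤ B) (hC : 0 ≤ C)
    (hle : ∀ s, |h s| ≤ A + B * |Real.sin (s / 2)| + C * Real.sin (s / 2) ^ 2) :
    |∫ s in (-Real.pi)..Real.pi, h s * fejerKernel n s ^ 2| ≤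
      (A + B * (3 / (2 * n)) + C * (2 / (n : ℝ) ^ 2)) *
        ∫ s in (-Real.pi)..Real.pi, fejerKernel n s ^ 2 := by
  have hc := continuous_fejerKernel n
  have hi (h : ℝ → ℝ) (hh : Continuous h) : IntervalIntegrable h volume (-Real.pi) Real.pi :=
    hh.intervalIntegrable _ _
  have hpi : -Real.pi ≤ Real.pi := by linarith [Real.pi_pos]
  calc _ ≤ ∫ s in (-Real.pi)..Real.pi, |h s * fejerKernel n s ^ 2| :=
        intervalIntegral.abs_integral_le_integral_abs hpi
    _ ≤ ∫ s in (-Real.pi)..Real.pi, (A * fejerKernel n s ^ 2 +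
          B * (fejerKernel n s ^ 2 * |Real.sin (s / 2)|) +
          C * (fejerKernel n s ^ 2 * Real.sin (s / 2) ^ 2)) := by
        refine intervalIntegral.integral_mono_on hpi
          (hi _ (by fun_prop)) (hi _ (by fun_prop)) fun s _ => ?_
        rw [abs_mul, abs_of_nonneg (sq_nonneg (fejerKernel n s))]
        have := mul_le_mul_of_nonneg_right (hle s) (sq_nonneg (fejerKernel n s))
        linarith
    _ = A * (∫ s in (-Real.pi)..Real.pi, fejerKernel n s ^ 2) +
          B * (∫ s in (-Real.pi)..Real.pi, fejerKernel n s ^ 2 * |Real.sin (s / 2)|) +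
          C * ∫ s in (-Real.pi)..Real.pi, fejerKernel n s ^ 2 * Real.sin (s / 2) ^ 2 := by
        rw [intervalIntegral.integral_add (hi _ (by fun_prop)) (hi _ (by fun_prop)),
          intervalIntegral.integral_add (hi _ (by fun_prop)) (hi _ (by fun_prop)),
          intervalIntegral.integral_const_mul, intervalIntegral.integral_const_mul,
          intervalIntegral.integral_const_mul]
    _ ≤ A * (∫ s in (-Real.pi)..Real.pi, fejerKernel n s ^ 2) +
          B * (3 / (2 * n) * ∫ s in (-Real.pi)..Real.pi, fejerKernel n s ^ 2) +
          C * (2 / (n : ℝ) ^ 2 * ∫ s in (-Real.pi)..Real.pi, fejerKernel n s ^ 2) := by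
        gcongr
        · exact integral_sq_fejerKernel_mul_abs_sin_le hn
        · exact integral_sq_fejerKernel_mul_sin_sq_le hn
    _ = _ := by ring

/-- The Chebyshev polynomial of the first kind transported from `[-1, 1]` to `[0, 1]`. -/
noncomputable def shiftedChebyshev (m : ℤ) : Polynomial ℝ :=
  (Polynomial.Chebyshev.T ℝ m).comp (1 - 2 * Polynomial.X)

lemma eval_shiftedChebyshev (m : ℤ) (φ : ℝ) :
    (shiftedChebyshev m).eval ((1 - Real.cos φ) / 2) = Real.cos (m * φ) := by
  rw [shiftedChebyshev, Polynomial.eval_comp, ← Polynomial.Chebyshev.T_real_cos]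
  congr 1
  simp
  ring

lemma natDegree_shiftedChebyshev_le (m : ℤ) : (shiftedChebyshev m).natDegree ≤ m.natAbs := by
  have h : (1 - 2 * Polynomial.X : Polynomial ℝ).natDegree ≤ 1 := by compute_degree
  refine Polynomial.natDegree_comp_le.trans ?_
  rw [Polynomial.Chebyshev.natDegree_T]
  exact (Nat.mul_le_mul_left _ h).trans (by simp)

lemma abs_coeff_shiftedChebyshev_le (m : ℤ) (k : ℕ) :
    |(shiftedChebyshev m).coeff k| ≤ 7 ^ m.natAbs := by
  have key (N : ℕ) : (∀ k, |(shiftedChebyshev N).coeff k| ≤ 7 ^ N) ∧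
      ∀ k, |(shiftedChebyshev (N + 1)).coeff k| ≤ 7 ^ (N + 1) := by
    induction N with
    | zero =>
      constructor <;> intro k <;> rcases k with _ | _ | k <;>
        norm_num [shiftedChebyshev, Polynomial.coeff_one, Polynomial.coeff_X,
          Polynomial.coeff_ofNat_mul]
    | succ N ih =>
      refine ⟨by exact_mod_cast ih.2, fun k => ?_⟩
      have h : shiftedChebyshev ((N + 1 : ℕ) + 1) =
          2 * shiftedChebyshev (N + 1) - 4 * (Polynomial.X * shiftedChebyshev (N + 1)) -
            shiftedChebyshev N := by
        have := Polynomial.Chebyshev.T_add_two ℝ (N : ℤ)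
        rw [shiftedChebyshev, shiftedChebyshev, shiftedChebyshev]
        push_cast
        rw [add_assoc, one_add_one_eq_two, this]
        simp only [Polynomial.sub_comp, Polynomial.mul_comp, Polynomial.X_comp,
          Polynomial.ofNat_comp]
        ring
      have h1 := ih.2 k
      have h2 : |(Polynomial.X * shiftedChebyshev (N + 1)).coeff k| ≤ 7 ^ (N + 1) := by
        rcases k with _ | k
        · simp
        · rw [Polynomial.coeff_X_mul]; exact ih.2 k
      have h3 := ih.1 k
      have h4 : (0 : ℝ) < 7 ^ N := by positivity
      rw [h, Polynomial.coeff_sub, Polynomial.coeff_sub, Polynomial.coeff_ofNat_mul,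
        Polynomial.coeff_ofNat_mul]
      rw [pow_succ] at h1 h2
      rw [pow_succ, pow_succ]
      rw [abs_le] at *
      constructor <;> norm_num <;> linarith [h1.1, h1.2, h2.1, h2.2, h3.1, h3.2]
  have := (key m.natAbs).1 k
  rwa [shiftedChebyshev, Polynomial.Chebyshev.T_natAbs] at this

/-- Jackson-type theorem on `[0, 1]` with an error that vanishes at the left endpoint. -/
theorem exists_polynomial_approx_sqrt {n : ℕ} (hn : 0 < n) {g : ℝ → ℝ} (hg : LipschitzWith 1 g)
    (hg0 : g 0 = 0) :
    ∃ Q : Polynomial ℝ, Q.natDegree ≤ 2 * (n - 1) ∧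
      (∀ k, |Q.coeff k| ≤ 2 * n * 7 ^ (2 * (n - 1))) ∧
      ∀ y ∈ Set.Icc (0 : ℝ) 1, |g y - (Q.eval y - Q.eval 0)| ≤ 7 * Real.sqrt y / n := by
  have hn' : (0 : ℝ) < n := by exact_mod_cast hn
  have hK := continuous_fejerKernel n
  set W := ∫ u in (-Real.pi)..Real.pi, fejerKernel n u ^ 2 with hW
  have hWle : Real.pi * (n : ℝ) ^ 3 ≤ W := le_integral_sq_fejerKernel n
  have hW0 : 0 < W := lt_of_lt_of_le (by positivity) hWle
  set F : ℝ → ℝ := fun s => g ((1 - Real.cos s) / 2) with hF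
  have hgc : Continuous g := hg.continuous
  have hFc : Continuous F := by fun_prop
  have hFneg (s : ℝ) : F (-s) = F s := by simp [hF]
  have hFper : Function.Periodic F (2 * Real.pi) := fun s => by simp [hF]
  have hFlip (s t : ℝ) : |F s - F t| ≤ |Real.sin ((s + t) / 2)| * |Real.sin ((s - t) / 2)| := by
    have h1 := hg.dist_le_mul ((1 - Real.cos s) / 2) ((1 - Real.cos t) / 2)
    rw [Real.dist_eq, Real.dist_eq, NNReal.coe_one, one_mul] at h1
    refine h1.trans (le_of_eq ?_)
    rw [← abs_mul, ← sub_div, sub_sub_sub_cancel_left, ← neg_sub, Real.cos_sub_cos]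
    congr 1
    ring
  have hFle (s : ℝ) : |F s| ≤ 1 := by
    have h1 := hFlip s 0
    have h0 : F 0 = 0 := by simp [hF, hg0]
    rw [h0, sub_zero] at h1
    exact h1.trans (mul_le_one₀ (Real.abs_sin_le_one _) (abs_nonneg _) (Real.abs_sin_le_one _))
  have hi (h : ℝ → ℝ) (hh : Continuous h) : IntervalIntegrable h volume (-Real.pi) Real.pi :=
    hh.intervalIntegrable _ _
  set c : ℤ → ℝ := fun m => ∫ s in (-Real.pi)..Real.pi, F s * Real.cos (m * s) with hc
  have hcle (m : ℤ) : |c m| ≤ 2 * Real.pi := by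
    have h1 := intervalIntegral.norm_integral_le_of_norm_le_const (a := -Real.pi) (b := Real.pi)
      (f := fun s => F s * Real.cos (m * s)) (C := 1) fun s _ => by
        rw [Real.norm_eq_abs, abs_mul]
        exact mul_le_one₀ (hFle s) (abs_nonneg _) (Real.abs_cos_le_one _)
    rw [Real.norm_eq_abs, sub_neg_eq_add, ← two_mul, one_mul,
      abs_of_pos (by positivity : 0 < 2 * Real.pi)] at h1
    exact h1
  set Q : Polynomial ℝ := ∑ x ∈ quadIndex n,
    Polynomial.C (W⁻¹ * c (quadFreq x)) * shiftedChebyshev (quadFreq x) with hQ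
  have hQeval (φ : ℝ) : Q.eval ((1 - Real.cos φ) / 2) =
      W⁻¹ * ∫ s in (-Real.pi)..Real.pi, F (s + φ) * fejerKernel n s ^ 2 := by
    have h1 : ∫ s in (-Real.pi)..Real.pi, F (s + φ) * fejerKernel n s ^ 2 =
        ∫ s in (-Real.pi)..Real.pi, F s * fejerKernel n (s - φ) ^ 2 := by
      have hp : Function.Periodic (fun s => F s * fejerKernel n (s - φ) ^ 2) (2 * Real.pi) := by
        intro s
        simp only [hFper s, add_sub_right_comm s (2 * Real.pi) φ, fejerKernel_periodic n (s - φ)]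
      have h2 := intervalIntegral.integral_comp_add_right (a := -Real.pi) (b := Real.pi)
        (fun s => F s * fejerKernel n (s - φ) ^ 2) φ
      simp only [add_sub_cancel_right] at h2
      rw [h2]
      have h3 := hp.intervalIntegral_add_eq (-Real.pi + φ) (-Real.pi)
      rw [show -Real.pi + φ + 2 * Real.pi = Real.pi + φ by ring,
        show -Real.pi + 2 * Real.pi = Real.pi by ring] at h3
      exact h3
    have h2 (s : ℝ) : F s * fejerKernel n (s - φ) ^ 2 =
        (∑ x ∈ quadIndex n, Real.cos (quadFreq x * φ) * (F s * Real.cos (quadFreq x * s))) +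
        F s * ∑ x ∈ quadIndex n, Real.sin (quadFreq x * s) * Real.sin (quadFreq x * φ) := by
      rw [sq_fejerKernel_eq_sum_cos]
      simp only [mul_sub, Real.cos_sub, Finset.sum_add_distrib, mul_add, Finset.mul_sum]
      congr 1
      exact Finset.sum_congr rfl fun x _ => by ring
    rw [h1]
    simp only [h2]
    rw [intervalIntegral.integral_add (hi _ (by fun_prop)) (hi _ (by fun_prop)),
      integral_neg_pi_pi_eq_zero_of_odd
        (h := fun s => F s * ∑ x ∈ quadIndex n,
          Real.sin (quadFreq x * s) * Real.sin (quadFreq x * φ))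
        (fun s => by simp [hFneg, Finset.sum_neg_distrib]), add_zero,
      intervalIntegral.integral_finsetSum fun _ _ => hi _ (by fun_prop), hQ,
      Polynomial.eval_finsetSum, Finset.mul_sum]
    refine Finset.sum_congr rfl fun x _ => ?_
    rw [Polynomial.eval_mul, Polynomial.eval_C, eval_shiftedChebyshev,
      intervalIntegral.integral_const_mul]
    ring
  have hbound (h : ℝ → ℝ) (hh : Continuous h) (A B C : ℝ) (hB : 0 ≤ B) (hC : 0 ≤ C)
      (hle : ∀ s, |h s| ≤ A + B * |Real.sin (s / 2)| + C * Real.sin (s / 2) ^ 2) :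
      |W⁻¹ * ∫ s in (-Real.pi)..Real.pi, h s * fejerKernel n s ^ 2| ≤
        A + B * (3 / (2 * n)) + C * (2 / (n : ℝ) ^ 2) := by
    rw [abs_mul, abs_of_pos (inv_pos.2 hW0), inv_mul_le_iff₀ hW0, mul_comm W]
    exact abs_integral_mul_sq_fejerKernel_le hn hh hB hC hle
  have hnear (φ : ℝ) : |F φ - Q.eval ((1 - Real.cos φ) / 2)| ≤
      3 * |Real.sin (φ / 2)| / n + 2 / (n : ℝ) ^ 2 := by
    have h1 : Q.eval ((1 - Real.cos φ) / 2) - F φ =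
        W⁻¹ * ∫ s in (-Real.pi)..Real.pi, (F (s + φ) - F φ) * fejerKernel n s ^ 2 := by
      simp only [sub_mul]
      rw [intervalIntegral.integral_sub (hi _ (by fun_prop)) (hi _ (by fun_prop)),
        intervalIntegral.integral_const_mul, ← hW, hQeval]
      field_simp
    rw [abs_sub_comm, h1]
    refine (hbound _ (by fun_prop) 0 (2 * |Real.sin (φ / 2)|) 1 (by positivity) zero_le_one
      fun s => ?_).trans (le_of_eq (by field_simp; ring))
    refine (hFlip _ _).trans ?_
    rw [add_sub_cancel_right, ← sq_abs (Real.sin (s / 2)),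
      show (s + φ + φ) / 2 = s / 2 + φ / 2 + φ / 2 by ring]
    have h2 := abs_sin_add_le (s / 2 + φ / 2) (φ / 2)
    have h3 := abs_sin_add_le (s / 2) (φ / 2)
    nlinarith [abs_nonneg (Real.sin (s / 2))]
  have hzero (φ : ℝ) : |Q.eval ((1 - Real.cos φ) / 2) - Q.eval 0| ≤
      |Real.sin (φ / 2)| * (3 / n + |Real.sin (φ / 2)|) := by
    have h0 := hQeval 0
    simp only [Real.cos_zero, sub_self, zero_div, add_zero] at h0
    have h1 : Q.eval ((1 - Real.cos φ) / 2) - Q.eval 0 =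
        W⁻¹ * ∫ s in (-Real.pi)..Real.pi, (F (s + φ) - F s) * fejerKernel n s ^ 2 := by
      simp only [sub_mul]
      rw [intervalIntegral.integral_sub (hi _ (by fun_prop)) (hi _ (by fun_prop)), hQeval, h0]
      ring
    rw [h1]
    refine (hbound _ (by fun_prop) (|Real.sin (φ / 2)| ^ 2) (2 * |Real.sin (φ / 2)|) 0
      (by positivity) le_rfl fun s => ?_).trans (le_of_eq (by field_simp; ring))
    refine (hFlip _ _).trans ?_
    rw [add_sub_cancel_left, show (s + φ + s) / 2 = s / 2 + φ / 2 + s / 2 by ring]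
    have h2 := abs_sin_add_le (s / 2 + φ / 2) (s / 2)
    have h3 := abs_sin_add_le (s / 2) (φ / 2)
    nlinarith [abs_nonneg (Real.sin (φ / 2))]
  refine ⟨Q, ?_, fun k => ?_, fun y hy => ?_⟩
  · refine Polynomial.natDegree_sum_le_of_forall_le _ _ fun x hx => ?_
    exact (Polynomial.natDegree_C_mul_le _ _).trans
      ((natDegree_shiftedChebyshev_le _).trans (natAbs_quadFreq_le hx))
  · rw [hQ, Polynomial.finsetSum_coeff]
    refine (Finset.abs_sum_le_sum_abs _ _).trans ?_
    have h1 : ∀ x ∈ quadIndex n, |(Polynomial.C (W⁻¹ * c (quadFreq x)) *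
        shiftedChebyshev (quadFreq x)).coeff k| ≤ 2 / (n : ℝ) ^ 3 * 7 ^ (2 * (n - 1)) := by
      intro x hx
      rw [Polynomial.coeff_C_mul, abs_mul]
      gcongr
      · rw [abs_mul, abs_of_pos (inv_pos.2 hW0), inv_mul_le_iff₀ hW0]
        refine (hcle _).trans ?_
        rw [mul_div_assoc', le_div_iff₀ (by positivity)]
        linarith
      · exact (abs_coeff_shiftedChebyshev_le _ _).trans
          (pow_le_pow_right₀ (by norm_num) (natAbs_quadFreq_le hx))
    refine (Finset.sum_le_sum h1).trans (le_of_eq ?_)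
    rw [Finset.sum_const, card_quadIndex, nsmul_eq_mul]
    push_cast
    field_simp
  · obtain ⟨hy0, hy1⟩ := hy
    set φ := Real.arccos (1 - 2 * y) with hφ
    have hcos : Real.cos φ = 1 - 2 * y := Real.cos_arccos (by linarith) (by linarith)
    have hyφ : (1 - Real.cos φ) / 2 = y := by rw [hcos]; ring
    have hr : |Real.sin (φ / 2)| = Real.sqrt y := by
      rw [← Real.sqrt_sq_eq_abs, Real.sin_sq_eq_half_sub, mul_div_cancel₀ φ two_ne_zero, hcos]
      congr 1; ring
    have h1 := hnear φ
    have h2 := hzero φ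
    have h3 := hnear 0
    have hF0 : F 0 = 0 := by simp [hF, hg0]
    have hFφ : F φ = g y := by simp only [hF, hyφ]
    rw [hyφ, hr, hFφ] at h1
    rw [hyφ, hr] at h2
    rw [hF0] at h3
    simp only [Real.cos_zero, sub_self, zero_div, Real.sin_zero, abs_zero, mul_zero,
      zero_add, zero_sub, abs_neg] at h3
    have hsq := Real.sq_sqrt hy0
    set r := Real.sqrt y
    have hr0 : 0 ≤ r := Real.sqrt_nonneg y
    have hgy : |g y| ≤ r ^ 2 := by
      have := hg.dist_le_mul y 0
      rw [hg0, Real.dist_eq, Real.dist_eq, NNReal.coe_one, one_mul, sub_zero, sub_zero,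
        abs_of_nonneg hy0] at this
      rwa [hsq]
    rcases le_total r (1 / n) with hrn | hrn
    · have h4 : r * r ≤ r / n := by
        have := mul_le_mul_of_nonneg_left hrn hr0
        rwa [mul_one_div] at this
      have h5 : r * (3 / n + r) = 3 * (r / n) + r * r := by ring
      have h6 : 7 * r / n = 7 * (r / n) := by ring
      have h7 : 0 ≤ r / n := by positivity
      refine (abs_sub _ _).trans ?_
      rw [h6]
      nlinarith
    · have h4 : 1 / (n : ℝ) ^ 2 ≤ r / n := by
        rw [sq, ← div_div]
        gcongr
      have h5 : 3 * r / n + 2 / (n : ℝ) ^ 2 = 3 * (r / n) + 2 * (1 / (n : ℝ) ^ 2) := by ring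
      have h6 : 7 * r / n = 7 * (r / n) := by ring
      have h7 : 2 / (n : ℝ) ^ 2 = 2 * (1 / (n : ℝ) ^ 2) := by ring
      rw [← sub_add]
      refine (abs_add_le _ _).trans ?_
      rw [h6]
      linarith

lemma integrable_of_continuous_of_compl_null {μ : Measure ℝ} [IsFiniteMeasure μ] {K : Set ℝ}
    (hK : IsCompact K) (hμ : μ Kᶜ = 0) {h : ℝ → ℝ} (hh : Continuous h) : Integrable h μ := by
  have h1 : μ.restrict K = μ := Measure.restrict_eq_self_of_ae_mem (ae_iff.2 hμ)
  rw [← h1]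
  exact hh.continuousOn.integrableOn_compact hK

lemma integral_sub_integral_sum {ι : Type*} {μ ν : Measure ℝ}
    (hμ : ∀ h : ℝ → ℝ, Continuous h → Integrable h μ)
    (hν : ∀ h : ℝ → ℝ, Continuous h → Integrable h ν)
    (s : Finset ι) (w : ι → ℝ) (h : ι → ℝ → ℝ)
    (hh : ∀ i, Continuous (h i)) :
    (∫ x, ∑ i ∈ s, w i * h i x ∂μ) - ∫ x, ∑ i ∈ s, w i * h i x ∂ν =
      ∑ i ∈ s, w i * ((∫ x, h i x ∂μ) - ∫ x, h i x ∂ν) := by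
  rw [integral_finsetSum _ fun i _ => (hμ _ (hh i)).const_mul _,
    integral_finsetSum _ fun i _ => (hν _ (hh i)).const_mul _, ← Finset.sum_sub_distrib]
  simp only [integral_const_mul, mul_sub]

lemma abs_moment_sub_le_recenter {μ ν : Measure ℝ}
    (hμ : ∀ h : ℝ → ℝ, Continuous h → Integrable h μ)
    (hν : ∀ h : ℝ → ℝ, Continuous h → Integrable h ν)
    {B ρ a c : ℝ} {d : ℕ}
    (hmom : ∀ k ≤ d, |(∫ x, (x - c) ^ k ∂μ) - ∫ x, (x - c) ^ k ∂ν| ≤ B * ρ ^ k)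
    {k : ℕ} (hk : k ≤ d) :
    |(∫ x, (x - a) ^ k ∂μ) - ∫ x, (x - a) ^ k ∂ν| ≤ B * (ρ + |c - a|) ^ k := by
  have h (x : ℝ) : (x - a) ^ k =
      ∑ m ∈ Finset.range (k + 1), ((c - a) ^ (k - m) * k.choose m) * (x - c) ^ m := by
    rw [← sub_add_sub_cancel x c a, add_pow]
    exact Finset.sum_congr rfl fun _ _ => by ring
  simp only [h]
  rw [integral_sub_integral_sum hμ hν _ _ (fun m x => (x - c) ^ m) (fun _ => by fun_prop),
    add_pow, Finset.mul_sum]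
  refine (Finset.abs_sum_le_sum_abs _ _).trans (Finset.sum_le_sum fun m hm => ?_)
  rw [abs_mul, abs_mul, abs_pow, Nat.abs_cast]
  have hm' : m ≤ d := (Nat.lt_succ_iff.1 (Finset.mem_range.1 hm)).trans hk
  calc _ ≤ |c - a| ^ (k - m) * (k.choose m : ℝ) * (B * ρ ^ m) := by
        gcongr
        exact hmom m hm'
    _ = _ := by ring

lemma abs_integral_polynomial_sub_le {μ ν : Measure ℝ}
    (hμ : ∀ h : ℝ → ℝ, Continuous h → Integrable h μ)
    (hν : ∀ h : ℝ → ℝ, Continuous h → Integrable h ν)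
    {B ρ a b c R M : ℝ} {d : ℕ} (hB : 0 ≤ B) (hb : 0 < b)
    (hρ : 0 ≤ ρ) (hR : 1 ≤ R) (hRb : ρ + |c - a| ≤ R * b)
    (hmom : ∀ k ≤ d, |(∫ x, (x - c) ^ k ∂μ) - ∫ x, (x - c) ^ k ∂ν| ≤ B * ρ ^ k)
    {Q : Polynomial ℝ} (hQ : Q.natDegree ≤ d) (hM : ∀ k, |Q.coeff k| ≤ M) :
    |(∫ x, Q.eval ((x - a) / b) ∂μ) - ∫ x, Q.eval ((x - a) / b) ∂ν| ≤
      (d + 1) * (M * (B * R ^ d)) := by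
  have hM0 : 0 ≤ M := (abs_nonneg _).trans (hM 0)
  have h (x : ℝ) : Q.eval ((x - a) / b) =
      ∑ k ∈ Finset.range (d + 1), (Q.coeff k * (b ^ k)⁻¹) * (x - a) ^ k := by
    rw [Polynomial.eval_eq_sum_range' (Nat.lt_succ_of_le hQ)]
    exact Finset.sum_congr rfl fun k _ => by rw [div_pow]; ring
  simp only [h]
  rw [integral_sub_integral_sum hμ hν _ _ (fun k x => (x - a) ^ k) (fun _ => by fun_prop)]
  refine (Finset.abs_sum_le_sum_abs _ _).trans ?_
  have h1 : ∀ k ∈ Finset.range (d + 1), |(Q.coeff k * (b ^ k)⁻¹) *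
      ((∫ x, (x - a) ^ k ∂μ) - ∫ x, (x - a) ^ k ∂ν)| ≤ M * (B * R ^ d) := by
    intro k hk
    have hk' : k ≤ d := Nat.lt_succ_iff.1 (Finset.mem_range.1 hk)
    rw [mul_assoc, abs_mul]
    gcongr
    · exact hM k
    · rw [abs_mul, abs_of_pos (by positivity : 0 < (b ^ k)⁻¹), inv_mul_le_iff₀ (by positivity)]
      calc _ ≤ B * (ρ + |c - a|) ^ k := abs_moment_sub_le_recenter hμ hν hmom hk'
        _ ≤ B * (R * b) ^ k := by gcongr
        _ = b ^ k * (B * R ^ k) := by ring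
        _ ≤ b ^ k * (B * R ^ d) := by gcongr
  refine (Finset.sum_le_sum h1).trans (le_of_eq ?_)
  simp

lemma lipschitzWith_one_rescale {f : ℝ → ℝ} (hf : LipschitzWith 1 f) (a : ℝ) {b : ℝ}
    (hb : 0 < b) : LipschitzWith 1 fun y => (f (a + b * y) - f a) / b := by
  refine LipschitzWith.of_dist_le_mul fun y z => ?_
  have h := hf.dist_le_mul (a + b * y) (a + b * z)
  rw [Real.dist_eq, Real.dist_eq, NNReal.coe_one, one_mul] at *
  rw [← sub_div, sub_sub_sub_cancel_right, abs_div, abs_of_pos hb, div_le_iff₀ hb]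
  rw [add_sub_add_left_eq_sub, ← mul_sub, abs_mul, abs_of_pos hb] at h
  linarith

lemma log_mul_sqrt_log_le {ε x : ℝ} (hε : 0 < ε) (hx : 1 ≤ x) :
    Real.log x * Real.sqrt (Real.log x) ≤ (1 + 4 / ε) ^ 2 * x ^ (ε / 2) := by
  have hL : 0 ≤ Real.log x := Real.log_nonneg hx
  have h1 : Real.log x ≤ x ^ (ε / 4) / (ε / 4) :=
    Real.log_le_rpow_div (by linarith) (by linarith)
  have h2 : 1 ≤ x ^ (ε / 4) := Real.one_le_rpow hx (by linarith)
  have h3 : Real.sqrt (Real.log x) ≤ 1 + Real.log x :=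
    Real.sqrt_le_iff.2 ⟨by linarith, by nlinarith⟩
  have h4 : 1 + Real.log x ≤ (1 + 4 / ε) * x ^ (ε / 4) := by
    have : x ^ (ε / 4) / (ε / 4) = 4 / ε * x ^ (ε / 4) := by field_simp
    linarith
  have h5 : x ^ (ε / 2) = x ^ (ε / 4) * x ^ (ε / 4) := by
    rw [← Real.rpow_add (by linarith)]; congr 1; ring
  calc _ ≤ (1 + Real.log x) * (1 + Real.log x) := by gcongr; linarith
    _ ≤ ((1 + 4 / ε) * x ^ (ε / 4)) * ((1 + 4 / ε) * x ^ (ε / 4)) := by gcongr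
    _ = _ := by rw [h5]; ring

lemma sq_mul_pow_le_rpow {R δ η x : ℝ} {N : ℕ} (hR : 1 ≤ R) (hx : 1 ≤ x)
    (hN : (N : ℝ) ≤ δ * Real.log x) (hδ : δ * Real.log (196 * R ^ 2) ≤ η) :
    ((N : ℝ) + 1) ^ 2 * (7 * R) ^ (2 * N) ≤ x ^ η := by
  have h1 : (N : ℝ) + 1 ≤ 2 ^ N := by exact_mod_cast Nat.lt_two_pow_self
  have hR2 : 1 ≤ 196 * R ^ 2 := by nlinarith
  calc _ ≤ ((2 : ℝ) ^ N) ^ 2 * (7 * R) ^ (2 * N) := by gcongr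
    _ = (196 * R ^ 2) ^ N := by
        rw [← pow_mul, mul_comm N 2, pow_mul, pow_mul, ← mul_pow]; congr 1; ring
    _ = (196 * R ^ 2) ^ (N : ℝ) := (Real.rpow_natCast _ _).symm
    _ ≤ (196 * R ^ 2) ^ (δ * Real.log x) := Real.rpow_le_rpow_of_exponent_le hR2 hN
    _ = x ^ (δ * Real.log (196 * R ^ 2)) := by
        rw [Real.rpow_def_of_pos (by linarith), Real.rpow_def_of_pos (by linarith)]
        congr 1; ring
    _ ≤ x ^ η := Real.rpow_le_rpow_of_exponent_le hx hδ

/-- Geometry of `Itil` in units of `D = c₁ ln n / n`: with `a` its left endpoint and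
`b = 5 D j`. -/
lemma exists_leftEndpoint_Itil {c₁ : ℝ} {n j : ℕ} (hj : 1 ≤ j)
    (hD : 0 < c₁ * Real.log n / n) :
    ∃ a : ℝ, |xctr c₁ n j - a| ≤ 2 * (c₁ * Real.log n / n * j) ∧ ∀ x ∈ Itil c₁ n j,
      0 ≤ x ∧ a ≤ x ∧ x - a ≤ 5 * (c₁ * Real.log n / n * j) ∧
      5 * (c₁ * Real.log n / n * j) * (x - a) ≤ 400 * (c₁ * Real.log n / n * x) := by
  have hx : xctr c₁ n j = c₁ * Real.log n / n * (j * (j - 1)) := by rw [xctr]; ring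
  rw [hx, Itil]
  set D := c₁ * Real.log n / n
  rcases hj.eq_or_lt with rfl | hj
  · refine ⟨0, by simp [hD.le], fun x hx => ?_⟩
    norm_num at hx
    obtain ⟨h1, h2⟩ := hx
    norm_num
    exact ⟨h1, by linarith, by nlinarith⟩
  · have hj2 : (2 : ℝ) ≤ j := by exact_mod_cast hj
    have hj2' : 2 ≤ j := hj
    refine ⟨D * (j - 3 / 2) ^ 2, ?_, fun x hx => ?_⟩
    · rw [← mul_sub, abs_mul, abs_of_pos hD, ← mul_assoc, mul_comm 2 D, mul_assoc]
      refine mul_le_mul_of_nonneg_left ?_ hD.le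
      rw [abs_le]
      constructor <;> nlinarith
    · rw [if_pos hj2', mul_one] at hx
      obtain ⟨h1, h2⟩ := hx
      have h3 : x - D * (j - 3 / 2) ^ 2 ≤ 5 * (D * j) := by nlinarith
      have h4 : 0 ≤ D * ((j : ℝ) - 3 / 2) ^ 2 := by positivity
      refine ⟨by linarith, h1, h3, ?_⟩
      have h5 : (j : ℝ) ^ 2 ≤ 16 * (j - 3 / 2) ^ 2 := by nlinarith
      calc 5 * (D * j) * (x - D * (j - 3 / 2) ^ 2) ≤ 5 * (D * j) * (5 * (D * j)) := by gcongr
        _ = 25 * D * (D * (j : ℝ) ^ 2) := by ring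
        _ ≤ 25 * D * (D * (16 * (j - 3 / 2) ^ 2)) := by gcongr
        _ = 400 * (D * (D * (j - 3 / 2) ^ 2)) := by ring
        _ ≤ _ := by gcongr

theorem stmt13 (c₁ c₂ c₃ ε : ℝ) (hc₁ : 0 < c₁) (hc₂ : 0 < c₂) (hc₃ : 0 < c₃) (hε : 0 < ε)
    (hεc : c₂ * (6 * Real.log 2 + Real.log (5 * c₃ / c₁)) < ε) :
    ∃ C₀ : ℝ, 0 < C₀ ∧
      ∀ n : ℕ, 2 ≤ n → 1 ≤ c₂ * Real.log n →
      ∀ j : ℕ, 1 ≤ j →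
      ∀ Sj : ℝ, 0 ≤ Sj →
      ∀ μ ν : Measure ℝ, IsFiniteMeasure μ → IsFiniteMeasure ν →
        μ (Itil c₁ n j)ᶜ = 0 → ν (Itil c₁ n j)ᶜ = 0 →
        (μ (Itil c₁ n j)).toReal = Sj → (ν (Itil c₁ n j)).toReal = Sj →
        (∀ k : ℕ, 1 ≤ k → (k : ℝ) ≤ c₂ * Real.log n →
          |(∫ x, (x - xctr c₁ n j) ^ k ∂μ) - ∫ x, (x - xctr c₁ n j) ^ k ∂ν| ≤
            2 * Real.sqrt (Sj * Real.log n) * (c₃ * (j : ℝ) * Real.log n / n) ^ k) →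
        ∀ f : ℝ → ℝ, LipschitzWith 1 f → f 0 = 0 →
          |(∫ x, f x ∂μ) - ∫ x, f x ∂ν| ≤
            C₀ * ((∫ x, Real.sqrt (x / ((n : ℝ) * Real.log n)) ∂(μ + ν)) +
              (j : ℝ) * Real.sqrt Sj * (n : ℝ) ^ (ε - 1)) := by
  set R : ℝ := c₃ / c₁ + 1 with hR
  have hR1 : 1 ≤ R := by rw [hR]; linarith [div_pos hc₃ hc₁]
  have hlogR : 0 < Real.log (196 * R ^ 2) := Real.log_pos (by nlinarith)
  set δ : ℝ := min (c₂ / 2) (ε / 2 / Real.log (196 * R ^ 2)) with hδ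
  have hδ0 : 0 < δ := lt_min (by positivity) (by positivity)
  have hδ1 : δ ≤ c₂ / 2 := min_le_left _ _
  have hδ2 : δ * Real.log (196 * R ^ 2) ≤ ε / 2 :=
    (le_div_iff₀ hlogR).1 (min_le_right _ _)
  set A : ℝ := 140 * Real.sqrt c₁ / δ with hA
  set A' : ℝ := 40 * c₁ * (1 + 4 / ε) ^ 2 with hA'
  have hA0 : 0 < A := by positivity
  have hA'0 : 0 < A' := by positivity
  refine ⟨A + A', by positivity, ?_⟩
  intro n hn _ j hj S hS μ ν _ _ hμI hνI hμS hνS hmom f hf hf0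
  have hn' : (2 : ℝ) ≤ n := by exact_mod_cast hn
  have hnpos : (0 : ℝ) < n := by linarith
  have hjpos : (0 : ℝ) < j := by exact_mod_cast hj
  set L : ℝ := Real.log n with hL
  have hL0 : 0 < L := Real.log_pos (by linarith)
  have hD : 0 < c₁ * L / n := by positivity
  obtain ⟨a, hac, hI⟩ := exists_leftEndpoint_Itil hj hD
  rw [← hL] at hac hI
  set D : ℝ := c₁ * L / n with hDdef
  set b : ℝ := 5 * (D * j) with hbdef
  have hb : 0 < b := by positivity
  have hμc (h : ℝ → ℝ) (hh : Continuous h) : Integrable h μ :=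
    integrable_of_continuous_of_compl_null isCompact_Icc hμI hh
  have hνc (h : ℝ → ℝ) (hh : Continuous h) : Integrable h ν :=
    integrable_of_continuous_of_compl_null isCompact_Icc hνI hh
  have huniv (κ : Measure ℝ) (hκ : κ (Itil c₁ n j)ᶜ = 0)
      (hκS : (κ (Itil c₁ n j)).toReal = S) : κ.real Set.univ = S := by
    rw [measureReal_def, ← hκS, measure_congr (Filter.eventuallyEq_univ.2 (mem_ae_iff.2 hκ)).symm]
  have hμu := huniv μ hμI hμS
  have hνu := huniv ν hνI hνS
  -- the degree is a small multiple of `ln n`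
  obtain ⟨N, hNL, hNL'⟩ : ∃ N : ℕ, (N : ℝ) ≤ δ * L ∧ δ * L ≤ (N + 1 : ℕ) := by
    refine ⟨⌊δ * L⌋₊, Nat.floor_le (by positivity), ?_⟩
    push_cast
    exact (Nat.lt_floor_add_one _).le
  have hg := lipschitzWith_one_rescale hf a hb
  obtain ⟨Q, hQdeg, hQcoeff, hQapprox⟩ :=
    exists_polynomial_approx_sqrt (Nat.succ_pos N) hg (by simp)
  rw [Nat.succ_sub_one] at hQdeg hQcoeff
  set B : ℝ := 2 * Real.sqrt (S * L) with hBdef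
  have hmom' : ∀ k ≤ 2 * N, |(∫ x, (x - xctr c₁ n j) ^ k ∂μ) -
      ∫ x, (x - xctr c₁ n j) ^ k ∂ν| ≤ B * (c₃ * j * L / n) ^ k := by
    intro k hk
    rcases Nat.eq_zero_or_pos k with rfl | hk0
    · simp [hμu, hνu, hBdef]
    · refine hmom k hk0 ?_
      have : (k : ℝ) ≤ 2 * N := by exact_mod_cast hk
      nlinarith
  have hRb : c₃ * j * L / n + |xctr c₁ n j - a| ≤ R * b := by
    have h1 : c₃ * j * L / n = c₃ / c₁ * (D * j) := by rw [hDdef]; field_simp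
    have h2 : 0 ≤ c₃ / c₁ * (D * j) := by positivity
    have h3 : 0 ≤ D * j := by positivity
    rw [h1, hR, hbdef]
    linarith
  have hpoly := abs_integral_polynomial_sub_le hμc hνc (by positivity) hb (by positivity)
    hR1 hRb hmom' hQdeg hQcoeff
  set P : ℝ → ℝ := fun x => Q.eval ((x - a) / b) with hP
  have hPc : Continuous P := Q.continuous.comp (by fun_prop)
  have hfc : Continuous f := hf.continuous
  set e : ℝ → ℝ := fun x => f x - b * P x + (b * Q.eval 0 - f a) with he
  have hec : Continuous e := by fun_prop
  have hebound : ∀ x ∈ Itil c₁ n j, |e x| ≤ A * Real.sqrt (x / (n * L)) := by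
    intro x hx
    obtain ⟨hx0, hax, hxb, hxD⟩ := hI x hx
    have h1 := hQapprox ((x - a) / b)
      ⟨div_nonneg (by linarith) hb.le, (div_le_one hb).2 hxb⟩
    have h2 : e x = b * ((f (a + b * ((x - a) / b)) - f a) / b -
        (Q.eval ((x - a) / b) - Q.eval 0)) := by
      rw [mul_div_cancel₀ _ hb.ne', add_sub_cancel, mul_sub, mul_div_cancel₀ _ hb.ne', he]
      ring
    have h3 : b * Real.sqrt ((x - a) / b) = Real.sqrt (b * (x - a)) := by
      rw [← Real.sqrt_sq hb.le, ← Real.sqrt_mul (sq_nonneg b), Real.sqrt_sq hb.le]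
      congr 1; field_simp
    have h4 : Real.sqrt (b * (x - a)) ≤ 20 * (Real.sqrt c₁ * L * Real.sqrt (x / (n * L))) := by
      refine (Real.sqrt_le_sqrt hxD).trans (le_of_eq ?_)
      have : 400 * (D * x) = (20 * L) ^ 2 * (c₁ * (x / (n * L))) := by
        rw [hDdef]; field_simp; ring
      rw [this, Real.sqrt_mul (sq_nonneg _), Real.sqrt_sq (by positivity),
        Real.sqrt_mul hc₁.le]
      ring
    have hNpos : (0 : ℝ) < (N + 1 : ℕ) := by positivity
    rw [h2, abs_mul, abs_of_pos hb]
    calc _ ≤ b * (7 * Real.sqrt ((x - a) / b) / (N + 1 : ℕ)) := by gcongr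
      _ = 7 * (b * Real.sqrt ((x - a) / b)) / (N + 1 : ℕ) := by ring
      _ ≤ 7 * (20 * (Real.sqrt c₁ * L * Real.sqrt (x / (n * L)))) / (δ * L) := by
          rw [h3]; gcongr
      _ = _ := by rw [hA]; field_simp; ring
  have heint (κ : Measure ℝ) (hκ : κ (Itil c₁ n j)ᶜ = 0)
      (hκc : ∀ h : ℝ → ℝ, Continuous h → Integrable h κ) :
      |∫ x, e x ∂κ| ≤ A * ∫ x, Real.sqrt (x / (n * L)) ∂κ := by
    rw [← integral_const_mul]
    refine abs_integral_le_integral_abs.trans ?_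
    refine integral_mono_ae (hκc _ (by fun_prop)) (hκc _ (by fun_prop)) ?_
    have : ∀ᵐ x ∂κ, x ∈ Itil c₁ n j := ae_iff.2 hκ
    filter_upwards [this] with x hx using hebound x hx
  have hesplit (κ : Measure ℝ) [IsFiniteMeasure κ] (hκS : κ.real Set.univ = S)
      (hκc : ∀ h : ℝ → ℝ, Continuous h → Integrable h κ) :
      ∫ x, f x ∂κ = (∫ x, e x ∂κ) + b * (∫ x, P x ∂κ) - S * (b * Q.eval 0 - f a) := by
    rw [he, integral_add (hκc _ (by fun_prop)) (integrable_const _),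
      integral_sub (hκc _ hfc) (hκc _ (by fun_prop)), integral_const_mul, integral_const,
      hκS, smul_eq_mul]
    ring
  have hfinal : b * ((2 * N + 1) * (2 * (N + 1) * 7 ^ (2 * N) * (B * R ^ (2 * N)))) ≤
      A' * (j * Real.sqrt S * (n : ℝ) ^ (ε - 1)) := by
    have h1 : L * Real.sqrt L ≤ (1 + 4 / ε) ^ 2 * (n : ℝ) ^ (ε / 2) :=
      log_mul_sqrt_log_le hε (by linarith)
    have h2 : ((N : ℝ) + 1) ^ 2 * (7 * R) ^ (2 * N) ≤ (n : ℝ) ^ (ε / 2) :=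
      sq_mul_pow_le_rpow hR1 (by linarith) hNL hδ2
    have h3 : (n : ℝ) ^ (ε - 1) = (n : ℝ) ^ (ε / 2) * (n : ℝ) ^ (ε / 2) / n := by
      rw [← Real.rpow_add hnpos, add_halves, Real.rpow_sub_one hnpos.ne']
    calc _ ≤ b * ((2 * (N + 1)) * (2 * (N + 1) * 7 ^ (2 * N) * (B * R ^ (2 * N)))) := by
          gcongr; linarith
      _ = 40 * c₁ * (j * Real.sqrt S) / n * (L * Real.sqrt L) *
            (((N : ℝ) + 1) ^ 2 * (7 * R) ^ (2 * N)) := by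
          rw [hbdef, hBdef, hDdef, Real.sqrt_mul hS, mul_pow]; ring
      _ ≤ 40 * c₁ * (j * Real.sqrt S) / n * ((1 + 4 / ε) ^ 2 * (n : ℝ) ^ (ε / 2)) *
            (n : ℝ) ^ (ε / 2) := by gcongr
      _ = _ := by rw [h3, hA']; ring
  have hpoly' : |b * ((∫ x, P x ∂μ) - ∫ x, P x ∂ν)| ≤
      A' * (j * Real.sqrt S * (n : ℝ) ^ (ε - 1)) := by
    rw [abs_mul, abs_of_pos hb]
    refine le_trans ?_ hfinal
    push_cast at hpoly
    exact mul_le_mul_of_nonneg_left hpoly hb.le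
  have hsqrt := integral_add_measure (μ := μ) (ν := ν)
    (f := fun x => Real.sqrt (x / ((n : ℝ) * L))) (hμc _ (by fun_prop)) (hνc _ (by fun_prop))
  have hdiff : (∫ x, f x ∂μ) - ∫ x, f x ∂ν =
      (∫ x, e x ∂μ) - (∫ x, e x ∂ν) + b * ((∫ x, P x ∂μ) - ∫ x, P x ∂ν) := by
    rw [hesplit μ hμu hμc, hesplit ν hνu hνc]; ring
  have hint0 : 0 ≤ ∫ x, Real.sqrt (x / ((n : ℝ) * L)) ∂(μ + ν) :=
    integral_nonneg fun _ => Real.sqrt_nonneg _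
  have hY0 : 0 ≤ (j : ℝ) * Real.sqrt S * (n : ℝ) ^ (ε - 1) := by positivity
  calc |(∫ x, f x ∂μ) - ∫ x, f x ∂ν|
      ≤ |∫ x, e x ∂μ| + |∫ x, e x ∂ν| + |b * ((∫ x, P x ∂μ) - ∫ x, P x ∂ν)| := by
        rw [hdiff]
        exact (abs_add_le _ _).trans (add_le_add_left (abs_sub _ _) _)
    _ ≤ A * (∫ x, Real.sqrt (x / ((n : ℝ) * L)) ∂(μ + ν)) +
          A' * (j * Real.sqrt S * (n : ℝ) ^ (ε - 1)) := by
        rw [hsqrt, mul_add]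
        exact add_le_add (add_le_add (heint μ hμI hμc) (heint ν hνI hνc)) hpoly'
    _ ≤ _ := by
        rw [mul_add]
        gcongr <;> linarith
end
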